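/- Let n ≥ 2 be an integer and let u ∈ C¹(ℝⁿ) be a weak solution of −Δₙu = e^{u} on ℝⁿ with ∫_{ℝⁿ} e^{u} dx < ∞. Then there exists C > 0 such that |u(x) + ((1/(nωₙ)) ∫_{ℝⁿ} e^{u} dx)^{1/(n−1)} log|x|| ≤ C for all x ∈ ℝⁿ with |x| ≥ 1. -/

import Mathlib

open MeasureTheory Metric Filter Topology Real Set
open scoped InnerProductSpace

/-- The Lebesgue volume of the unit ball in `ℝⁿ`. -/
noncomputable def omegaN (n : ℕ) : ℝ :=
  (volume (ball (0 : EuclideanSpace ℝ (Fin n)) 1)).toReal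

/-- `c_γ = sign γ * (|γ| / (n ωₙ))^{1/(n-1)}`. -/
noncomputable def cgamma (n : ℕ) (γ : ℝ) : ℝ :=
  Real.sign γ * (|γ| / ((n : ℝ) * omegaN n)) ^ ((1 : ℝ) / ((n : ℝ) - 1))

/-- `u` is a weak solution of `-Δₙ u = f` on `U`. -/
def IsWeakNSol (n : ℕ) (U : Set (EuclideanSpace ℝ (Fin n)))
    (u f : EuclideanSpace ℝ (Fin n) → ℝ) : Prop :=
  ∀ φ : EuclideanSpace ℝ (Fin n) → ℝ, ContDiff ℝ 1 φ → HasCompactSupport φ →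
    tsupport φ ⊆ U →
    ∫ x in U, ‖gradient u x‖ ^ (n - 2) * ⟪gradient u x, gradient φ x⟫_ℝ
      = ∫ x in U, f x * φ x

namespace NLaplace

/-- Euclidean space of dimension `n`. -/
abbrev Euc (n : ℕ) := EuclideanSpace ℝ (Fin n)

/-- The map `ξ ↦ |ξ|^{n-2} ξ`. -/
noncomputable def nflux (n : ℕ) (ξ : Euc n) : Euc n := ‖ξ‖ ^ (n - 2) • ξ

theorem continuous_nflux (n : ℕ) : Continuous (nflux n) := by
  unfold nflux; fun_prop

theorem nflux_neg (n : ℕ) (ξ : Euc n) : nflux n (-ξ) = -nflux n ξ := by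
  simp [nflux]

theorem norm_nflux {n : ℕ} (hn : 2 ≤ n) (ξ : Euc n) : ‖nflux n ξ‖ = ‖ξ‖ ^ (n - 1) := by
  obtain ⟨k, rfl⟩ := Nat.exists_eq_add_of_le' hn
  simp [nflux, norm_smul, pow_succ]

theorem inner_nflux_self {n : ℕ} (hn : 2 ≤ n) (ξ : Euc n) : ⟪nflux n ξ, ξ⟫_ℝ = ‖ξ‖ ^ n := by
  obtain ⟨k, rfl⟩ := Nat.exists_eq_add_of_le' hn
  simp [nflux, real_inner_smul_left, pow_add]

theorem nflux_smul {n : ℕ} (hn : 2 ≤ n) {c : ℝ} (hc : 0 ≤ c) (ξ : Euc n) :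
    nflux n (c • ξ) = c ^ (n - 1) • nflux n ξ := by
  obtain ⟨k, rfl⟩ := Nat.exists_eq_add_of_le' hn
  simp only [nflux, norm_smul, Real.norm_of_nonneg hc, smul_smul]
  congr 1
  simp only [Nat.add_sub_cancel, show k + 2 - 1 = k + 1 by omega]
  ring

theorem inner_nflux_sub (n : ℕ) (a b : Euc n) :
    ⟪nflux n a - nflux n b, a - b⟫_ℝ = (‖a‖ ^ (n - 2) + ‖b‖ ^ (n - 2)) / 2 * ‖a - b‖ ^ 2 +
      (‖a‖ ^ (n - 2) - ‖b‖ ^ (n - 2)) * (‖a‖ ^ 2 - ‖b‖ ^ 2) / 2 := by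
  simp only [nflux, inner_sub_left, inner_sub_right, real_inner_smul_left,
    @norm_sub_sq_real _ _ _ a b, real_inner_self_eq_norm_sq, real_inner_comm a b]
  ring

theorem pow_sub_pow_mul_sq_sub_sq_nonneg {s t : ℝ} (hs : 0 ≤ s) (ht : 0 ≤ t) (k : ℕ) :
    0 ≤ (s ^ k - t ^ k) * (s ^ 2 - t ^ 2) := by
  rcases le_total s t with h | h
  · exact mul_nonneg_of_nonpos_of_nonpos (sub_nonpos.2 (by gcongr)) (sub_nonpos.2 (by gcongr))
  · exact mul_nonneg (sub_nonneg.2 (by gcongr)) (sub_nonneg.2 (by gcongr))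

theorem inner_nflux_sub_nonneg (n : ℕ) (a b : Euc n) : 0 ≤ ⟪nflux n a - nflux n b, a - b⟫_ℝ := by
  have h := pow_sub_pow_mul_sq_sub_sq_nonneg (norm_nonneg a) (norm_nonneg b) (n - 2)
  rw [inner_nflux_sub]
  positivity

theorem inner_nflux_sub_pos {n : ℕ} {a b : Euc n} (hab : a ≠ b) :
    0 < ⟪nflux n a - nflux n b, a - b⟫_ℝ := by
  have h := pow_sub_pow_mul_sq_sub_sq_nonneg (norm_nonneg a) (norm_nonneg b) (n - 2)
  have h3 : 0 < ‖a - b‖ := norm_pos_iff.2 (sub_ne_zero.2 hab)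
  have h4 : 0 < ‖a‖ ^ (n - 2) + ‖b‖ ^ (n - 2) := by
    by_cases ha : a = 0
    · have : 0 < ‖b‖ := norm_pos_iff.2 fun h => hab (ha.trans h.symm)
      positivity
    · have : 0 < ‖a‖ := norm_pos_iff.2 ha
      positivity
  rw [inner_nflux_sub]
  positivity

/-! ### Calculus of gradients -/

theorem continuous_gradient {n : ℕ} {u : Euc n → ℝ} (hu : ContDiff ℝ 1 u) :
    Continuous (gradient u) :=
  (InnerProductSpace.toDual ℝ (Euc n)).symm.continuous.comp (hu.continuous_fderiv one_ne_zero)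

theorem continuousAt_gradient {n : ℕ} {u : Euc n → ℝ} {x : Euc n} (hu : ContDiffAt ℝ 1 u x) :
    ContinuousAt (gradient u) x :=
  (InnerProductSpace.toDual ℝ (Euc n)).symm.continuous.continuousAt.comp
    (hu.continuousAt_fderiv one_ne_zero)

theorem hasGradientAt_of_contDiff {n : ℕ} {u : Euc n → ℝ} (hu : ContDiff ℝ 1 u) (x : Euc n) :
    HasGradientAt u (gradient u x) x :=
  (hu.differentiable one_ne_zero x).hasGradientAt

theorem norm_gradient {n : ℕ} (u : Euc n → ℝ) (x : Euc n) : ‖gradient u x‖ = ‖fderiv ℝ u x‖ := by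
  simp [gradient]

theorem hasGradientAt_comp {n : ℕ} {u : Euc n → ℝ} {x g : Euc n} {θ : ℝ → ℝ} {θ' : ℝ}
    (hθ : HasDerivAt θ θ' (u x)) (hu : HasGradientAt u g x) :
    HasGradientAt (fun y => θ (u y)) (θ' • g) x := by
  rw [hasGradientAt_iff_hasFDerivAt] at *
  rw [map_smul]
  exact hθ.comp_hasFDerivAt x hu

theorem gradient_eq_zero_of_notMem_tsupport {n : ℕ} {φ : Euc n → ℝ} {x : Euc n}
    (hx : x ∉ tsupport φ) : gradient φ x = 0 := by
  have h : φ =ᶠ[𝓝 x] fun _ => (0 : ℝ) := notMem_tsupport_iff_eventuallyEq.1 hx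
  have : HasGradientAt φ 0 x := by
    rw [hasGradientAt_iff_hasFDerivAt, map_zero]
    exact (hasFDerivAt_const (0 : ℝ) x).congr_of_eventuallyEq h
  exact this.gradient

theorem contDiff_one_of_tsupport {n : ℕ} {φ : Euc n → ℝ}
    (h : ∀ x ∈ tsupport φ, ContDiffAt ℝ 1 φ x) : ContDiff ℝ 1 φ := by
  rw [contDiff_iff_contDiffAt]
  intro x
  by_cases hx : x ∈ tsupport φ
  · exact h x hx
  · have h : φ =ᶠ[𝓝 x] fun _ => (0 : ℝ) := notMem_tsupport_iff_eventuallyEq.1 hx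
    exact contDiffAt_const.congr_of_eventuallyEq h

theorem hasCompactSupport_gradient {n : ℕ} {φ : Euc n → ℝ} (h : HasCompactSupport φ) :
    HasCompactSupport (gradient φ) :=
  HasCompactSupport.intro h fun _ hx => gradient_eq_zero_of_notMem_tsupport hx

/-- The primitive of `χ` vanishing at `a`. -/
noncomputable def primitive (χ : ℝ → ℝ) (a s : ℝ) : ℝ := ∫ t in a..s, χ t

theorem hasDerivAt_primitive {χ : ℝ → ℝ} (hχ : Continuous χ) (a s : ℝ) :
    HasDerivAt (primitive χ a) (χ s) s :=
  intervalIntegral.integral_hasDerivAt_right (hχ.intervalIntegrable _ _)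
    hχ.aestronglyMeasurable.stronglyMeasurableAtFilter hχ.continuousAt

theorem contDiff_primitive {χ : ℝ → ℝ} (hχ : Continuous χ) (a : ℝ) :
    ContDiff ℝ 1 (primitive χ a) := by
  rw [contDiff_one_iff_deriv]
  refine ⟨fun s => (hasDerivAt_primitive hχ a s).differentiableAt, ?_⟩
  convert hχ
  exact funext fun s => (hasDerivAt_primitive hχ a s).deriv

/-! ### The comparison principle -/

theorem primitive_pos_part_of_nonpos {s : ℝ} (hs : s ≤ 0) :
    primitive (fun t => max t 0) 0 s = 0 := by
  rw [primitive, intervalIntegral.integral_congr (g := fun _ => 0)]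
  · simp
  · intro t ht
    rw [uIcc_of_ge hs] at ht
    exact max_eq_right ht.2

theorem primitive_pos_part_pos {s : ℝ} (hs : 0 < s) : 0 < primitive (fun t => max t 0) 0 s := by
  refine intervalIntegral.intervalIntegral_pos_of_pos_on ?_ (fun t ht => ?_) hs
  · exact (continuous_id.max continuous_const).intervalIntegrable _ _
  · exact lt_max_of_lt_left ht.1

theorem primitive_pos_part_nonneg (s : ℝ) : 0 ≤ primitive (fun t => max t 0) 0 s := by
  rcases le_or_gt s 0 with h | h
  · exact (primitive_pos_part_of_nonpos h).ge
  · exact (primitive_pos_part_pos h).le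

theorem comparison_principle {n : ℕ} (hn : 2 ≤ n) {Ω V : Set (Euc n)} (hΩ : IsOpen Ω)
    (hb : Bornology.IsBounded Ω) (hV : IsOpen V) (hΩV : closure Ω ⊆ V) {v z : Euc n → ℝ}
    (hv : ContDiffOn ℝ 1 v V) (hz : ContDiffOn ℝ 1 z V) (hle : ∀ x ∈ frontier Ω, v x ≤ z x)
    (hw : ∀ φ : Euc n → ℝ, ContDiff ℝ 1 φ → HasCompactSupport φ → tsupport φ ⊆ Ω →
      (∀ x, 0 ≤ φ x) →
      ∫ x, ⟪nflux n (gradient v x) - nflux n (gradient z x), gradient φ x⟫_ℝ ≤ 0) :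
    ∀ x ∈ Ω, v x ≤ z x := by
  have : Nonempty (Fin n) := ⟨⟨0, by omega⟩⟩
  by_contra! hcon
  obtain ⟨x₀, hx₀, hlt⟩ := hcon
  set ε := (v x₀ - z x₀) / 2 with hε
  have hεpos : 0 < ε := by rw [hε]; linarith
  set θ := primitive (fun t => max t 0) 0
  have hχ : Continuous fun t : ℝ => max t 0 := continuous_id.max continuous_const
  set φ : Euc n → ℝ := Ω.indicator fun x => θ (v x - z x - ε) with hφ
  have hφΩ : ∀ x ∈ Ω, φ x = θ (v x - z x - ε) := fun x hx => indicator_of_mem hx _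
  set K := closure Ω ∩ {x | ε ≤ v x - z x} with hK
  have hKc : IsClosed K := by
    have : ContinuousOn (fun x => v x - z x) (closure Ω) :=
      (hv.continuousOn.mono hΩV).sub (hz.continuousOn.mono hΩV)
    exact this.preimage_isClosed_of_isClosed isClosed_closure isClosed_Ici
  have hKcomp : IsCompact K := (hb.isCompact_closure).of_isClosed_subset hKc inter_subset_left
  have hKΩ : K ⊆ Ω := by
    rintro x ⟨hx1, hx2⟩
    by_contra hx
    have := hle x (by rw [hΩ.frontier_eq]; exact ⟨hx1, hx⟩)
    simp only [mem_ofPred_eq] at hx2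
    linarith
  have hsupp : tsupport φ ⊆ K := by
    refine closure_minimal (fun x hx => ?_) hKc
    by_contra hxK
    apply hx
    by_cases hxΩ : x ∈ Ω
    · rw [hφΩ x hxΩ]
      refine primitive_pos_part_of_nonpos ?_
      by_contra! h
      exact hxK ⟨subset_closure hxΩ, by simp only [mem_ofPred_eq]; linarith⟩
    · exact indicator_of_notMem hxΩ _
  have hΩV' : Ω ⊆ V := subset_closure.trans hΩV
  have hvat : ∀ x ∈ Ω, ContDiffAt ℝ 1 v x := fun x hx => hv.contDiffAt (hV.mem_nhds (hΩV' hx))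
  have hzat : ∀ x ∈ Ω, ContDiffAt ℝ 1 z x := fun x hx => hz.contDiffAt (hV.mem_nhds (hΩV' hx))
  have heq : ∀ x ∈ Ω, φ =ᶠ[𝓝 x] fun x => θ (v x - z x - ε) := fun x hx =>
    Filter.eventually_of_mem (hΩ.mem_nhds hx) hφΩ
  have hφc : HasCompactSupport φ := hKcomp.of_isClosed_subset (isClosed_tsupport _) hsupp
  have hφ1 : ContDiff ℝ 1 φ := by
    refine contDiff_one_of_tsupport fun x hx => ?_
    have hxΩ := hKΩ (hsupp hx)
    refine ContDiffAt.congr_of_eventuallyEq ?_ (heq x hxΩ)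
    exact (contDiff_primitive hχ 0).contDiffAt.comp x
      (((hvat x hxΩ).sub (hzat x hxΩ)).sub contDiffAt_const)
  have hgrad : ∀ x ∈ Ω, gradient φ x =
      max (v x - z x - ε) 0 • (gradient v x - gradient z x) := by
    intro x hx
    have h1 : HasGradientAt (fun x => v x - z x - ε) (gradient v x - gradient z x) x := by
      rw [hasGradientAt_iff_hasFDerivAt, map_sub]
      exact (((hvat x hx).differentiableAt one_ne_zero).hasGradientAt.hasFDerivAt.sub
        ((hzat x hx).differentiableAt one_ne_zero).hasGradientAt.hasFDerivAt).sub_const ε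
    have h2 := hasGradientAt_comp (hasDerivAt_primitive hχ 0 (v x - z x - ε)) h1
    have h3 : HasGradientAt φ _ x := HasFDerivAt.congr_of_eventuallyEq h2 (heq x hx)
    exact h3.gradient
  set F : Euc n → ℝ := fun x =>
    ⟪nflux n (gradient v x) - nflux n (gradient z x), gradient φ x⟫_ℝ with hF
  have hF0 : ∀ x, 0 ≤ F x := by
    intro x
    by_cases hx : x ∈ Ω
    · simp only [hF, hgrad x hx, real_inner_smul_right]
      exact mul_nonneg (le_max_right _ _) (inner_nflux_sub_nonneg _ _ _)
    · simp only [hF]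
      rw [gradient_eq_zero_of_notMem_tsupport fun h => hx (hKΩ (hsupp h)), inner_zero_right]
  have hFsupp : tsupport F ⊆ tsupport φ := by
    refine closure_minimal (fun x hx => ?_) (isClosed_tsupport _)
    by_contra h
    exact hx (by simp only [hF, gradient_eq_zero_of_notMem_tsupport h, inner_zero_right])
  have hFc : HasCompactSupport F := hφc.of_isClosed_subset (isClosed_tsupport _) hFsupp
  have hFcont : Continuous F := by
    refine continuous_of_tsupport fun x hx => ?_
    have hxΩ := hKΩ (hsupp (hFsupp hx))
    exact (((continuous_nflux n).continuousAt.comp (continuousAt_gradient (hvat x hxΩ))).sub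
      ((continuous_nflux n).continuousAt.comp (continuousAt_gradient (hzat x hxΩ)))).inner
      (continuous_gradient hφ1).continuousAt
  have hint : ∫ x, F x ≤ 0 := by
    refine hw φ hφ1 hφc (hsupp.trans hKΩ) fun x => ?_
    exact indicator_nonneg (fun _ _ => primitive_pos_part_nonneg _) x
  have hFz : ∀ x, F x = 0 := by
    intro x
    by_contra h
    have := hFcont.integral_pos_of_hasCompactSupport_nonneg_nonzero (μ := volume) hFc hF0 h
    linarith
  have hgz : ∀ x, fderiv ℝ φ x = 0 := by
    intro x
    rw [← norm_eq_zero, ← norm_gradient, norm_eq_zero]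
    by_cases hx : x ∈ Ω
    · have h := hFz x
      simp only [hF, hgrad x hx, real_inner_smul_right] at h
      rw [hgrad x hx]
      rcases mul_eq_zero.1 h with h | h
      · rw [h, zero_smul]
      · by_cases hab : gradient v x = gradient z x
        · simp [hab]
        · exact absurd h (inner_nflux_sub_pos hab).ne'
    · exact gradient_eq_zero_of_notMem_tsupport fun h => hx (hKΩ (hsupp h))
  obtain ⟨y, hy⟩ : ∃ y, y ∉ tsupport φ := by
    by_contra! h
    have : tsupport φ = univ := eq_univ_of_forall h
    exact noncompact_univ (Euc n) (this ▸ hφc)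
  have hc := is_const_of_fderiv_eq_zero (hφ1.differentiable one_ne_zero) hgz x₀ y
  rw [image_eq_zero_of_notMem_tsupport hy, hφΩ x₀ hx₀] at hc
  exact (primitive_pos_part_pos (by linarith : 0 < v x₀ - z x₀ - ε)).ne' hc

/-! ### Hölder's inequality with integer exponents -/

theorem integral_pow_mul_pow_le {α : Type*} [MeasurableSpace α] {μ : Measure α} {n : ℕ}
    (hn : 2 ≤ n) {f g : α → ℝ} (hf0 : ∀ x, 0 ≤ f x) (hg0 : ∀ x, 0 ≤ g x)
    (hfm : AEStronglyMeasurable f μ) (hgm : AEStronglyMeasurable g μ)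
    (hf : Integrable (fun x => f x ^ n) μ) (hg : Integrable (fun x => g x ^ n) μ) :
    (∫ x, f x ^ (n - 1) * g x ∂μ) ^ n ≤ (∫ x, f x ^ n ∂μ) ^ (n - 1) * ∫ x, g x ^ n ∂μ := by
  have hn0 : (n : ℝ) ≠ 0 := by positivity
  have hn1 : (1 : ℝ) < n := by exact_mod_cast hn
  have hn1' : ((n - 1 : ℕ) : ℝ) = (n : ℝ) - 1 := by push_cast [show 1 ≤ n by omega]; ring
  have hpq : (n : ℝ).HolderConjugate ((n : ℝ) / ((n : ℝ) - 1)) :=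
    Real.HolderConjugate.conjExponent hn1
  have hfp : ∀ x, (f x ^ (n - 1)) ^ ((n : ℝ) / ((n : ℝ) - 1)) = f x ^ n := by
    intro x
    rw [← Real.rpow_natCast, ← Real.rpow_mul (hf0 x), hn1', mul_div_cancel₀ _ (by linarith),
      Real.rpow_natCast]
  have hq0 : 0 < (n : ℝ) / ((n : ℝ) - 1) := hpq.symm.pos
  have hmf : MemLp (fun x => f x ^ (n - 1)) (ENNReal.ofReal ((n : ℝ) / ((n : ℝ) - 1))) μ := by
    refine (integrable_norm_rpow_iff (hfm.pow _) (by simpa using hq0) ENNReal.ofReal_ne_top).1 ?_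
    rw [ENNReal.toReal_ofReal hq0.le]
    refine hf.congr (ae_of_all _ fun x => ?_)
    simp only [Pi.pow_apply, Real.norm_of_nonneg (pow_nonneg (hf0 x) _), hfp]
  have hmg : MemLp g (ENNReal.ofReal (n : ℝ)) μ := by
    rw [← integrable_norm_rpow_iff hgm (by simp; omega) ENNReal.ofReal_ne_top,
      ENNReal.toReal_ofReal (by positivity)]
    refine hg.congr (ae_of_all _ fun x => ?_)
    simp only [Real.norm_of_nonneg (hg0 x), Real.rpow_natCast]
  have h := integral_mul_le_Lp_mul_Lq_of_nonneg hpq.symm (ae_of_all _ fun x => pow_nonneg (hf0 x) _)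
    (ae_of_all _ hg0) hmf hmg
  simp only [hfp, Real.rpow_natCast] at h
  have hI : 0 ≤ ∫ x, f x ^ n ∂μ := integral_nonneg fun x => pow_nonneg (hf0 x) _
  have hJ : 0 ≤ ∫ x, g x ^ n ∂μ := integral_nonneg fun x => pow_nonneg (hg0 x) _
  calc (∫ x, f x ^ (n - 1) * g x ∂μ) ^ n ≤ _ :=
        pow_le_pow_left₀ (integral_nonneg fun x => mul_nonneg (pow_nonneg (hf0 x) _) (hg0 x)) h n
    _ = _ := by
        rw [mul_pow, ← Real.rpow_natCast, ← Real.rpow_natCast, ← Real.rpow_mul hI,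
          ← Real.rpow_mul hJ, one_div_mul_cancel hn0, Real.rpow_one, one_div_div,
          div_mul_cancel₀ _ hn0, ← hn1', Real.rpow_natCast]


theorem nontrivial_euc {n : ℕ} (hn : 2 ≤ n) : Nontrivial (Euc n) := by
  have : NeZero n := ⟨by omega⟩
  infer_instance

/-- Integration in polar coordinates. -/
theorem integral_polar {n : ℕ} (hn : 2 ≤ n) {F : Euc n → ℝ} (hF : Integrable F) :
    ∫ x, F x = ∫ θ : sphere (0 : Euc n) 1, (∫ r in Ioi (0 : ℝ), r ^ (n - 1) * F (r • θ.1))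
      ∂(volume : Measure (Euc n)).toSphere := by
  have hnt := nontrivial_euc hn
  have hmp := (volume : Measure (Euc n)).measurePreserving_homeomorphUnitSphereProd
  have hemb := (homeomorphUnitSphereProd (Euc n)).measurableEmbedding
  have h0 : ∀ x : ({(0 : Euc n)}ᶜ : Set (Euc n)),
      ((homeomorphUnitSphereProd (Euc n) x).2.1 • (homeomorphUnitSphereProd (Euc n) x).1.1) = x.1 := by
    intro x
    have hx : ‖x.1‖ ≠ 0 := norm_ne_zero_iff.2 x.2
    simp [homeomorphUnitSphereProd, smul_smul, hx]
  have h1 : ∫ x, F x = ∫ x : ({(0)}ᶜ : Set (Euc n)), F x ∂((volume : Measure (Euc n)).comap (↑)) := by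
    rw [integral_subtype_comap (measurableSet_singleton _).compl fun x ↦ F x,
        restrict_compl_singleton]
  have h2 := hmp.integral_comp hemb (fun p => F (p.2.1 • p.1.1))
  simp only [h0] at h2
  have hi : Integrable (fun x : ({(0)}ᶜ : Set (Euc n)) => F x)
      ((volume : Measure (Euc n)).comap (↑)) := by
    rw [← Function.comp_def F, ← integrableOn_iff_comap_subtypeVal (by measurability)]
    exact hF.integrableOn
  have h3 := (hmp.integrable_comp_emb hemb (g := fun p => F (p.2.1 • p.1.1))).1 (by
    simpa only [Function.comp_def, h0] using hi)
  rw [h1, h2, integral_prod _ h3]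
  have hfr : Module.finrank ℝ (Euc n) = n := by simp
  refine integral_congr_ae (Eventually.of_forall fun θ => ?_)
  simp only [Measure.volumeIoiPow, ENNReal.ofReal]
  rw [integral_withDensity_eq_integral_smul (by fun_prop),
    integral_subtype_comap measurableSet_Ioi
      fun a ↦ Real.toNNReal (a ^ (Module.finrank ℝ (Euc n) - 1)) • F (a • θ.1),
        setIntegral_congr_fun measurableSet_Ioi fun x hx ↦ ?_]
  rw [NNReal.smul_def, Real.coe_toNNReal _ (pow_nonneg hx.out.le _), hfr, smul_eq_mul]

theorem toSphere_real_univ {n : ℕ} (hn : 2 ≤ n) :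
    (volume : Measure (Euc n)).toSphere.real univ = n * omegaN n := by
  have hnt := nontrivial_euc hn
  rw [Measure.toSphere_real_apply_univ]
  simp [omegaN, Measure.real]

theorem omegaN_pos (n : ℕ) : 0 < omegaN n :=
  ENNReal.toReal_pos (measure_ball_pos _ _ one_pos).ne' measure_ball_lt_top.ne

theorem mul_omegaN_pos {n : ℕ} (hn : 2 ≤ n) : 0 < n * omegaN n :=
  mul_pos (by exact_mod_cast (by omega : 0 < n)) (omegaN_pos n)

theorem hasDerivAt_ray {n : ℕ} {φ : Euc n → ℝ} (hφ : ContDiff ℝ 1 φ) (θ : Euc n) (r : ℝ) :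
    HasDerivAt (fun r : ℝ => φ (r • θ)) ⟪gradient φ (r • θ), θ⟫_ℝ r := by
  have h1 := (hasGradientAt_of_contDiff hφ (r • θ)).hasFDerivAt
  have h2 : HasDerivAt (fun r : ℝ => r • θ) θ r := by
    simpa using (hasDerivAt_id r).smul_const θ
  have h3 := h1.comp_hasDerivAt r h2
  rwa [InnerProductSpace.toDual_apply_apply] at h3

theorem hasCompactSupport_ray {n : ℕ} {φ : Euc n → ℝ} (h : HasCompactSupport φ) {θ : Euc n}
    (hθ : ‖θ‖ = 1) : HasCompactSupport (fun r : ℝ => φ (r • θ)) := by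
  obtain ⟨R, hR⟩ := h.isBounded.subset_closedBall 0
  refine HasCompactSupport.intro (isCompact_closedBall (0 : ℝ) R) fun r hr => ?_
  by_contra hne
  have := hR (subset_tsupport _ hne)
  simp [norm_smul, hθ] at this hr
  linarith

theorem integrable_of_continuous_away {n : ℕ} {F : Euc n → ℝ} {ε : ℝ} (hε : 0 < ε)
    (h0 : ∀ x ∈ ball (0 : Euc n) ε, F x = 0) (hc : ContinuousOn F {0}ᶜ)
    (hs : HasCompactSupport F) : Integrable F := by
  refine Continuous.integrable_of_hasCompactSupport ?_ hs
  rw [continuous_iff_continuousAt]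
  intro x
  by_cases hx : x = 0
  · subst hx
    refine (continuousAt_const (y := (0 : ℝ))).congr ?_
    filter_upwards [ball_mem_nhds (0 : Euc n) hε] with x hx using (h0 x hx).symm
  · exact hc.continuousAt (isOpen_compl_singleton.mem_nhds hx)

/-- The radial field `x / |x|^n` has divergence `n ωₙ δ₀`. -/
theorem integral_radial_eq_neg {n : ℕ} (hn : 2 ≤ n) {φ : Euc n → ℝ} (hφ : ContDiff ℝ 1 φ)
    (hs : HasCompactSupport φ) {ε : ℝ} (hε : 0 < ε) (h0 : ∀ x ∈ ball (0 : Euc n) ε, φ x = φ 0) :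
    ∫ x, ⟪x, gradient φ x⟫_ℝ / ‖x‖ ^ n = -(n * omegaN n * φ 0) := by
  have hg0 : ∀ x ∈ ball (0 : Euc n) ε, gradient φ x = 0 := by
    intro x hx
    have : φ =ᶠ[𝓝 x] fun _ => φ 0 := by
      filter_upwards [isOpen_ball.mem_nhds hx] with y hy using h0 y hy
    rw [this.gradient.eq_of_nhds]; simp
  have hint : Integrable fun x => ⟪x, gradient φ x⟫_ℝ / ‖x‖ ^ n := by
    refine integrable_of_continuous_away hε (fun x hx => by rw [hg0 x hx]; simp) ?_ ?_
    · refine ContinuousOn.div ?_ (by fun_prop) fun x hx => pow_ne_zero _ (norm_ne_zero_iff.2 hx)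
      have := continuous_gradient hφ
      exact Continuous.continuousOn (by fun_prop)
    · refine (hasCompactSupport_gradient hs).mono' ?_
      intro x hx
      by_contra h
      have hz : gradient φ x = 0 := by
        by_contra h2; exact h (subset_tsupport _ h2)
      apply hx
      simp only [hz]; simp
  rw [integral_polar hn hint]
  have key : ∀ θ : sphere (0 : Euc n) 1, (∫ r in Ioi (0 : ℝ), r ^ (n - 1) *
      (⟪r • θ.1, gradient φ (r • θ.1)⟫_ℝ / ‖r • θ.1‖ ^ n)) = -φ 0 := by
    intro θ
    have hθ : ‖θ.1‖ = 1 := by simp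
    have e1 : EqOn (fun r : ℝ => r ^ (n - 1) *
      (⟪r • θ.1, gradient φ (r • θ.1)⟫_ℝ / ‖r • θ.1‖ ^ n))
      (deriv fun r : ℝ => φ (r • θ.1)) (Ioi 0) := by
      intro r hr
      have hr' : 0 < r := hr
      simp only [(hasDerivAt_ray hφ θ.1 r).deriv, norm_smul, hθ, Real.norm_of_nonneg hr'.le,
        real_inner_smul_left, mul_one, real_inner_comm]
      obtain ⟨k, rfl⟩ := Nat.exists_eq_add_of_le' hn
      rw [show k + 2 - 1 = k + 1 by omega]
      field_simp
      ring
    rw [setIntegral_congr_fun measurableSet_Ioi e1,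
      HasCompactSupport.integral_Ioi_deriv_eq ?_ (hasCompactSupport_ray hs hθ)]
    · simp
    · exact hφ.comp (contDiff_id.smul contDiff_const)
  simp only [key]
  rw [integral_const, toSphere_real_univ hn]
  simp

/-- The divergence of a general radial field away from the origin. -/
theorem integral_radial_mul {n : ℕ} (hn : 2 ≤ n) {φ : Euc n → ℝ} (hφ : ContDiff ℝ 1 φ)
    (hs : HasCompactSupport φ) (h0 : (0 : Euc n) ∉ tsupport φ) {H H' : ℝ → ℝ}
    (hH : ∀ r, 0 < r → HasDerivAt H (H' r) r) (hH' : ContinuousOn H' (Ioi 0)) :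
    ∫ x, H ‖x‖ / ‖x‖ ^ n * ⟪x, gradient φ x⟫_ℝ = -∫ x, H' ‖x‖ / ‖x‖ ^ (n - 1) * φ x := by
  obtain ⟨ε, hε, hball⟩ := Metric.isOpen_iff.1 (isClosed_tsupport φ).isOpen_compl 0 h0
  have hφ0 : ∀ x ∈ ball (0 : Euc n) ε, φ x = 0 := fun x hx => image_eq_zero_of_notMem_tsupport (hball hx)
  have hg0 : ∀ x ∈ ball (0 : Euc n) ε, gradient φ x = 0 := fun x hx =>
    gradient_eq_zero_of_notMem_tsupport (hball hx)
  have hnc : MapsTo (fun x : Euc n => ‖x‖) {0}ᶜ (Ioi 0) := fun x hx => norm_pos_iff.2 hx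
  have hHc : ContinuousOn H (Ioi 0) := fun r hr => (hH r hr).continuousAt.continuousWithinAt
  have hcg := continuous_gradient hφ
  have hcφ := hφ.continuous
  have hint : Integrable fun x => H ‖x‖ / ‖x‖ ^ n * ⟪x, gradient φ x⟫_ℝ := by
    refine integrable_of_continuous_away hε (fun x hx => by rw [hg0 x hx]; simp) ?_ ?_
    · refine ContinuousOn.mul (ContinuousOn.div (hHc.comp continuous_norm.continuousOn hnc)
        (by fun_prop) fun x hx => pow_ne_zero _ (norm_ne_zero_iff.2 hx)) ?_
      exact Continuous.continuousOn (by fun_prop)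
    · refine (hasCompactSupport_gradient hs).mono' ?_
      intro x hx
      by_contra h
      have hz : gradient φ x = 0 := by
        by_contra h2; exact h (subset_tsupport _ h2)
      apply hx
      simp only [hz]; simp
  have hint2 : Integrable fun x => H' ‖x‖ / ‖x‖ ^ (n - 1) * φ x := by
    refine integrable_of_continuous_away hε (fun x hx => by rw [hφ0 x hx]; simp) ?_ ?_
    · exact ContinuousOn.mul (ContinuousOn.div (hH'.comp continuous_norm.continuousOn hnc)
        (by fun_prop) fun x hx => pow_ne_zero _ (norm_ne_zero_iff.2 hx)) hcφ.continuousOn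
    · exact hs.mul_left
  rw [integral_polar hn hint, integral_polar hn hint2, ← integral_neg]
  refine integral_congr_ae (Eventually.of_forall fun θ => ?_)
  have hθ : ‖θ.1‖ = 1 := by simp
  have hmem : ∀ r : ℝ, 0 ≤ r → r < ε → r • θ.1 ∈ ball (0 : Euc n) ε := by
    intro r hr hr2
    simp [norm_smul, hθ, abs_of_nonneg hr, hr2]
  have e1 : EqOn (fun r : ℝ => r ^ (n - 1) *
      (H ‖r • θ.1‖ / ‖r • θ.1‖ ^ n * ⟪r • θ.1, gradient φ (r • θ.1)⟫_ℝ))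
      (fun r => H r * ⟪gradient φ (r • θ.1), θ.1⟫_ℝ) (Ioi 0) := by
    intro r hr
    have hr' : 0 < r := hr
    simp only [norm_smul, hθ, Real.norm_of_nonneg hr'.le,
      real_inner_smul_left, mul_one, real_inner_comm]
    obtain ⟨k, rfl⟩ := Nat.exists_eq_add_of_le' hn
    rw [show k + 2 - 1 = k + 1 by omega]
    field_simp
    ring
  have e2 : EqOn (fun r : ℝ => r ^ (n - 1) *
      (H' ‖r • θ.1‖ / ‖r • θ.1‖ ^ (n - 1) * φ (r • θ.1)))
      (fun r => H' r * φ (r • θ.1)) (Ioi 0) := by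
    intro r hr
    have hr' : 0 < r := hr
    simp only [norm_smul, hθ, Real.norm_of_nonneg hr'.le, mul_one]
    field_simp
  simp only
  rw [setIntegral_congr_fun measurableSet_Ioi e1, setIntegral_congr_fun measurableSet_Ioi e2]
  have hsupp := hasCompactSupport_ray hs hθ
  obtain ⟨R, hR⟩ := hsupp.isBounded.subset_closedBall 0
  have hzero : ∀ r, R < r → φ (r • θ.1) = 0 := by
    intro r hr
    by_contra hne
    have := hR (subset_tsupport _ (show r ∈ Function.support fun r : ℝ => φ (r • θ.1) from hne))
    simp at this
    linarith [le_abs_self r]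
  -- both integrands vanish off `[ε/2, R+1]`
  have hzg : ∀ r, R < r → ⟪gradient φ (r • θ.1), θ.1⟫_ℝ = 0 := by
    intro r hr
    rw [← (hasDerivAt_ray hφ θ.1 r).deriv]
    have : (fun r : ℝ => φ (r • θ.1)) =ᶠ[𝓝 r] fun _ => 0 := by
      filter_upwards [lt_mem_nhds hr] with s hs using hzero s hs
    rw [this.deriv_eq]; simp
  have hb : ∀ (K : ℝ → ℝ) (p : ℝ → ℝ), ContinuousOn K (Ioi 0) → Continuous p →
      (∀ r, 0 ≤ r → r < ε → p r = 0) → (∀ r, R < r → p r = 0) →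
      IntegrableOn (fun r => K r * p r) (Ioi 0) := by
    intro K p hK hp h1 h2
    have : IntegrableOn (fun r => K r * p r) (Icc (ε / 2) R) := by
      refine ContinuousOn.integrableOn_Icc (ContinuousOn.mul (hK.mono ?_) hp.continuousOn)
      intro r hr; exact lt_of_lt_of_le (by positivity) hr.1
    refine this.of_forall_sdiff_eq_zero measurableSet_Ioi ?_
    intro r hr
    have hr0 : 0 < r := hr.1
    rcases lt_or_ge r ε with h | h
    · rw [h1 r hr0.le h, mul_zero]
    · have : R < r := by
        by_contra h3
        exact hr.2 ⟨by linarith, not_lt.1 h3⟩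
      rw [h2 r this, mul_zero]
  have I1 := hb H (fun r => ⟪gradient φ (r • θ.1), θ.1⟫_ℝ) hHc (by fun_prop)
    (fun r h1 h2 => by rw [hg0 _ (hmem r h1 h2)]; simp) hzg
  have I2 := hb H' (fun r => φ (r • θ.1)) hH' (by fun_prop)
    (fun r h1 h2 => hφ0 _ (hmem r h1 h2)) hzero
  have hlim1 : Tendsto (fun r => H r * φ (r • θ.1)) atTop (𝓝 0) := by
    refine tendsto_const_nhds.congr' ?_
    filter_upwards [eventually_gt_atTop R] with r hr
    rw [hzero r hr, mul_zero]
  have := integral_Ioi_of_hasDerivAt_of_tendsto' (f := fun r => Function.update (fun r => H r * φ (r • θ.1)) 0 0 r)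
    (f' := fun r => H' r * φ (r • θ.1) + H r * ⟪gradient φ (r • θ.1), θ.1⟫_ℝ) (a := 0) (m := 0)
    ?_ (I2.add I1) ?_
  · rw [integral_add I2 I1] at this
    rw [Function.update_self, sub_zero] at this
    linarith
  · intro r hr
    rcases eq_or_lt_of_le (show (0:ℝ) ≤ r from hr) with h | h
    · subst h
      have hz : (0 : Euc n) ∈ ball (0 : Euc n) ε := mem_ball_self hε
      have e : (fun r => Function.update (fun r => H r * φ (r • θ.1)) 0 0 r) =ᶠ[𝓝 0] fun _ => (0 : ℝ) := by
        filter_upwards [ball_mem_nhds (0 : ℝ) hε] with r hr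
        by_cases h : r = 0
        · simp [h]
        · rw [Function.update_of_ne h, hφ0 _ (by simpa [norm_smul, hθ] using hr), mul_zero]
      rw [zero_smul, hφ0 _ hz, hg0 _ hz]
      simpa using (hasDerivAt_const (0 : ℝ) (0 : ℝ)).congr_of_eventuallyEq e
    · refine ((hH r h).mul (hasDerivAt_ray hφ θ.1 r)).congr_of_eventuallyEq ?_
      filter_upwards [lt_mem_nhds h] with s hs
      rw [Function.update_of_ne hs.ne']; rfl
  · refine hlim1.congr' ?_
    filter_upwards [eventually_gt_atTop 0] with r hr
    rw [Function.update_of_ne hr.ne']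

theorem integrable_annulus {n : ℕ} {r1 r2 : ℝ} (h1 : 0 < r1) :
    IntegrableOn (fun x : Euc n => (‖x‖ ^ n)⁻¹) {x | r1 ≤ ‖x‖ ∧ ‖x‖ ≤ r2} := by
  have hK : IsCompact {x : Euc n | r1 ≤ ‖x‖ ∧ ‖x‖ ≤ r2} := by
    refine (isCompact_closedBall (0 : Euc n) r2).of_isClosed_subset ?_ ?_
    · exact (isClosed_le continuous_const continuous_norm).inter
        (isClosed_le continuous_norm continuous_const)
    · intro x hx; simpa using hx.2
  refine ContinuousOn.integrableOn_compact hK ?_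
  refine ContinuousOn.inv₀ (by fun_prop) fun x hx => ?_
  have : 0 < ‖x‖ := h1.trans_le hx.1
  positivity

theorem integral_annulus {n : ℕ} (hn : 2 ≤ n) {r1 r2 : ℝ} (h1 : 0 < r1) (h12 : r1 ≤ r2) :
    ∫ x in {x : Euc n | r1 ≤ ‖x‖ ∧ ‖x‖ ≤ r2}, (‖x‖ ^ n)⁻¹ = n * omegaN n * Real.log (r2 / r1) := by
  have hnt := nontrivial_euc hn
  have hmeas : MeasurableSet {x : Euc n | r1 ≤ ‖x‖ ∧ ‖x‖ ≤ r2} :=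
    (measurableSet_le measurable_const measurable_norm).inter
      (measurableSet_le measurable_norm measurable_const)
  rw [← integral_indicator hmeas]
  have := integral_fun_norm_addHaar (volume : Measure (Euc n))
    ((Icc r1 r2).indicator fun r : ℝ => (r ^ n)⁻¹)
  have e : ∀ x : Euc n, (Icc r1 r2).indicator (fun r : ℝ => (r ^ n)⁻¹) ‖x‖ =
      {x : Euc n | r1 ≤ ‖x‖ ∧ ‖x‖ ≤ r2}.indicator (fun x => (‖x‖ ^ n)⁻¹) x := by
    intro x; simp [indicator]
  simp only [e] at this
  rw [this]
  have hfr : Module.finrank ℝ (Euc n) = n := by simp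
  have h3 : ∫ y in Ioi (0 : ℝ), y ^ (n - 1) • (Icc r1 r2).indicator (fun r : ℝ => (r ^ n)⁻¹) y
      = Real.log (r2 / r1) := by
    rw [← integral_inv_of_pos h1 (h1.trans_le h12), intervalIntegral.integral_of_le h12,
      ← integral_Icc_eq_integral_Ioc, ← integral_indicator measurableSet_Ioi,
      ← integral_indicator measurableSet_Icc]
    congr 1
    ext y
    by_cases hy : y ∈ Icc r1 r2
    · have hy0 : 0 < y := h1.trans_le hy.1
      rw [indicator_of_mem (show y ∈ Ioi (0:ℝ) from hy0), indicator_of_mem hy, indicator_of_mem hy]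
      obtain ⟨k, rfl⟩ := Nat.exists_eq_add_of_le' hn
      rw [show k + 2 - 1 = k + 1 by omega, smul_eq_mul]
      field_simp
      ring
    · rw [indicator_of_notMem hy]
      by_cases h0 : y ∈ Ioi (0:ℝ) <;> simp [h0, hy]
  rw [hfr, h3]
  simp [omegaN, Measure.real, mul_assoc]


/-! ### A smooth truncation -/

/-- A trapezoidal bump with support in `[a, b]`. -/
noncomputable def trap (a b s : ℝ) : ℝ := max 0 (min 1 (min (s - a) (b - s)))

/-- The primitive of the trapezoidal bump. -/
noncomputable def ramp (a b s : ℝ) : ℝ := primitive (trap a b) a s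

theorem continuous_trap (a b : ℝ) : Continuous (trap a b) := by unfold trap; fun_prop

theorem trap_nonneg (a b s : ℝ) : 0 ≤ trap a b s := le_max_left _ _

theorem trap_le_one (a b s : ℝ) : trap a b s ≤ 1 := max_le zero_le_one (min_le_left _ _)

theorem trap_eq_zero_of_le {a b s : ℝ} (h : s ≤ a) : trap a b s = 0 :=
  max_eq_left ((min_le_right _ _).trans ((min_le_left _ _).trans (by linarith)))

theorem trap_eq_zero_of_ge {a b s : ℝ} (h : b ≤ s) : trap a b s = 0 :=
  max_eq_left ((min_le_right _ _).trans ((min_le_right _ _).trans (by linarith)))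

theorem trap_eq_one {a b s : ℝ} (h1 : a + 1 ≤ s) (h2 : s ≤ b - 1) : trap a b s = 1 := by
  unfold trap
  rw [min_eq_left (le_min (by linarith) (by linarith))]; simp

theorem hasDerivAt_ramp (a b s : ℝ) : HasDerivAt (ramp a b) (trap a b s) s :=
  hasDerivAt_primitive (continuous_trap a b) a s

theorem contDiff_ramp (a b : ℝ) : ContDiff ℝ 1 (ramp a b) :=
  contDiff_primitive (continuous_trap a b) a

theorem monotone_ramp (a b : ℝ) : Monotone (ramp a b) :=
  monotone_of_deriv_nonneg (fun s => (hasDerivAt_ramp a b s).differentiableAt)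
    fun s => by rw [(hasDerivAt_ramp a b s).deriv]; exact trap_nonneg a b s

theorem ramp_sub (a b s t : ℝ) : ramp a b t - ramp a b s = ∫ x in s..t, trap a b x := by
  unfold ramp primitive
  rw [intervalIntegral.integral_interval_sub_left] <;>
    exact (continuous_trap a b).intervalIntegrable _ _

theorem ramp_self (a b : ℝ) : ramp a b a = 0 := by simp [ramp, primitive]

theorem ramp_of_le {a b s : ℝ} (h : s ≤ a) : ramp a b s = 0 := by
  have h1 := ramp_sub a b s a
  rw [ramp_self, intervalIntegral.integral_congr (g := fun _ => (0 : ℝ))] at h1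
  · simpa using h1
  · intro x hx
    rw [uIcc_of_le h] at hx
    exact trap_eq_zero_of_le hx.2

theorem ramp_of_ge {a b s : ℝ} (h : b ≤ s) : ramp a b s = ramp a b b := by
  have h1 := ramp_sub a b b s
  rw [intervalIntegral.integral_congr (g := fun _ => (0 : ℝ))] at h1
  · simpa [sub_eq_zero] using h1
  · intro x hx
    rw [uIcc_of_le h] at hx
    exact trap_eq_zero_of_ge hx.1

theorem ramp_nonneg (a b s : ℝ) : 0 ≤ ramp a b s := by
  rcases le_total s a with h | h
  · rw [ramp_of_le h]
  · rw [← ramp_self a b]; exact monotone_ramp a b h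

theorem ramp_le (a b s : ℝ) : ramp a b s ≤ ramp a b b := by
  rcases le_total s b with h | h
  · exact monotone_ramp a b h
  · rw [ramp_of_ge h]

theorem ramp_le_sub {a b : ℝ} (h : a ≤ b) : ramp a b b ≤ b - a := by
  have h1 := ramp_sub a b a b
  rw [ramp_self, sub_zero] at h1
  rw [h1]
  refine (intervalIntegral.integral_mono_on h ((continuous_trap a b).intervalIntegrable _ _)
    intervalIntegrable_const fun x _ => trap_le_one a b x).trans ?_
  simp

theorem sub_two_le_ramp (a b : ℝ) : b - a - 2 ≤ ramp a b b := by
  rcases le_total (b - a) 2 with h | h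
  · linarith [ramp_nonneg a b b]
  · have h1 := ramp_sub a b (a + 1) (b - 1)
    rw [intervalIntegral.integral_congr (g := fun _ => (1 : ℝ))] at h1
    · simp at h1
      linarith [ramp_nonneg a b (a + 1), ramp_le a b (b - 1)]
    · intro x hx
      rw [uIcc_of_le (by linarith)] at hx
      exact trap_eq_one hx.1 hx.2

/-! ### Annuli -/

/-- The closed annulus. -/
def ann (n : ℕ) (r1 r2 : ℝ) : Set (Euc n) := {x | r1 ≤ ‖x‖ ∧ ‖x‖ ≤ r2}

theorem isClosed_ann (n : ℕ) (r1 r2 : ℝ) : IsClosed (ann n r1 r2) :=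
  (isClosed_le continuous_const continuous_norm).inter
        (isClosed_le continuous_norm continuous_const)

theorem isCompact_ann (n : ℕ) (r1 r2 : ℝ) : IsCompact (ann n r1 r2) := by
  refine (isCompact_closedBall (0 : Euc n) r2).of_isClosed_subset (isClosed_ann n r1 r2) ?_
  intro x hx; simpa using hx.2

/-- The `n`-capacity of a ball in a concentric ball. -/
theorem capacity_le {n : ℕ} (hn : 2 ≤ n) {φ : Euc n → ℝ} (hφ : ContDiff ℝ 1 φ) {r1 r2 : ℝ}
    (h1 : 0 < r1) (h12 : r1 ≤ r2) (hc : ∀ x ∈ ball (0 : Euc n) r1, φ x = φ 0)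
    (hs : tsupport φ ⊆ closedBall 0 r2) (h0 : 0 ≤ φ 0) :
    (n * omegaN n * φ 0) ^ n ≤ (n * omegaN n * Real.log (r2 / r1)) ^ (n - 1) *
      ∫ x, ‖gradient φ x‖ ^ n := by
  have hcs : HasCompactSupport φ := (isCompact_closedBall 0 r2).of_isClosed_subset
    (isClosed_tsupport φ) hs
  have hcg := continuous_gradient hφ
  have hcsg := hasCompactSupport_gradient hcs
  have hg1 : ∀ x ∈ ball (0 : Euc n) r1, gradient φ x = 0 := by
    intro x hx
    have : φ =ᶠ[𝓝 x] fun _ => φ 0 := by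
      filter_upwards [isOpen_ball.mem_nhds hx] with y hy using hc y hy
    rw [this.gradient.eq_of_nhds]; simp
  have hg2 : ∀ x, x ∉ ann n r1 r2 → gradient φ x = 0 := by
    intro x hx
    by_cases hx1 : ‖x‖ < r1
    · exact hg1 x (by simpa using hx1)
    · refine gradient_eq_zero_of_notMem_tsupport fun h => hx ⟨not_lt.1 hx1, ?_⟩
      simpa using hs h
  have e := integral_radial_eq_neg hn hφ hcs h1 hc
  have hcont1 : ContinuousOn (fun x : Euc n => ‖x‖⁻¹) (ann n r1 r2) :=
    ContinuousOn.inv₀ (by fun_prop) fun x hx => (h1.trans_le hx.1).ne'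
  have hm := (isClosed_ann n r1 r2).measurableSet
  have hintg : Integrable fun x => ‖gradient φ x‖ ^ n := by
    refine Continuous.integrable_of_hasCompactSupport (by fun_prop) ?_
    refine hcsg.mono fun x hx hx2 => hx ?_
    have : n ≠ 0 := by omega
    simp [show gradient φ x = 0 from hx2, this]
  have hH := integral_pow_mul_pow_le (μ := volume.restrict (ann n r1 r2)) hn
    (f := fun x : Euc n => ‖x‖⁻¹) (g := fun x => ‖gradient φ x‖)
    (fun x => by positivity) (fun x => by positivity)
    (hcont1.aestronglyMeasurable hm) (by fun_prop)
    ((hcont1.pow n).integrableOn_compact (isCompact_ann n r1 r2)) hintg.integrableOn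
  simp only [inv_pow] at hH
  rw [show ann n r1 r2 = {x | r1 ≤ ‖x‖ ∧ ‖x‖ ≤ r2} from rfl, integral_annulus hn h1 h12] at hH
  have hle : n * omegaN n * φ 0 ≤ ∫ x in ann n r1 r2, (‖x‖ ^ (n - 1))⁻¹ * ‖gradient φ x‖ := by
    have : n * omegaN n * φ 0 = ∫ x in ann n r1 r2, -(⟪x, gradient φ x⟫_ℝ / ‖x‖ ^ n) := by
      rw [setIntegral_eq_integral_of_forall_compl_eq_zero, integral_neg, e, neg_neg]
      intro x hx
      rw [hg2 x hx]; simp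
    rw [this]
    have hp : ∀ x ∈ ann n r1 r2, 0 < ‖x‖ := fun x hx => h1.trans_le hx.1
    refine setIntegral_mono_on (ContinuousOn.integrableOn_compact (isCompact_ann n r1 r2) ?_)
      (ContinuousOn.integrableOn_compact (isCompact_ann n r1 r2) ?_) hm ?_
    · refine ContinuousOn.neg (ContinuousOn.div (by fun_prop) (by fun_prop) fun x hx => ?_)
      have := hp x hx; positivity
    · refine ContinuousOn.mul (ContinuousOn.inv₀ (by fun_prop) fun x hx => ?_) (by fun_prop)
      have := hp x hx; positivity
    · intro x hx
      have hx0 := hp x hx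
      have : -⟪x, gradient φ x⟫_ℝ ≤ ‖x‖ * ‖gradient φ x‖ :=
        (neg_le_abs _).trans (abs_real_inner_le_norm _ _)
      obtain ⟨k, rfl⟩ := Nat.exists_eq_add_of_le' hn
      rw [← neg_div, div_le_iff₀ (by positivity)]
      refine this.trans (le_of_eq ?_)
      rw [show k + 2 - 1 = k + 1 by omega]
      field_simp
      ring
  calc _ ≤ (∫ x in ann n r1 r2, (‖x‖ ^ (n - 1))⁻¹ * ‖gradient φ x‖) ^ n :=
        pow_le_pow_left₀ (mul_nonneg (mul_omegaN_pos hn).le h0) hle n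
    _ ≤ _ := hH
    _ ≤ _ := by
      have hl : 0 ≤ Real.log (r2 / r1) := Real.log_nonneg ((one_le_div h1).2 h12)
      have hpos := mul_omegaN_pos hn
      refine mul_le_mul_of_nonneg_left ?_ (by positivity)
      exact setIntegral_le_integral hintg (ae_of_all _ fun x => by positivity)

/-! ### Entire solutions of finite mass -/

/-- Entire weak solutions of `-Δₙ u = e^u` with finite mass. -/
structure Sol (n : ℕ) (u : Euc n → ℝ) : Prop where
  contDiff : ContDiff ℝ 1 u
  integrable : Integrable fun x => Real.exp (u x)
  weak : ∀ φ : Euc n → ℝ, ContDiff ℝ 1 φ → HasCompactSupport φ →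
    ∫ x, ⟪nflux n (gradient u x), gradient φ x⟫_ℝ = ∫ x, Real.exp (u x) * φ x

/-- The mass `∫ e^u`. -/
noncomputable def mass {n : ℕ} (u : Euc n → ℝ) : ℝ := ∫ x, Real.exp (u x)

theorem mass_pos {n : ℕ} {u : Euc n → ℝ} (h : Sol n u) : 0 < mass u :=
  integral_exp_pos h.integrable

theorem energy_ramp {n : ℕ} (hn : 2 ≤ n) {u : Euc n → ℝ} (h : Sol n u) (a b : ℝ)
    (hcs : HasCompactSupport fun x => ramp a b (u x)) :
    Integrable (fun x => trap a b (u x) * ‖gradient u x‖ ^ n) ∧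
    ∫ x, trap a b (u x) * ‖gradient u x‖ ^ n ≤ ramp a b b * mass u := by
  have hφ : ContDiff ℝ 1 fun x => ramp a b (u x) := (contDiff_ramp a b).comp h.contDiff
  have hg : ∀ x, gradient (fun x => ramp a b (u x)) x = trap a b (u x) • gradient u x := fun x =>
    (hasGradientAt_comp (hasDerivAt_ramp a b (u x)) (hasGradientAt_of_contDiff h.contDiff x)).gradient
  have e := h.weak _ hφ hcs
  simp only [hg, real_inner_smul_right, inner_nflux_self hn] at e
  have hcu := h.contDiff.continuous
  have hcg := continuous_gradient h.contDiff
  constructor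
  · refine Continuous.integrable_of_hasCompactSupport ?_ ?_
    · have := continuous_trap a b; fun_prop
    · refine (hasCompactSupport_gradient hcs).mono fun x hx hx2 => hx ?_
      rw [hg] at hx2
      have : n ≠ 0 := by omega
      rcases smul_eq_zero.1 hx2 with h | h <;> simp [h, this]
  · rw [e, mass, ← integral_const_mul]
    refine integral_mono ?_ (h.integrable.const_mul _) fun x => ?_
    · exact Continuous.integrable_of_hasCompactSupport
        ((Real.continuous_exp.comp hcu).mul hφ.continuous) hcs.mul_left
    · simp only
      rw [mul_comm]
      gcongr
      exact ramp_le _ _ _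

theorem norm_gradient_ramp_le {n : ℕ} (hn : 2 ≤ n) {u : Euc n → ℝ} (hu : ContDiff ℝ 1 u)
    (a b : ℝ) (x : Euc n) :
    ‖gradient (fun x => ramp a b (u x)) x‖ ^ n ≤ trap a b (u x) * ‖gradient u x‖ ^ n := by
  rw [(hasGradientAt_comp (hasDerivAt_ramp a b (u x)) (hasGradientAt_of_contDiff hu x)).gradient,
    norm_smul, mul_pow, Real.norm_of_nonneg (trap_nonneg _ _ _)]
  gcongr
  exact pow_le_of_le_one (trap_nonneg _ _ _) (trap_le_one _ _ _) (by omega)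

/-- Oscillation bound: a solution large on a ball and small outside a larger one has large mass. -/
theorem cap_pow_le {n : ℕ} (hn : 2 ≤ n) {u : Euc n → ℝ} (h : Sol n u) {a b r1 r2 : ℝ}
    (h1 : 0 < r1) (h12 : r1 ≤ r2) (hb : ∀ x, ‖x‖ < r1 → b ≤ u x)
    (ha : ∀ x, r2 < ‖x‖ → u x ≤ a) :
    n * omegaN n * ramp a b b ^ (n - 1) ≤ mass u * Real.log (r2 / r1) ^ (n - 1) := by
  set T := ramp a b b with hT
  have hT0 : 0 ≤ T := ramp_nonneg _ _ _
  have hl : 0 ≤ Real.log (r2 / r1) := Real.log_nonneg ((one_le_div h1).2 h12)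
  have hω := mul_omegaN_pos hn
  have hM := mass_pos h
  rcases eq_or_lt_of_le hT0 with hT1 | hT1
  · rw [← hT1, zero_pow (by omega), mul_zero]; positivity
  have hφ : ContDiff ℝ 1 fun x => ramp a b (u x) := (contDiff_ramp a b).comp h.contDiff
  have hts : tsupport (fun x => ramp a b (u x)) ⊆ closedBall 0 r2 := by
    refine closure_minimal (fun x hx => ?_) isClosed_closedBall
    by_contra hx2
    exact hx (ramp_of_le (ha x (by simpa using hx2)))
  have hcs : HasCompactSupport fun x => ramp a b (u x) :=
    (isCompact_closedBall 0 r2).of_isClosed_subset (isClosed_tsupport _) hts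
  have hval : ∀ x ∈ ball (0 : Euc n) r1, ramp a b (u x) = T := fun x hx =>
    ramp_of_ge (hb x (by simpa using hx))
  have hv0 := hval 0 (mem_ball_self h1)
  have hcap := capacity_le hn hφ h1 h12 (fun x hx => (hval x hx).trans hv0.symm) hts
    (ramp_nonneg _ _ _)
  obtain ⟨hi, hE⟩ := energy_ramp hn h a b hcs
  simp only [hv0] at hcap
  have h2 : ∫ x, ‖gradient (fun x => ramp a b (u x)) x‖ ^ n ≤ T * mass u := by
    refine le_trans (integral_mono_of_nonneg (ae_of_all _ fun x => by positivity) hi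
      (ae_of_all _ fun x => norm_gradient_ramp_le hn h.contDiff a b x)) hE
  have h3 := hcap.trans (mul_le_mul_of_nonneg_left h2 (by positivity))
  obtain ⟨k, rfl⟩ := Nat.exists_eq_add_of_le' hn
  rw [show k + 2 - 1 = k + 1 by omega] at h3 ⊢
  set W := ((k + 2 : ℕ) : ℝ) * omegaN (k + 2)
  have : (W ^ (k + 1) * T) * (W * T ^ (k + 1)) ≤
      (W ^ (k + 1) * T) * (mass u * Real.log (r2 / r1) ^ (k + 1)) := by
    calc _ = (W * T) ^ (k + 2) := by ring
      _ ≤ _ := h3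
      _ = _ := by ring
  exact le_of_mul_le_mul_left this (by positivity)

theorem annulus_energy_le {n : ℕ} (hn : 2 ≤ n) {u : Euc n → ℝ} (h : Sol n u) {a b r1 r2 R : ℝ}
    (hab : a ≤ b) (hu : ∀ x ∈ ann n r1 r2, a ≤ u x ∧ u x ≤ b) (hR : ∀ x, R < ‖x‖ → u x ≤ a - 1) :
    ∫ x in ann n r1 r2, ‖gradient u x‖ ^ n ≤ (b - a + 2) * mass u := by
  have hts : tsupport (fun x => ramp (a - 1) (b + 1) (u x)) ⊆ closedBall 0 R := by
    refine closure_minimal (fun x hx => ?_) isClosed_closedBall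
    by_contra hx2
    exact hx (ramp_of_le (hR x (by simpa using hx2)))
  have hcs : HasCompactSupport fun x => ramp (a - 1) (b + 1) (u x) :=
    (isCompact_closedBall 0 R).of_isClosed_subset (isClosed_tsupport _) hts
  obtain ⟨hi, hE⟩ := energy_ramp hn h _ _ hcs
  calc ∫ x in ann n r1 r2, ‖gradient u x‖ ^ n
      = ∫ x in ann n r1 r2, trap (a - 1) (b + 1) (u x) * ‖gradient u x‖ ^ n := by
        refine setIntegral_congr_fun (isClosed_ann n r1 r2).measurableSet fun x hx => ?_
        rw [trap_eq_one (by linarith [(hu x hx).1]) (by linarith [(hu x hx).2]), one_mul]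
    _ ≤ ∫ x, trap (a - 1) (b + 1) (u x) * ‖gradient u x‖ ^ n :=
        setIntegral_le_integral hi (ae_of_all _ fun x =>
          mul_nonneg (trap_nonneg _ _ _) (by positivity))
    _ ≤ _ := hE
    _ ≤ _ := by
      refine mul_le_mul_of_nonneg_right ?_ (mass_pos h).le
      exact (ramp_le_sub (by linarith)).trans (by linarith)

/-- A logarithmic cutoff. -/
noncomputable def logCutoff (n : ℕ) (r1 r2 : ℝ) (x : Euc n) : ℝ :=
  if ‖x‖ < r1 then 1 else
    1 - ramp (Real.log r1) (Real.log r2) (Real.log ‖x‖) / ramp (Real.log r1) (Real.log r2) (Real.log r2)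

theorem hasGradientAt_log_norm {n : ℕ} {x : Euc n} (hx : x ≠ 0) :
    HasGradientAt (fun x : Euc n => Real.log ‖x‖) ((‖x‖ ^ 2)⁻¹ • x) x := by
  have hx' : 0 < ‖x‖ := norm_pos_iff.2 hx
  have h1 : HasGradientAt (fun x : Euc n => ‖x‖ ^ 2) ((2 : ℝ) • x) x := by
    rw [hasGradientAt_iff_hasFDerivAt]
    have := (hasStrictFDerivAt_norm_sq x).hasFDerivAt
    have e : (InnerProductSpace.toDual ℝ (Euc n)) ((2 : ℝ) • x) = 2 • innerSL ℝ x := by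
      ext y; simp [two_smul]
    rw [e]; exact this
  have h2 : HasDerivAt (fun s : ℝ => Real.log s / 2) ((‖x‖ ^ 2)⁻¹ / 2) (‖x‖ ^ 2) :=
    (Real.hasDerivAt_log (by positivity)).div_const 2
  have h3 := hasGradientAt_comp (u := fun x : Euc n => ‖x‖ ^ 2) h2 h1
  convert h3 using 1
  · ext y; rw [Real.log_pow]; push_cast; ring
  · rw [smul_smul]; congr 1; ring

theorem hasGradientAt_radial {n : ℕ} {x : Euc n} (hx : x ≠ 0) {g : ℝ → ℝ} {g' : ℝ}
    (hg : HasDerivAt g g' (Real.log ‖x‖)) :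
    HasGradientAt (fun x : Euc n => g (Real.log ‖x‖)) ((g' / ‖x‖ ^ 2) • x) x := by
  have := hasGradientAt_comp hg (hasGradientAt_log_norm hx)
  rwa [smul_smul, ← div_eq_mul_inv] at this

theorem contDiffAt_log_norm {n : ℕ} {x : Euc n} (hx : x ≠ 0) :
    ContDiffAt ℝ 1 (fun x : Euc n => Real.log ‖x‖) x :=
  (contDiffAt_norm ℝ hx).log (norm_ne_zero_iff.2 hx)

section logCutoff

variable {n : ℕ} {r1 r2 : ℝ}

theorem logCutoff_of_ne {x : Euc n} (hx : x ≠ 0) : logCutoff n r1 r2 x =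
    1 - ramp (Real.log r1) (Real.log r2) (Real.log ‖x‖) /
      ramp (Real.log r1) (Real.log r2) (Real.log r2) := by
  unfold logCutoff
  split_ifs with h
  · rw [ramp_of_le (Real.log_le_log (norm_pos_iff.2 hx) h.le)]; simp
  · rfl

theorem contDiff_logCutoff (h1 : 0 < r1) : ContDiff ℝ 1 (logCutoff n r1 r2) := by
  rw [contDiff_iff_contDiffAt]
  intro x
  by_cases hx : x = 0
  · subst hx
    refine (contDiffAt_const (c := (1 : ℝ))).congr_of_eventuallyEq ?_
    filter_upwards [ball_mem_nhds (0 : Euc n) h1] with y hy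
    simp [logCutoff, show ‖y‖ < r1 by simpa using hy]
  · refine ContDiffAt.congr_of_eventuallyEq (f := fun x => 1 - ramp (Real.log r1) (Real.log r2) (Real.log ‖x‖) /
      ramp (Real.log r1) (Real.log r2) (Real.log r2)) ?_ ?_
    · exact contDiffAt_const.sub (((contDiff_ramp _ _).contDiffAt.comp x
        (contDiffAt_log_norm hx)).div_const _)
    · filter_upwards [isOpen_compl_singleton.mem_nhds hx] with y hy
      exact logCutoff_of_ne hy

theorem gradient_logCutoff {x : Euc n} (hx : x ≠ 0) :
    gradient (logCutoff n r1 r2) x = (-(trap (Real.log r1) (Real.log r2) (Real.log ‖x‖) /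
      ramp (Real.log r1) (Real.log r2) (Real.log r2)) / ‖x‖ ^ 2) • x := by
  have e : logCutoff n r1 r2 =ᶠ[𝓝 x] fun x => (fun s => 1 - ramp (Real.log r1) (Real.log r2) s /
      ramp (Real.log r1) (Real.log r2) (Real.log r2)) (Real.log ‖x‖) := by
    filter_upwards [isOpen_compl_singleton.mem_nhds hx] with y hy
    exact logCutoff_of_ne hy
  rw [e.gradient.eq_of_nhds]
  refine (hasGradientAt_radial hx (((hasDerivAt_ramp _ _ _).div_const _).const_sub 1)).gradient

theorem logCutoff_nonneg (x : Euc n) : 0 ≤ logCutoff n r1 r2 x := by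
  unfold logCutoff
  split_ifs
  · exact zero_le_one
  · exact sub_nonneg.2 (div_le_one_of_le₀ (ramp_le _ _ _) (ramp_nonneg _ _ _))

end logCutoff

theorem ball_mass_pow_le {n : ℕ} (hn : 2 ≤ n) {u : Euc n → ℝ} (h : Sol n u) {a b r1 r2 R : ℝ}
    (h1 : 0 < r1) (h12 : 2 < Real.log (r2 / r1)) (h2 : 0 < r2)
    (hab : a ≤ b) (hu : ∀ x ∈ ann n r1 r2, a ≤ u x ∧ u x ≤ b) (hR : ∀ x, R < ‖x‖ → u x ≤ a - 1) :
    ((Real.log (r2 / r1) - 2) * ∫ x in ball (0 : Euc n) r1, Real.exp (u x)) ^ n ≤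
      ((b - a + 2) * mass u) ^ (n - 1) * (n * omegaN n * Real.log (r2 / r1)) := by
  have hr12 : r1 ≤ r2 := by
    by_contra hlt
    have := Real.log_nonpos (div_nonneg h2.le h1.le) ((div_le_one h1).2 (not_le.1 hlt).le)
    linarith
  set T := ramp (Real.log r1) (Real.log r2) (Real.log r2) with hT
  have hTS : Real.log (r2 / r1) - 2 ≤ T := by
    rw [Real.log_div h2.ne' h1.ne']; exact sub_two_le_ramp _ _
  have hT0 : 0 < T := by linarith
  have hm := (isClosed_ann n r1 r2).measurableSet
  have hp : ∀ x ∈ ann n r1 r2, 0 < ‖x‖ := fun x hx => h1.trans_le hx.1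
  have hcg := continuous_gradient h.contDiff
  set ψ := logCutoff n r1 r2
  have hψ : ContDiff ℝ 1 ψ := contDiff_logCutoff h1
  have hcgψ := continuous_gradient hψ
  have hts : tsupport ψ ⊆ closedBall 0 r2 := by
    refine closure_minimal (fun x hx => ?_) isClosed_closedBall
    by_contra hx2
    have hx3 : r2 < ‖x‖ := by simpa using hx2
    apply hx
    have hx0 : x ≠ 0 := norm_pos_iff.1 (h2.trans hx3)
    change logCutoff n r1 r2 x = 0
    rw [logCutoff_of_ne hx0, ramp_of_ge (Real.log_le_log h2 hx3.le), div_self hT0.ne', sub_self]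
  have hcs : HasCompactSupport ψ :=
    (isCompact_closedBall 0 r2).of_isClosed_subset (isClosed_tsupport _) hts
  have e := h.weak ψ hψ hcs
  have hcu := h.contDiff.continuous
  have hI1 : ∫ x in ball (0 : Euc n) r1, Real.exp (u x) ≤ ∫ x, Real.exp (u x) * ψ x := by
    have hint : Integrable fun x => Real.exp (u x) * ψ x :=
      Continuous.integrable_of_hasCompactSupport
        ((Real.continuous_exp.comp hcu).mul hψ.continuous) hcs.mul_left
    refine le_trans (le_of_eq ?_) (setIntegral_le_integral hint (s := ball 0 r1)
      (ae_of_all _ fun x => mul_nonneg (Real.exp_pos _).le (logCutoff_nonneg x)))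
    refine setIntegral_congr_fun measurableSet_ball fun x hx => ?_
    have : ψ x = 1 := by simp [ψ, logCutoff, show ‖x‖ < r1 by simpa using hx]
    simp [this]
  have hg2 : ∀ x, x ∉ ann n r1 r2 → gradient ψ x = 0 := by
    intro x hx
    by_cases hx1 : ‖x‖ < r1
    · have : ψ =ᶠ[𝓝 x] fun _ => 1 := by
        filter_upwards [(continuous_norm.tendsto x).eventually (gt_mem_nhds hx1)] with y hy
        simp [ψ, logCutoff, hy]
      rw [this.gradient.eq_of_nhds]; simp
    · refine gradient_eq_zero_of_notMem_tsupport fun h => hx ⟨not_lt.1 hx1, ?_⟩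
      simpa using hts h
  have hcont1 : ContinuousOn (fun x : Euc n => T⁻¹ * ‖x‖⁻¹) (ann n r1 r2) :=
    ContinuousOn.mul continuousOn_const (ContinuousOn.inv₀ (by fun_prop) fun x hx => (hp x hx).ne')
  have hI2 : ∫ x, ⟪nflux n (gradient u x), gradient ψ x⟫_ℝ ≤
      ∫ x in ann n r1 r2, ‖gradient u x‖ ^ (n - 1) * (T⁻¹ * ‖x‖⁻¹) := by
    rw [← setIntegral_eq_integral_of_forall_compl_eq_zero (s := ann n r1 r2)
      fun x hx => by rw [hg2 x hx]; simp]
    refine setIntegral_mono_on (ContinuousOn.integrableOn_compact (isCompact_ann n r1 r2) ?_)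
      (ContinuousOn.integrableOn_compact (isCompact_ann n r1 r2) ?_) hm ?_
    · have := continuous_nflux n
      exact Continuous.continuousOn (by fun_prop)
    · exact ContinuousOn.mul (by fun_prop) hcont1
    · intro x hx
      have hx0 := hp x hx
      refine (real_inner_le_norm _ _).trans ?_
      rw [norm_nflux hn]
      gcongr
      rw [gradient_logCutoff (norm_pos_iff.1 hx0), norm_smul, norm_div, norm_neg, norm_div,
        Real.norm_of_nonneg (trap_nonneg _ _ _), Real.norm_of_nonneg hT0.le, norm_pow, norm_norm]
      have := trap_le_one (Real.log r1) (Real.log r2) (Real.log ‖x‖)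
      calc _ ≤ 1 / T / ‖x‖ ^ 2 * ‖x‖ := by gcongr
        _ = _ := by field_simp
  have hH := integral_pow_mul_pow_le (μ := volume.restrict (ann n r1 r2)) hn
    (f := fun x => ‖gradient u x‖) (g := fun x : Euc n => T⁻¹ * ‖x‖⁻¹)
    (fun x => by positivity) (fun x => by positivity) (by fun_prop)
    (hcont1.aestronglyMeasurable hm)
    ((Continuous.continuousOn (by fun_prop)).integrableOn_compact (isCompact_ann n r1 r2))
    ((hcont1.pow n).integrableOn_compact (isCompact_ann n r1 r2))
  simp only [mul_pow, inv_pow] at hH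
  rw [integral_const_mul, show (∫ x in ann n r1 r2, (‖x‖ ^ n)⁻¹) = _ from
    integral_annulus hn h1 hr12] at hH
  set m := ∫ x in ball (0 : Euc n) r1, Real.exp (u x)
  have hm0 : 0 ≤ m := integral_nonneg fun x => (Real.exp_pos _).le
  have hω := mul_omegaN_pos hn
  have hM := mass_pos h
  have h5 : m ^ n ≤ ((b - a + 2) * mass u) ^ (n - 1) *
      ((T ^ n)⁻¹ * (n * omegaN n * Real.log (r2 / r1))) := by
    refine (pow_le_pow_left₀ hm0 (hI1.trans (e.symm.le.trans hI2)) n).trans (hH.trans ?_)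
    have : 0 ≤ Real.log (r2 / r1) := by linarith
    refine mul_le_mul_of_nonneg_right (pow_le_pow_left₀ (integral_nonneg fun x => by positivity) ?_ _)
      (by positivity)
    exact annulus_energy_le hn h hab hu hR
  calc ((Real.log (r2 / r1) - 2) * m) ^ n ≤ (T * m) ^ n := by
        have : 0 ≤ Real.log (r2 / r1) - 2 := by linarith
        gcongr
    _ = T ^ n * m ^ n := mul_pow _ _ _
    _ ≤ T ^ n * _ := mul_le_mul_of_nonneg_left h5 (by positivity)
    _ = _ := by field_simp


theorem integrableOn_of_continuous {α : Type*} [TopologicalSpace α] [T2Space α]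
    [MeasurableSpace α] [OpensMeasurableSpace α] {μ : Measure α} [IsFiniteMeasureOnCompacts μ]
    {s : Set α} (hs : IsCompact s) {f : α → ℝ} (hf : Continuous f) : IntegrableOn f s μ :=
  hf.continuousOn.integrableOn_compact hs

/-! ### Morrey's inequality on balls -/

section Morrey

variable {E : Type*} [NormedAddCommGroup E] [NormedSpace ℝ E] [FiniteDimensional ℝ E]
  [MeasurableSpace E] [BorelSpace E] (μ : Measure E) [μ.IsAddHaarMeasure]

theorem setIntegral_contraction_le {L : ℝ} {F : E → ℝ} (hF : Continuous F) (hF0 : ∀ x, 0 ≤ F x)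
    {x : E} (hx : x ∈ closedBall (0 : E) L) {s : ℝ} (hs0 : 0 < s) (hs1 : s ≤ 1) :
    s ^ Module.finrank ℝ E * ∫ y in closedBall (0 : E) L, F (x + s • (y - x)) ∂μ ≤
      ∫ y in closedBall (0 : E) L, F y ∂μ := by
  set Q := closedBall (0 : E) L
  have hQm : MeasurableSet Q := measurableSet_closedBall
  have hmem : ∀ y ∈ Q, x + s • (y - x) ∈ Q := by
    intro y hy
    exact (convex_closedBall (0 : E) L).add_smul_sub_mem hx hy ⟨hs0.le, hs1⟩
  have hQi : IntegrableOn F Q μ := hF.continuousOn.integrableOn_compact (isCompact_closedBall _ _)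
  set H := Q.indicator F with hH
  have hHi : Integrable H μ := hQi.integrable_indicator hQm
  have hH0 : ∀ y, 0 ≤ H y := fun y => indicator_nonneg (fun z _ => hF0 z) y
  have e1 : ∫ y, H (x + s • (y - x)) ∂μ = (s ^ Module.finrank ℝ E)⁻¹ * ∫ y, H y ∂μ := by
    rw [integral_sub_right_eq_self (fun y => H (x + s • y)) x,
      Measure.integral_comp_smul μ (fun y => H (x + y)) s, integral_add_left_eq_self,
      abs_of_nonneg (by positivity), smul_eq_mul]
  have i1 : Integrable (fun y => H (x + s • (y - x))) μ := by
    have h1 : Integrable (fun y => H (x + y)) μ := hHi.comp_add_left x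
    have h2 : Integrable (fun y => H (x + s • y)) μ := h1.comp_smul hs0.ne'
    exact h2.comp_sub_right x
  have hle : ∫ y in Q, F (x + s • (y - x)) ∂μ ≤ ∫ y, H (x + s • (y - x)) ∂μ := by
    calc _ = ∫ y in Q, H (x + s • (y - x)) ∂μ :=
          setIntegral_congr_fun hQm fun y hy => (indicator_of_mem (hmem y hy) F).symm
      _ ≤ _ := setIntegral_le_integral i1 (ae_of_all _ fun y => hH0 _)
  calc _ ≤ s ^ Module.finrank ℝ E * ((s ^ Module.finrank ℝ E)⁻¹ * ∫ y, H y ∂μ) := by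
        rw [← e1]; gcongr
    _ = ∫ y, H y ∂μ := by field_simp
    _ = _ := integral_indicator hQm

theorem exists_pow_eq {n : ℕ} (hn : n ≠ 0) {B : ℝ} (hB : 0 ≤ B) : ∃ K : ℝ, 0 ≤ K ∧ K ^ n = B :=
  ⟨B ^ ((n : ℝ)⁻¹), Real.rpow_nonneg hB _, Real.rpow_inv_natCast_pow hB hn⟩

theorem abs_setIntegral_sub_pow_le {L : ℝ} {n : ℕ} (hn : 2 ≤ n)
    (hd : Module.finrank ℝ E + 1 = n) {g : E → ℝ} (hg : ContDiff ℝ 1 g) {x : E}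
    (hx : x ∈ closedBall (0 : E) L) :
    |∫ y in closedBall (0 : E) L, (g y - g x) ∂μ| ^ n ≤
      (2 * L * n) ^ n * (μ.real (closedBall (0 : E) L) ^ (n - 1) *
        ∫ y in closedBall (0 : E) L, ‖fderiv ℝ g y‖ ^ n ∂μ) := by
  set Q := closedBall (0 : E) L with hQ
  have hQm : MeasurableSet Q := measurableSet_closedBall
  have hQc : IsCompact Q := isCompact_closedBall _ _
  have hQf : IsFiniteMeasure (μ.restrict Q) := ⟨by simpa using hQc.measure_lt_top⟩
  have hL : 0 ≤ L := (norm_nonneg x).trans (by simpa [hQ] using hx)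
  have hD : Continuous (fderiv ℝ g) := hg.continuous_fderiv one_ne_zero
  set F : E → ℝ := fun y => ‖fderiv ℝ g y‖ with hF
  have hFc : Continuous F := hD.norm
  set B := μ.real Q ^ (n - 1) * ∫ y in Q, F y ^ n ∂μ with hB
  have hB0 : 0 ≤ B := mul_nonneg (by positivity) (integral_nonneg fun y => by positivity)
  obtain ⟨K, hK0, hK⟩ := exists_pow_eq (n := n) (by omega) hB0
  -- the bound for a fixed parameter
  have key : ∀ τ : ℝ, 0 < τ → τ ≤ 1 →
      ∫ y in Q, τ ^ (n - 1) * F (x + τ ^ n • (y - x)) ∂μ ≤ K := by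
    intro τ h0 h1
    have hc : Continuous fun y => τ ^ (n - 1) * F (x + τ ^ n • (y - x)) := by fun_prop
    have hn0 : 0 ≤ ∫ y in Q, τ ^ (n - 1) * F (x + τ ^ n • (y - x)) ∂μ :=
      integral_nonneg fun y => by positivity
    refine le_of_pow_le_pow_left₀ (n := n) (by omega) hK0 ?_
    rw [hK]
    have hH := integral_pow_mul_pow_le (μ := μ.restrict Q) hn (f := fun _ => (1 : ℝ))
      (g := fun y => τ ^ (n - 1) * F (x + τ ^ n • (y - x))) (fun _ => zero_le_one)
      (fun y => by positivity) (by fun_prop) hc.aestronglyMeasurable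
      (by simp) ((hc.pow n).continuousOn.integrableOn_compact hQc)
    simp only [one_pow, one_mul] at hH
    refine hH.trans ?_
    rw [hB]
    have : ∫ (x : E) in Q, (1 : ℝ) ∂μ = μ.real Q := by simp
    rw [this]
    refine mul_le_mul_of_nonneg_left ?_ (by positivity)
    have hs := setIntegral_contraction_le μ (F := fun y => F y ^ n) (by fun_prop)
      (fun y => by positivity) hx (s := τ ^ n) (by positivity) (pow_le_one₀ h0.le h1)
    refine le_trans (le_of_eq ?_) hs
    rw [← integral_const_mul]
    congr 1; ext y
    rw [mul_pow, ← pow_mul, ← pow_mul, ← hd]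
    congr 2
    simp; ring
  -- integrate along rays
  have hray : ∀ y τ, HasDerivAt (fun τ : ℝ => g (x + τ ^ n • (y - x)))
      ((n * τ ^ (n - 1)) * fderiv ℝ g (x + τ ^ n • (y - x)) (y - x)) τ := by
    intro y τ
    have h1 := (hg.differentiable one_ne_zero (x + τ ^ n • (y - x))).hasFDerivAt
    have h2 : HasDerivAt (fun τ : ℝ => x + τ ^ n • (y - x)) ((n * τ ^ (n - 1)) • (y - x)) τ :=
      ((hasDerivAt_pow n τ).smul_const (y - x)).const_add x
    have h3 := h1.comp_hasDerivAt τ h2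
    rwa [map_smul, smul_eq_mul] at h3
  set D : E → ℝ → ℝ := fun y τ => (n * τ ^ (n - 1)) * fderiv ℝ g (x + τ ^ n • (y - x)) (y - x)
    with hDdef
  have hDc : Continuous (Function.uncurry D) := by
    simp only [hDdef, Function.uncurry_def]
    refine Continuous.mul (by fun_prop) ?_
    exact (hD.comp (by fun_prop)).clm_apply (by fun_prop)
  have hftc : ∀ y, g y - g x = ∫ τ in Icc (0 : ℝ) 1, D y τ := by
    intro y
    rw [integral_Icc_eq_integral_Ioc, ← intervalIntegral.integral_of_le zero_le_one,
      intervalIntegral.integral_eq_sub_of_hasDerivAt (fun τ _ => hray y τ)]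
    · simp [show n ≠ 0 by omega]
    · exact Continuous.intervalIntegrable (hDc.comp (by fun_prop : Continuous fun τ : ℝ => (y, τ))) _ _
  have hint : Integrable (Function.uncurry D) ((μ.restrict Q).prod (volume.restrict (Icc (0 : ℝ) 1))) := by
    rw [Measure.prod_restrict]
    exact hDc.continuousOn.integrableOn_compact (hQc.prod isCompact_Icc)
  have e : ∫ y in Q, (g y - g x) ∂μ = ∫ τ in Icc (0 : ℝ) 1, ∫ y in Q, D y τ ∂μ := by
    simp only [hftc]
    exact integral_integral_swap hint
  have hbound : |∫ y in Q, (g y - g x) ∂μ| ≤ 2 * L * n * K := by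
    rw [e]
    have := norm_setIntegral_le_of_norm_le_const_ae' (μ := volume) (s := Icc (0 : ℝ) 1)
      (f := fun τ => ∫ y in Q, D y τ ∂μ) (C := 2 * L * n * K) (by simp) (ae_of_all _ ?_)
    · simpa using this
    · intro τ hτ
      rcases eq_or_lt_of_le hτ.1 with h0 | h0
      · have : ∀ y, D y τ = 0 := by
          intro y; simp [hDdef, ← h0, show n - 1 ≠ 0 by omega]
        simp only [this]; simp; positivity
      · refine (norm_integral_le_integral_norm _).trans ?_
        calc _ ≤ ∫ y in Q, 2 * L * n * (τ ^ (n - 1) * F (x + τ ^ n • (y - x))) ∂μ := by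
              refine setIntegral_mono_on ?_ ?_ hQm ?_
              · exact integrableOn_of_continuous hQc
                  ((hDc.comp (by fun_prop : Continuous fun y : E => (y, τ))).norm)
              · exact integrableOn_of_continuous hQc (by fun_prop)
              · intro y hy
                simp only [hDdef, norm_mul, norm_pow, Real.norm_of_nonneg h0.le]
                have h1 : ‖fderiv ℝ g (x + τ ^ n • (y - x)) (y - x)‖ ≤
                    F (x + τ ^ n • (y - x)) * (2 * L) := by
                  refine (ContinuousLinearMap.le_opNorm _ _).trans ?_
                  have : ‖y - x‖ ≤ 2 * L := by
                    have h1 : ‖y‖ ≤ L := by simpa [hQ] using hy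
                    have h2 : ‖x‖ ≤ L := by simpa [hQ] using hx
                    linarith [norm_sub_le y x]
                  gcongr
                calc _ ≤ ‖(n : ℝ)‖ * τ ^ (n - 1) * (F (x + τ ^ n • (y - x)) * (2 * L)) := by gcongr
                  _ = _ := by simp; ring
          _ = 2 * L * n * ∫ y in Q, τ ^ (n - 1) * F (x + τ ^ n • (y - x)) ∂μ := integral_const_mul _ _
          _ ≤ _ := by
            have := key τ h0 hτ.2
            gcongr
  calc _ ≤ (2 * L * n * K) ^ n := pow_le_pow_left₀ (abs_nonneg _) hbound n
    _ = _ := by rw [mul_pow, hK]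

/-- Morrey's inequality with exponent one more than the dimension. -/
theorem morrey_pow_le {L : ℝ} (hL : 0 < L) {n : ℕ} (hn : 2 ≤ n)
    (hd : Module.finrank ℝ E + 1 = n) : ∃ C : ℝ, 0 ≤ C ∧ ∀ g : E → ℝ, ContDiff ℝ 1 g →
      ∀ x ∈ closedBall (0 : E) L, ∀ y ∈ closedBall (0 : E) L,
        |g x - g y| ^ n ≤ C * ∫ y in closedBall (0 : E) L, ‖fderiv ℝ g y‖ ^ n ∂μ := by
  set Q := closedBall (0 : E) L with hQ
  have hQc : IsCompact Q := isCompact_closedBall _ _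
  have hQf : IsFiniteMeasure (μ.restrict Q) := ⟨by simpa using hQc.measure_lt_top⟩
  have hQ0 : 0 < μ.real Q := ENNReal.toReal_pos (measure_closedBall_pos _ _ hL).ne'
    hQc.measure_lt_top.ne
  set A := (2 * L * n) ^ n * μ.real Q ^ (n - 1) with hA
  refine ⟨2 ^ n * A / μ.real Q ^ n, by positivity, fun g hg x hx y hy => ?_⟩
  have hgi : IntegrableOn g Q μ := hg.continuous.continuousOn.integrableOn_compact hQc
  set I := ∫ y in Q, ‖fderiv ℝ g y‖ ^ n ∂μ
  have hI : 0 ≤ I := integral_nonneg fun y => by positivity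
  obtain ⟨K, hK0, hK⟩ := exists_pow_eq (n := n) (B := A * I) (by omega) (by positivity)
  have hb : ∀ z ∈ Q, |(∫ y in Q, g y ∂μ) - μ.real Q * g z| ≤ K := by
    intro z hz
    refine le_of_pow_le_pow_left₀ (n := n) (by omega) hK0 ?_
    have := abs_setIntegral_sub_pow_le μ hn hd hg hz
    rw [integral_sub hgi (integrable_const _)] at this
    simp only [integral_const, measureReal_restrict_apply_univ, smul_eq_mul] at this
    rw [hK]
    refine this.trans (le_of_eq ?_)
    rw [hA, mul_assoc (_ ^ n)]
  have h1 : μ.real Q * |g x - g y| ≤ 2 * K := by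
    have hx' := abs_le.1 (hb x hx)
    have hy' := abs_le.1 (hb y hy)
    rw [← abs_of_pos hQ0, ← abs_mul, abs_le]
    constructor <;> nlinarith
  have h2 := pow_le_pow_left₀ (by positivity) h1 n
  rw [mul_pow, mul_pow, hK] at h2
  rw [div_mul_eq_mul_div, le_div_iff₀ (by positivity)]
  linarith

end Morrey

/-! ### Coordinate slices with small oscillation -/

/-- The linear embedding of a coordinate hyperplane. -/
noncomputable def sliceMap (d : ℕ) (i : Fin (d + 1)) : (Fin d → ℝ) →L[ℝ] Euc (d + 1) :=
  LinearMap.toContinuousLinearMap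
    { toFun := fun y => WithLp.toLp 2 (Fin.insertNth (α := fun _ => ℝ) i 0 y)
      map_add' := fun x y => by
        ext j
        refine Fin.succAboveCases i ?_ (fun j => ?_) j <;> simp
      map_smul' := fun c y => by
        ext j
        refine Fin.succAboveCases i ?_ (fun j => ?_) j <;> simp }

/-- The parametrization of the hyperplane `x i = t`. -/
noncomputable def slice (d : ℕ) (i : Fin (d + 1)) (t : ℝ) (y : Fin d → ℝ) : Euc (d + 1) :=
  WithLp.toLp 2 (Fin.insertNth (α := fun _ => ℝ) i t y)

theorem slice_eq (d : ℕ) (i : Fin (d + 1)) (t : ℝ) (y : Fin d → ℝ) :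
    slice d i t y = sliceMap d i y + EuclideanSpace.single i t := by
  ext j
  refine Fin.succAboveCases i ?_ (fun j => ?_) j <;> simp [slice, sliceMap]

theorem continuous_slice (d : ℕ) (i : Fin (d + 1)) :
    Continuous fun p : ℝ × (Fin d → ℝ) => slice d i p.1 p.2 := by
  unfold slice
  refine (PiLp.continuous_toLp 2 _).comp ?_
  exact Continuous.finInsertNth i continuous_fst continuous_snd

theorem slice_removeNth (d : ℕ) (i : Fin (d + 1)) {x : Euc (d + 1)} {t : ℝ} (h : x i = t) :
    slice d i t (fun j => x (i.succAbove j)) = x := by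
  ext j
  refine Fin.succAboveCases i ?_ (fun j => ?_) j <;> simp [slice, h]

theorem measurePreserving_slice (d : ℕ) (i : Fin (d + 1)) :
    MeasurePreserving (fun x : Euc (d + 1) => (x i, fun j => x (i.succAbove j))) volume volume := by
  have h1 := EuclideanSpace.volume_preserving_symm_measurableEquiv_toLp (Fin (d + 1))
  have h2 := volume_preserving_piFinSuccAbove (fun _ : Fin (d + 1) => ℝ) i
  exact h2.comp h1

theorem measurableEmbedding_slice (d : ℕ) (i : Fin (d + 1)) :
    MeasurableEmbedding (fun x : Euc (d + 1) => (x i, fun j => x (i.succAbove j))) :=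
  (MeasurableEquiv.piFinSuccAbove (fun _ : Fin (d + 1) => ℝ) i).measurableEmbedding.comp
    (MeasurableEquiv.toLp 2 (Fin (d + 1) → ℝ)).symm.measurableEmbedding

/-- The slab-shaped box `{x i ∈ [α, α + 1], |x j| ≤ L for j ≠ i}`. -/
def slab (d : ℕ) (i : Fin (d + 1)) (α L : ℝ) : Set (Euc (d + 1)) :=
  {x | x i ∈ Icc α (α + 1) ∧ ∀ j, |x (i.succAbove j)| ≤ L}

theorem exists_good_slice {d : ℕ} (hd : 1 ≤ d) {L : ℝ} (hL : 0 < L) : ∃ C : ℝ, 0 ≤ C ∧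
    ∀ G : Euc (d + 1) → ℝ, ContDiff ℝ 1 G → ∀ i α, ∃ t ∈ Icc α (α + 1), ∀ x y : Euc (d + 1),
      x i = t → y i = t → (∀ j, |x (i.succAbove j)| ≤ L) → (∀ j, |y (i.succAbove j)| ≤ L) →
      |G x - G y| ^ (d + 1) ≤ C * ∫ z in slab d i α L, ‖gradient G z‖ ^ (d + 1) := by
  obtain ⟨C, hC0, hC⟩ := morrey_pow_le (volume : Measure (Fin d → ℝ)) hL (n := d + 1) (by omega)
    (by simp)
  set S := ∑ i, ‖sliceMap d i‖ ^ (d + 1) with hS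
  have hS0 : 0 ≤ S := Finset.sum_nonneg fun i _ => by positivity
  refine ⟨C * S, by positivity, fun G hG i α => ?_⟩
  set Q := closedBall (0 : Fin d → ℝ) L with hQ
  have hQc : IsCompact Q := isCompact_closedBall _ _
  set F : Euc (d + 1) → ℝ := fun z => ‖gradient G z‖ ^ (d + 1) with hF
  have hFc : Continuous F := by have := continuous_gradient hG; fun_prop
  have hcs := continuous_slice d i
  have hint : IntegrableOn (fun p : ℝ × (Fin d → ℝ) => F (slice d i p.1 p.2))
      (Icc α (α + 1) ×ˢ Q) (volume.prod volume) :=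
    (hFc.comp hcs).continuousOn.integrableOn_compact (isCompact_Icc.prod hQc)
  have e1 : ∫ z in slab d i α L, F z = ∫ t in Icc α (α + 1), ∫ y in Q, F (slice d i t y) := by
    rw [← setIntegral_prod (fun p : ℝ × (Fin d → ℝ) => F (slice d i p.1 p.2)) hint]
    have := (measurePreserving_slice d i).setIntegral_preimage_emb (measurableEmbedding_slice d i)
      (fun p : ℝ × (Fin d → ℝ) => F (slice d i p.1 p.2)) (Icc α (α + 1) ×ˢ Q)
    simp only [slice_removeNth d i rfl] at this
    rw [← Measure.volume_eq_prod, ← this]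
    congr 2
    ext x
    simp only [slab, hQ, mem_preimage, mem_prod, mem_ofPred_eq, mem_closedBall_zero_iff,
      pi_norm_le_iff_of_nonneg hL.le, Real.norm_eq_abs]
  obtain ⟨t, ht, hle⟩ := exists_le_setAverage (μ := volume) (s := Icc α (α + 1))
    (f := fun t => ∫ y in Q, F (slice d i t y)) (by simp) (by simp) (by
      have := hint
      rw [IntegrableOn, ← Measure.prod_restrict] at this
      exact this.integral_prod_left)
  rw [setAverage_eq, ← e1] at hle
  simp only [volume_real_Icc, add_sub_cancel_left, smul_eq_mul] at hle
  norm_num at hle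
  refine ⟨t, ht, fun x y hx hy hxL hyL => ?_⟩
  set g : (Fin d → ℝ) → ℝ := fun y => G (slice d i t y) with hg
  have hgc : ContDiff ℝ 1 g := by
    simp only [hg, slice_eq]
    exact hG.comp ((sliceMap d i).contDiff.add contDiff_const)
  have hmem : ∀ x : Euc (d + 1), (∀ j, |x (i.succAbove j)| ≤ L) →
      (fun j => x (i.succAbove j)) ∈ Q := by
    intro x hx
    simpa only [hQ, mem_closedBall_zero_iff, pi_norm_le_iff_of_nonneg hL.le, Real.norm_eq_abs]
  have h1 := hC g hgc _ (hmem x hxL) _ (hmem y hyL)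
  simp only [hg, slice_removeNth d i hx, slice_removeNth d i hy] at h1
  refine h1.trans ?_
  rw [mul_assoc]
  refine mul_le_mul_of_nonneg_left ?_ hC0
  refine le_trans ?_ (mul_le_mul_of_nonneg_left hle hS0)
  rw [← integral_const_mul]
  refine setIntegral_mono_on ?_ ?_ measurableSet_closedBall ?_
  · exact integrableOn_of_continuous hQc ((hgc.continuous_fderiv one_ne_zero).norm.pow _)
  · exact integrableOn_of_continuous hQc (continuous_const.mul
      (hFc.comp (hcs.comp (by fun_prop : Continuous fun y : Fin d → ℝ => (t, y)))))
  · intro z _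
    have h2 : HasFDerivAt g ((fderiv ℝ G (slice d i t z)).comp (sliceMap d i)) z := by
      have h3 := (hG.differentiable one_ne_zero (slice d i t z)).hasFDerivAt
      refine h3.comp z ?_
      have := ((sliceMap d i).hasFDerivAt (x := z)).add_const (EuclideanSpace.single i t)
      simpa only [← slice_eq] using this
    change ‖fderiv ℝ g z‖ ^ (d + 1) ≤ S * F (slice d i t z)
    rw [h2.fderiv, hF]
    simp only [norm_gradient]
    calc _ ≤ (‖fderiv ℝ G (slice d i t z)‖ * ‖sliceMap d i‖) ^ (d + 1) := by
          gcongr; exact ContinuousLinearMap.opNorm_comp_le _ _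
      _ = ‖sliceMap d i‖ ^ (d + 1) * ‖fderiv ℝ G (slice d i t z)‖ ^ (d + 1) := by ring
      _ ≤ _ := by
        gcongr
        exact Finset.single_le_sum (f := fun i => ‖sliceMap d i‖ ^ (d + 1))
          (fun i _ => by positivity) (Finset.mem_univ i)


/-! ### A logarithmic energy estimate -/

theorem continuous_of_tsupport {n : ℕ} {f η : Euc n → ℝ} (h : ∀ x ∈ tsupport η, ContinuousAt f x)
    (h0 : ∀ x ∉ tsupport η, f x = 0) : Continuous f := by
  rw [continuous_iff_continuousAt]
  intro x
  by_cases hx : x ∈ tsupport η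
  · exact h x hx
  · refine (continuousAt_const (y := (0 : ℝ))).congr ?_
    filter_upwards [(isClosed_tsupport η).isOpen_compl.mem_nhds hx] with y hy using (h0 y hy).symm

theorem young_pow {n : ℕ} (hn : 2 ≤ n) {p q : ℝ} (hp : 0 ≤ p) (hq : 0 ≤ q) :
    n * p ^ (n - 1) * q ≤ (n - 1) / 2 * p ^ n + n * 4 ^ (n - 1) * q ^ n := by
  obtain ⟨k, rfl⟩ := Nat.exists_eq_add_of_le' hn
  rw [show k + 2 - 1 = k + 1 by omega]
  push_cast
  rcases le_total (4 * q) p with h | h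
  · have h1 : (k + 2 : ℝ) * p ^ (k + 1) * q ≤ (k + 2 - 1) / 2 * p ^ (k + 2) := by
      have : (k + 2 : ℝ) * q ≤ (k + 2 - 1) / 2 * p := by
        have hk : (0 : ℝ) ≤ k := by positivity
        nlinarith
      calc _ = p ^ (k + 1) * ((k + 2 : ℝ) * q) := by ring
        _ ≤ p ^ (k + 1) * ((k + 2 - 1) / 2 * p) := by gcongr
        _ = _ := by ring
    have : 0 ≤ (k + 2 : ℝ) * 4 ^ (k + 1) * q ^ (k + 2) := by positivity
    linarith
  · have h1 : (k + 2 : ℝ) * p ^ (k + 1) * q ≤ (k + 2 : ℝ) * 4 ^ (k + 1) * q ^ (k + 2) := by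
      calc _ ≤ (k + 2 : ℝ) * (4 * q) ^ (k + 1) * q := by gcongr
        _ = _ := by ring
    have : 0 ≤ (k + 2 - 1 : ℝ) / 2 * p ^ (k + 2) :=
      mul_nonneg (by have : (0:ℝ) ≤ k := by positivity
                     linarith) (by positivity)
    linarith

/-- A smooth cutoff supported in an annulus. -/
noncomputable def annCutoff (n : ℕ) (R : ℝ) (x : Euc n) : ℝ :=
  Real.smoothTransition (4 * ‖x‖ ^ 2 - 2) * Real.smoothTransition (R ^ 2 + 1 - ‖x‖ ^ 2)

theorem contDiff_annCutoff (n : ℕ) (R : ℝ) : ContDiff ℝ 1 (annCutoff n R) := by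
  have h : ContDiff ℝ 1 fun x : Euc n => ‖x‖ ^ 2 := contDiff_norm_sq ℝ
  exact (Real.smoothTransition.contDiff.comp ((contDiff_const.mul h).sub contDiff_const)).mul
    (Real.smoothTransition.contDiff.comp (contDiff_const.sub h))

theorem annCutoff_nonneg (n : ℕ) (R : ℝ) (x : Euc n) : 0 ≤ annCutoff n R x :=
  mul_nonneg (Real.smoothTransition.nonneg _) (Real.smoothTransition.nonneg _)

theorem annCutoff_eq_one {n : ℕ} {R : ℝ} {x : Euc n} (hx : x ∈ ann n 1 R) :
    annCutoff n R x = 1 := by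
  have h1 : 1 ≤ ‖x‖ ^ 2 := one_le_pow₀ hx.1
  have h2 : ‖x‖ ^ 2 ≤ R ^ 2 := pow_le_pow_left₀ (norm_nonneg _) hx.2 2
  rw [annCutoff, Real.smoothTransition.one_of_one_le (by linarith),
    Real.smoothTransition.one_of_one_le (by linarith), one_mul]

theorem tsupport_annCutoff {n : ℕ} {R : ℝ} (hR : 0 < R) :
    tsupport (annCutoff n R) ⊆ {x | 1 / 2 < ‖x‖ ∧ ‖x‖ < R + 1} := by
  have : tsupport (annCutoff n R) ⊆ {x | 1 / 2 ≤ ‖x‖ ^ 2 ∧ ‖x‖ ^ 2 ≤ R ^ 2 + 1} := by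
    have hc : Continuous fun x : Euc n => ‖x‖ ^ 2 := by fun_prop
    have hcl : IsClosed ({x : Euc n | 1 / 2 ≤ ‖x‖ ^ 2} ∩ {x : Euc n | ‖x‖ ^ 2 ≤ R ^ 2 + 1}) :=
      (isClosed_le continuous_const hc).inter (isClosed_le hc continuous_const)
    refine closure_minimal (fun x hx => ?_) hcl
    constructor
    · by_contra h
      exact hx (by rw [annCutoff, Real.smoothTransition.zero_of_nonpos (by linarith), zero_mul])
    · by_contra h
      exact hx (by rw [annCutoff, Real.smoothTransition.zero_of_nonpos
        (x := R ^ 2 + 1 - ‖x‖ ^ 2) (by linarith), mul_zero])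
  intro x hx
  obtain ⟨h1, h2⟩ := this hx
  constructor
  · by_contra h
    have := norm_nonneg x
    nlinarith
  · by_contra h
    nlinarith

theorem hasCompactSupport_annCutoff {n : ℕ} {R : ℝ} (hR : 0 < R) :
    HasCompactSupport (annCutoff n R) :=
  (isCompact_closedBall 0 (R + 1)).of_isClosed_subset (isClosed_tsupport _) fun x hx => by
    simpa using (tsupport_annCutoff hR hx).2.le

/-- The region on which the weak inequality in Harnack's inequality is required. -/
def region (n : ℕ) (R : ℝ) : Set (Euc n) := {x | 1 / 2 < ‖x‖ ∧ ‖x‖ < R + 1}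

theorem norm_gradient_arsinh_le {n : ℕ} {w : Euc n → ℝ} (hw : ContDiff ℝ 1 w) {x : Euc n}
    (hx : 0 ≤ w x) :
    ‖gradient (fun x => Real.arsinh (w x)) x‖ ≤ 2 * (‖gradient w x‖ / (w x + 1)) := by
  rw [(hasGradientAt_comp (Real.hasDerivAt_arsinh (w x)) (hasGradientAt_of_contDiff hw x)).gradient,
    norm_smul, Real.norm_of_nonneg (by positivity)]
  have h1 : (w x + 1) / 2 ≤ √(1 + w x ^ 2) := by
    apply Real.le_sqrt_of_sq_le
    nlinarith [sq_nonneg (w x - 1)]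
  rw [inv_mul_eq_div]
  calc _ ≤ ‖gradient w x‖ / ((w x + 1) / 2) := by gcongr
    _ = _ := by field_simp

theorem log_energy {n : ℕ} (hn : 2 ≤ n) {K R : ℝ} (hR : 0 < R) :
    ∃ E : ℝ, 0 ≤ E ∧ ∀ w : Euc n → ℝ, ContDiff ℝ 1 w → (∀ x ∈ region n R, 0 ≤ w x) →
      (∀ φ : Euc n → ℝ, ContDiff ℝ 1 φ → HasCompactSupport φ → tsupport φ ⊆ region n R →
        (∀ x, 0 ≤ φ x) → -(K * ∫ x, φ x) ≤ ∫ x, ⟪nflux n (gradient w x), gradient φ x⟫_ℝ) →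
      0 ≤ K →
      ∫ x in ann n 1 R, ‖gradient (fun x => Real.arsinh (w x)) x‖ ^ n ≤ E := by
  set η := annCutoff n R with hη
  have hηc : ContDiff ℝ 1 η := contDiff_annCutoff n R
  have hηs : HasCompactSupport η := hasCompactSupport_annCutoff hR
  have hηt : tsupport η ⊆ region n R := tsupport_annCutoff hR
  have hηg := continuous_gradient hηc
  have hη0 : ∀ x, 0 ≤ η x := annCutoff_nonneg n R
  have hn1 : (0 : ℝ) < (n - 1) / 2 := by
    have : (2 : ℝ) ≤ n := by exact_mod_cast hn
    linarith
  have hi1 : Integrable fun x => η x ^ n := by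
    refine Continuous.integrable_of_hasCompactSupport (hηc.continuous.pow n) ?_
    exact hηs.mono fun x hx hx2 => hx (by simp [show η x = 0 from hx2, show n ≠ 0 by omega])
  have hi2 : Integrable fun x => ‖gradient η x‖ ^ n := by
    refine Continuous.integrable_of_hasCompactSupport (hηg.norm.pow n) ?_
    exact (hasCompactSupport_gradient hηs).mono fun x hx hx2 =>
      hx (by simp [show gradient η x = 0 from hx2, show n ≠ 0 by omega])
  set I := (K * ∫ x, η x ^ n) + n * 4 ^ (n - 1) * ∫ x, ‖gradient η x‖ ^ n with hI
  refine ⟨2 ^ n * (|I| / ((n - 1) / 2)), by positivity, fun w hw hw0 hweak hK => ?_⟩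
  have hwg := continuous_gradient hw
  set s : Euc n → ℝ := fun x => w x + 1
  have hs1 : ∀ x ∈ region n R, 1 ≤ s x := fun x hx => by
    have := hw0 x hx; simp only [s]; linarith
  set φ : Euc n → ℝ := fun x => η x ^ n * (s x ^ (n - 1))⁻¹ with hφ
  have hφη : Function.support φ ⊆ Function.support η := by
    intro x hx hx2
    exact hx (by simp [hφ, show η x = 0 from hx2, show n ≠ 0 by omega])
  have hφt : tsupport φ ⊆ tsupport η := closure_mono hφη
  have hφc : ContDiff ℝ 1 φ := by
    refine contDiff_one_of_tsupport fun x hx => ?_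
    have : 1 ≤ s x := hs1 x (hηt (hφt hx))
    refine (hηc.contDiffAt.pow n).mul (ContDiffAt.inv ?_ (by positivity))
    exact (hw.contDiffAt.add contDiffAt_const).pow _
  have hφs : HasCompactSupport φ := hηs.mono hφη
  have hφ0 : ∀ x, 0 ≤ φ x := by
    intro x
    by_cases hx : x ∈ region n R
    · have := hs1 x hx
      have := hη0 x
      positivity
    · have : η x = 0 := image_eq_zero_of_notMem_tsupport fun h => hx (hηt h)
      simp [hφ, this, show n ≠ 0 by omega]
  have hW := hweak φ hφc hφs (hφt.trans hηt) hφ0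
  have hφle : ∫ x, φ x ≤ ∫ x, η x ^ n := by
    refine integral_mono (hφc.continuous.integrable_of_hasCompactSupport hφs) hi1 fun x => ?_
    by_cases hx : x ∈ region n R
    · refine mul_le_of_le_one_right (pow_nonneg (hη0 x) _) (inv_le_one_of_one_le₀ (one_le_pow₀ (hs1 x hx)))
    · have : η x = 0 := image_eq_zero_of_notMem_tsupport fun h => hx (hηt h)
      simp [hφ, this, show n ≠ 0 by omega]
  set P : Euc n → ℝ := fun x => (η x * ‖gradient w x‖ / s x) ^ n with hP
  have hPc : Continuous P := by
    refine continuous_of_tsupport (η := η) (fun x hx => ?_) fun x hx => ?_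
    · have : 1 ≤ s x := hs1 x (hηt hx)
      refine ContinuousAt.pow (ContinuousAt.div ?_ ?_ (by positivity)) n
      · exact (hηc.continuous.mul hwg.norm).continuousAt
      · exact (hw.continuous.add continuous_const).continuousAt
    · simp [hP, image_eq_zero_of_notMem_tsupport hx, show n ≠ 0 by omega]
  have hPi : Integrable P := by
    refine hPc.integrable_of_hasCompactSupport (hηs.mono fun x hx hx2 => hx ?_)
    simp [hP, show η x = 0 from hx2, show n ≠ 0 by omega]
  have hpt : ∀ x, ⟪nflux n (gradient w x), gradient φ x⟫_ℝ ≤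
      n * 4 ^ (n - 1) * ‖gradient η x‖ ^ n - (n - 1) / 2 * P x := by
    intro x
    by_cases hx : x ∈ tsupport η
    · have hsx : 1 ≤ s x := hs1 x (hηt hx)
      have hs0 : 0 < s x := by linarith
      have hg : HasGradientAt φ ((n * η x ^ (n - 1) * (s x ^ (n - 1))⁻¹) • gradient η x -
          ((n - 1) * η x ^ n * (s x ^ n)⁻¹) • gradient w x) x := by
        have h1 : HasFDerivAt (fun x => η x ^ n) _ x :=
          ((hηc.differentiable one_ne_zero x).hasFDerivAt).pow n
        have hsd : HasFDerivAt s (fderiv ℝ w x) x :=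
          ((hw.differentiable one_ne_zero x).hasFDerivAt).add_const 1
        have h2 : HasFDerivAt (fun x => (s x ^ (n - 1))⁻¹) _ x :=
          (hasDerivAt_inv (x := s x ^ (n - 1)) (by positivity)).comp_hasFDerivAt x (hsd.pow (n - 1))
        rw [hasGradientAt_iff_hasFDerivAt]
        refine (h1.mul h2).congr_fderiv ?_
        obtain ⟨k, rfl⟩ := Nat.exists_eq_add_of_le' hn
        rw [show k + 2 - 1 = k + 1 by omega] at *
        rw [show k + 1 - 1 = k by omega]
        ext y
        simp only [_root_.add_apply, _root_.smul_apply, InnerProductSpace.toDual_apply_apply, inner_sub_left,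
          real_inner_smul_left, inner_gradient_left, smul_eq_mul, nsmul_eq_mul]
        push_cast
        field_simp
        ring
      rw [hg.gradient, inner_sub_right, real_inner_smul_right, real_inner_smul_right,
        inner_nflux_self hn]
      have h1 : ⟪nflux n (gradient w x), gradient η x⟫_ℝ ≤
          ‖gradient w x‖ ^ (n - 1) * ‖gradient η x‖ := by
        rw [← norm_nflux hn]; exact real_inner_le_norm _ _
      have h2 := young_pow hn (p := η x * ‖gradient w x‖ / s x) (q := ‖gradient η x‖)
        (by have := hη0 x; positivity) (by positivity)
      have h3 : n * η x ^ (n - 1) * (s x ^ (n - 1))⁻¹ * ⟪nflux n (gradient w x), gradient η x⟫_ℝ ≤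
          n * (η x * ‖gradient w x‖ / s x) ^ (n - 1) * ‖gradient η x‖ := by
        have := hη0 x
        calc _ ≤ n * η x ^ (n - 1) * (s x ^ (n - 1))⁻¹ *
              (‖gradient w x‖ ^ (n - 1) * ‖gradient η x‖) := by gcongr
          _ = _ := by rw [div_pow, mul_pow]; ring
      have h4 : (n - 1) * η x ^ n * (s x ^ n)⁻¹ * ‖gradient w x‖ ^ n = (n - 1) * P x := by
        simp only [hP]; rw [div_pow, mul_pow]; ring
      rw [h4]
      have h5 : (η x * ‖gradient w x‖ / s x) ^ n = P x := rfl
      rw [h5] at h2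
      linarith
    · have hz : gradient φ x = 0 := gradient_eq_zero_of_notMem_tsupport fun h => hx (hφt h)
      have hz2 : P x = 0 := by
        simp [hP, image_eq_zero_of_notMem_tsupport hx, show n ≠ 0 by omega]
      rw [hz, hz2, inner_zero_right, mul_zero, sub_zero]
      positivity
  have hint : ∫ x, ⟪nflux n (gradient w x), gradient φ x⟫_ℝ ≤
      n * 4 ^ (n - 1) * (∫ x, ‖gradient η x‖ ^ n) - (n - 1) / 2 * ∫ x, P x := by
    rw [← integral_const_mul, ← integral_const_mul, ← integral_sub (hi2.const_mul _) (hPi.const_mul _)]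
    refine integral_mono ?_ ((hi2.const_mul _).sub (hPi.const_mul _)) hpt
    have h1 := continuous_nflux n
    have h2 := continuous_gradient hφc
    refine Continuous.integrable_of_hasCompactSupport (by fun_prop) ?_
    exact (hasCompactSupport_gradient hφs).mono fun x hx hx2 =>
      hx (by simp only [show gradient φ x = 0 from hx2, inner_zero_right])
  have hPI : ∫ x, P x ≤ |I| / ((n - 1) / 2) := by
    rw [le_div_iff₀ hn1]
    have : K * ∫ x, φ x ≤ K * ∫ x, η x ^ n := mul_le_mul_of_nonneg_left hφle hK
    linarith [le_abs_self I]
  have hwa : ContDiff ℝ 1 fun x => Real.arsinh (w x) := hw.arsinh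
  calc _ ≤ ∫ x in ann n 1 R, 2 ^ n * P x := by
        refine setIntegral_mono_on (integrableOn_of_continuous (isCompact_ann n 1 R)
          ((continuous_gradient hwa).norm.pow n)) (hPi.const_mul _).integrableOn
          (isClosed_ann n 1 R).measurableSet fun x hx => ?_
        have hx2 : x ∈ region n R := ⟨by linarith [hx.1], by linarith [hx.2]⟩
        have h1 : η x = 1 := annCutoff_eq_one hx
        have h2 := norm_gradient_arsinh_le hw (hw0 x hx2)
        calc _ ≤ (2 * (‖gradient w x‖ / (w x + 1))) ^ n := by gcongr
          _ = _ := by simp only [hP, h1, s]; rw [mul_pow, one_mul]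
    _ ≤ ∫ x, 2 ^ n * P x := by
        refine setIntegral_le_integral (hPi.const_mul _) (ae_of_all _ fun x => ?_)
        by_cases hx : x ∈ region n R
        · have h1 := hs1 x hx
          have h2 := hη0 x
          simp only [hP, Pi.zero_apply]; positivity
        · have : η x = 0 := image_eq_zero_of_notMem_tsupport fun h => hx (hηt h)
          simp [hP, this, show n ≠ 0 by omega]
    _ = 2 ^ n * ∫ x, P x := integral_const_mul _ _
    _ ≤ _ := by gcongr


/-! ### A barrier bound -/

theorem integrable_inner_gradient {n : ℕ} {X : Euc n → Euc n} (hX : Continuous X) {φ : Euc n → ℝ}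
    (hφ : ContDiff ℝ 1 φ) (hφs : HasCompactSupport φ) :
    Integrable fun x => ⟪X x, gradient φ x⟫_ℝ := by
  have h2 := continuous_gradient hφ
  refine Continuous.integrable_of_hasCompactSupport (by fun_prop) ?_
  exact (hasCompactSupport_gradient hφs).mono fun x hx hx2 =>
    hx (by simp only [show gradient φ x = 0 from hx2, inner_zero_right])

theorem abs_coord_le_norm {n : ℕ} (x : Euc n) (i : Fin n) : |x i| ≤ ‖x‖ := by
  simpa using PiLp.norm_apply_le x i

theorem barrier_le {n : ℕ} (hn : 2 ≤ n) {K R m : ℝ} (hK : 0 ≤ K) {D : Set (Euc n)} (hD : IsOpen D)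
    (hDR : D ⊆ closedBall 0 R) {w : Euc n → ℝ} (hw : ContDiff ℝ 1 w)
    (hle : ∀ x ∈ frontier D, w x ≤ m)
    (hsub : ∀ φ : Euc n → ℝ, ContDiff ℝ 1 φ → HasCompactSupport φ → tsupport φ ⊆ D →
      (∀ x, 0 ≤ φ x) → ∫ x, ⟪nflux n (gradient w x), gradient φ x⟫_ℝ ≤ K * ∫ x, φ x) :
    ∀ x ∈ D, w x ≤ m + Real.exp R * (K + 1) * Real.exp R := by
  set i : Fin n := ⟨0, by omega⟩
  set e : Euc n := EuclideanSpace.single i 1 with he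
  have hne : ‖e‖ = 1 := by simp [he]
  have hxe : ∀ x : Euc n, ⟪e, x⟫_ℝ = x i := fun x => by
    rw [he, EuclideanSpace.inner_single_left]; simp
  set c := Real.exp R * (K + 1) with hc
  have hc0 : 0 ≤ c := by positivity
  set z : Euc n → ℝ := fun x => m + c * (Real.exp R - Real.exp ⟪e, x⟫_ℝ) with hz
  have hzc : ContDiff ℝ 1 z := by
    have : ContDiff ℝ 1 fun x : Euc n => ⟪e, x⟫_ℝ := contDiff_const.inner ℝ contDiff_id
    fun_prop
  have hzg : ∀ x, gradient z x = -((c * Real.exp ⟪e, x⟫_ℝ) • e) := by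
    intro x
    have h1 : HasGradientAt (fun x : Euc n => ⟪e, x⟫_ℝ) e x := by
      rw [hasGradientAt_iff_hasFDerivAt]
      exact (InnerProductSpace.toDual ℝ (Euc n) e).hasFDerivAt
    have h2 : HasDerivAt (fun s => m + c * (Real.exp R - Real.exp s))
        (-(c * Real.exp ⟪e, x⟫_ℝ)) ⟪e, x⟫_ℝ := by
      simpa using (((Real.hasDerivAt_exp ⟪e, x⟫_ℝ).const_sub (Real.exp R)).const_mul c).const_add m
    rw [(hasGradientAt_comp h2 h1).gradient, neg_smul]
  have hzf : ∀ x, nflux n (gradient z x) = -((c * Real.exp ⟪e, x⟫_ℝ) ^ (n - 1) • e) := by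
    intro x
    rw [hzg, nflux_neg, nflux_smul hn (by positivity)]
    simp [nflux, hne]
  have hDR' : closure D ⊆ closedBall 0 R := closure_minimal hDR isClosed_closedBall
  have hzm : ∀ x ∈ closure D, m ≤ z x := by
    intro x hx
    have h1 : ‖x‖ ≤ R := by simpa using hDR' hx
    have h2 : Real.exp ⟪e, x⟫_ℝ ≤ Real.exp R := by
      rw [hxe]; exact Real.exp_le_exp.2 ((le_abs_self _).trans ((abs_coord_le_norm x i).trans h1))
    have := mul_nonneg hc0 (sub_nonneg.2 h2)
    simp only [hz]; linarith
  have key := comparison_principle hn hD (isBounded_closedBall.subset hDR) isOpen_univ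
    (subset_univ _) hw.contDiffOn hzc.contDiffOn
    (fun x hx => (hle x hx).trans (hzm x (frontier_subset_closure hx))) ?_
  · intro x hx
    refine (key x hx).trans ?_
    simp only [hz]
    have := mul_nonneg hc0 (Real.exp_pos ⟪e, x⟫_ℝ).le
    linarith
  intro φ hφ hφs hφD hφ0
  have hfl := continuous_nflux n
  have hwg := continuous_gradient hw
  have hzg' := continuous_gradient hzc
  simp only [inner_sub_left]
  rw [integral_sub (integrable_inner_gradient (X := fun x => nflux n (gradient w x)) (hfl.comp hwg) hφ hφs)
    (integrable_inner_gradient (X := fun x => nflux n (gradient z x)) (hfl.comp hzg') hφ hφs)]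
  have h1 := hsub φ hφ hφs hφD hφ0
  set g : Euc n → ℝ := fun x => (c * Real.exp ⟪e, x⟫_ℝ) ^ (n - 1) with hg
  have hgd : ∀ x, HasFDerivAt g (((n - 1 : ℕ) * (c * Real.exp ⟪e, x⟫_ℝ) ^ (n - 1)) •
      InnerProductSpace.toDual ℝ (Euc n) e) x := by
    intro x
    have h1 : HasFDerivAt (fun x : Euc n => ⟪e, x⟫_ℝ) (InnerProductSpace.toDual ℝ (Euc n) e) x :=
      (InnerProductSpace.toDual ℝ (Euc n) e).hasFDerivAt
    have h2 : HasDerivAt (fun s => (c * Real.exp s) ^ (n - 1))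
        ((n - 1 : ℕ) * (c * Real.exp ⟪e, x⟫_ℝ) ^ (n - 1)) ⟪e, x⟫_ℝ := by
      refine (((Real.hasDerivAt_exp ⟪e, x⟫_ℝ).const_mul c).pow (n - 1)).congr_deriv ?_
      obtain ⟨k, rfl⟩ := Nat.exists_eq_add_of_le' hn
      rw [show k + 2 - 1 = k + 1 by omega, show k + 1 - 1 = k by omega, pow_succ, mul_assoc]
    exact h2.comp_hasFDerivAt x h1
  have hgc : Continuous g := by fun_prop
  have hφc := hφ.continuous
  have hgφ : Integrable fun x => g x * φ x :=
    (hgc.mul hφc).integrable_of_hasCompactSupport hφs.mul_left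
  have hgf : ∀ x, fderiv ℝ g x e = (n - 1 : ℕ) * g x := by
    intro x
    rw [(hgd x).fderiv]
    simp [hne, hg]
  have hφe : Integrable fun x => g x * fderiv ℝ φ x e := by
    have := integrable_inner_gradient (X := fun x => g x • e) (by fun_prop) hφ hφs
    refine this.congr (ae_of_all _ fun x => ?_)
    simp only [real_inner_smul_left, real_inner_comm (gradient φ x) e, inner_gradient_left]
  have hip := integral_mul_fderiv_eq_neg_fderiv_mul_of_integrable (μ := volume) (f := g) (g := φ)
    (v := e) (by simp only [hgf, mul_assoc]; exact hgφ.const_mul _) hφe hgφ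
    (fun x _ => (hgd x).differentiableAt) (fun x _ => hφ.differentiable one_ne_zero x)
  have e2 : ∫ x, ⟪nflux n (gradient z x), gradient φ x⟫_ℝ = ∫ x, (n - 1 : ℕ) * (g x * φ x) := by
    have : ∀ x, ⟪nflux n (gradient z x), gradient φ x⟫_ℝ = -(g x * fderiv ℝ φ x e) := by
      intro x
      rw [hzf, inner_neg_left, real_inner_smul_left,
        real_inner_comm (gradient φ x) e, inner_gradient_left]
    simp only [this, integral_neg]
    rw [hip, neg_neg]
    simp only [hgf, mul_assoc]
  have h3 : K * ∫ x, φ x ≤ ∫ x, (n - 1 : ℕ) * (g x * φ x) := by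
    rw [← integral_const_mul]
    refine integral_mono ((hφc.integrable_of_hasCompactSupport hφs).const_mul _)
      (hgφ.const_mul _) fun x => ?_
    by_cases hx : x ∈ tsupport φ
    · have h1 : ‖x‖ ≤ R := by simpa using hDR (hφD hx)
      have h2 : Real.exp (-R) ≤ Real.exp ⟪e, x⟫_ℝ := by
        rw [hxe]
        exact Real.exp_le_exp.2 (by
          have := neg_abs_le (x i); have := abs_coord_le_norm x i; linarith)
      have h3 : K + 1 ≤ c * Real.exp ⟪e, x⟫_ℝ := by
        calc K + 1 = c * Real.exp (-R) := by
              rw [hc, Real.exp_neg]; field_simp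
          _ ≤ _ := by gcongr
      have h4 : K + 1 ≤ g x := h3.trans (le_self_pow₀ (by linarith) (by omega))
      have h5 : (1 : ℝ) ≤ (n - 1 : ℕ) := by exact_mod_cast (by omega : 1 ≤ n - 1)
      have h6 := hφ0 x
      have h7 : K ≤ (n - 1 : ℕ) * g x := by nlinarith
      simp only
      rw [← mul_assoc]
      exact mul_le_mul_of_nonneg_right h7 h6
    · simp [image_eq_zero_of_notMem_tsupport hx]
  linarith [e2 ▸ h3]


/-! ### A Harnack inequality -/

theorem norm_le_mul_of_forall_abs_le {n : ℕ} {M : ℝ} {x : Euc n}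
    (h : ∀ j, |x j| ≤ M) : ‖x‖ ≤ n * M := by
  have h1 : ‖x‖ ≤ ∑ j, |x j| := by
    rw [EuclideanSpace.norm_eq]
    refine Real.sqrt_le_iff.2 ⟨Finset.sum_nonneg fun _ _ => abs_nonneg _, ?_⟩
    have := Finset.sum_sq_le_sq_sum_of_nonneg (s := Finset.univ) (f := fun j => |x j|)
      fun _ _ => abs_nonneg _
    simpa using this
  refine h1.trans ((Finset.sum_le_sum fun j _ => h j).trans ?_)
  simp

theorem add_one_le_of_abs_arsinh_sub_le {a b c : ℝ} (hb : 0 ≤ b)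
    (h : |Real.arsinh a - Real.arsinh b| ≤ c) : a + 1 ≤ 2 * Real.exp c * (b + 1) := by
  have h1 : a + 1 ≤ Real.exp (Real.arsinh a) := by
    rw [Real.exp_arsinh]
    have : (1 : ℝ) ≤ √(1 + a ^ 2) := Real.one_le_sqrt.2 (by nlinarith)
    linarith
  have h2 : Real.exp (Real.arsinh b) ≤ 2 * (b + 1) := by
    rw [Real.exp_arsinh]
    have : √(1 + b ^ 2) ≤ 1 + b := Real.sqrt_le_iff.2 ⟨by linarith, by nlinarith⟩
    linarith
  have h3 : Real.arsinh a ≤ c + Real.arsinh b := by linarith [le_abs_self (Real.arsinh a - Real.arsinh b)]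
  calc a + 1 ≤ Real.exp (c + Real.arsinh b) := h1.trans (Real.exp_le_exp.2 h3)
    _ = Real.exp c * Real.exp (Real.arsinh b) := Real.exp_add _ _
    _ ≤ Real.exp c * (2 * (b + 1)) := by gcongr
    _ = _ := by ring

/-- Sandwiching a solution between its values on the boundary of a shell. -/
theorem harnack_of_frontier {n : ℕ} (hn : 2 ≤ n) {K R Λ : ℝ} (hK : 0 ≤ K) (hΛ : 1 ≤ Λ)
    {D : Set (Euc n)} (hD : IsOpen D) (hDR : D ⊆ closedBall 0 R) {w : Euc n → ℝ}
    (hw : ContDiff ℝ 1 w) (hw0 : ∀ x ∈ D, 0 ≤ w x) {z : Euc n}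
    (hle : ∀ x ∈ frontier D, w x + 1 ≤ Λ * (w z + 1) ∧ w z + 1 ≤ Λ * (w x + 1))
    (hweak : ∀ φ : Euc n → ℝ, ContDiff ℝ 1 φ → HasCompactSupport φ → tsupport φ ⊆ D →
      (∀ x, 0 ≤ φ x) → |∫ x, ⟪nflux n (gradient w x), gradient φ x⟫_ℝ| ≤ K * ∫ x, φ x)
    {x y : Euc n} (hx : x ∈ D) (hy : y ∈ D) :
    w x + 1 ≤ (Λ ^ 2 * (1 + Real.exp R * (K + 1) * Real.exp R) +
      Real.exp R * (K + 1) * Real.exp R + 1) * (w y + 1) := by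
  set A := Real.exp R * (K + 1) * Real.exp R with hA
  have hA0 : 0 ≤ A := by positivity
  have h1 := barrier_le hn (m := Λ * (w z + 1)) hK hD hDR hw
    (fun p hp => by linarith [(hle p hp).1])
    (fun φ a b c d => (le_abs_self _).trans (hweak φ a b c d)) x hx
  have hneg : ∀ x, gradient (fun x => -w x) x = -gradient w x := fun x => by
    refine HasGradientAt.gradient ?_
    have := (hasGradientAt_of_contDiff hw x)
    rw [hasGradientAt_iff_hasFDerivAt] at this ⊢
    rw [map_neg]
    exact this.neg
  have h2 := barrier_le hn (m := 1 - (w z + 1) / Λ) hK hD hDR hw.neg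
    (fun p hp => by
      have := (hle p hp).2
      have : (w z + 1) / Λ ≤ w p + 1 := by rw [div_le_iff₀ (by linarith)]; linarith
      linarith)
    (fun φ a b c d => by
      simp only [hneg, nflux_neg, inner_neg_left, integral_neg]
      exact (neg_le_abs _).trans (hweak φ a b c d)) y hy
  rw [← hA] at h1 h2
  have hy0 := hw0 y hy
  have h3 : (w z + 1) / Λ ≤ w y + 1 + A := by linarith
  rw [div_le_iff₀ (by linarith)] at h3
  have h4 : w y + 1 + A ≤ (1 + A) * (w y + 1) := by nlinarith
  have h5 : w z + 1 ≤ (1 + A) * (w y + 1) * Λ := h3.trans (by gcongr)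
  have h6 : Λ * (w z + 1) ≤ Λ * ((1 + A) * (w y + 1) * Λ) := by gcongr
  nlinarith

theorem frontier_shell {n : ℕ} {f1 f2 f3 f4 : Fin n → ℝ} :
    IsOpen {x : Euc n | (∀ j, f4 j < x j ∧ x j < f3 j) ∧ ∃ j, x j < f2 j ∨ f1 j < x j} ∧
    ∀ x ∈ closure {x : Euc n | (∀ j, f4 j < x j ∧ x j < f3 j) ∧ ∃ j, x j < f2 j ∨ f1 j < x j},
      (∀ j, f4 j ≤ x j ∧ x j ≤ f3 j) ∧ (∃ j, x j ≤ f2 j ∨ f1 j ≤ x j) ∧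
      (x ∉ {x : Euc n | (∀ j, f4 j < x j ∧ x j < f3 j) ∧ ∃ j, x j < f2 j ∨ f1 j < x j} →
        ∃ j, x j = f1 j ∨ x j = f2 j ∨ x j = f3 j ∨ x j = f4 j) := by
  have hc : ∀ j, Continuous fun x : Euc n => x j := fun j => by fun_prop
  constructor
  · have e : {x : Euc n | (∀ j, f4 j < x j ∧ x j < f3 j) ∧ ∃ j, x j < f2 j ∨ f1 j < x j} =
        (⋂ j, {x : Euc n | f4 j < x j} ∩ {x | x j < f3 j}) ∩
          ⋃ j, {x : Euc n | x j < f2 j} ∪ {x | f1 j < x j} := by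
      ext x; simp
    rw [e]
    refine (isOpen_iInter_of_finite fun j => ?_).inter (isOpen_iUnion fun j => ?_)
    · exact (isOpen_lt continuous_const (hc j)).inter (isOpen_lt (hc j) continuous_const)
    · exact (isOpen_lt (hc j) continuous_const).union (isOpen_lt continuous_const (hc j))
  · intro x hx
    have hcl : IsClosed ((⋂ j, {x : Euc n | f4 j ≤ x j} ∩ {x | x j ≤ f3 j}) ∩
          ⋃ j, {x : Euc n | x j ≤ f2 j} ∪ {x | f1 j ≤ x j}) := by
      refine (isClosed_iInter fun j => ?_).inter (isClosed_iUnion_of_finite fun j => ?_)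
      · exact (isClosed_le continuous_const (hc j)).inter (isClosed_le (hc j) continuous_const)
      · exact (isClosed_le (hc j) continuous_const).union (isClosed_le continuous_const (hc j))
    have h := closure_minimal (fun y hy => ?_) hcl hx
    · simp only [mem_inter_iff, mem_iInter, mem_iUnion, mem_union, Set.mem_ofPred_eq] at h
      refine ⟨h.1, h.2, fun hxD => ?_⟩
      by_contra! hne
      obtain ⟨j, hj⟩ := h.2
      refine hxD ⟨fun j => ⟨lt_of_le_of_ne (h.1 j).1 (hne j).2.2.2.symm,
        lt_of_le_of_ne (h.1 j).2 (hne j).2.2.1⟩, j, ?_⟩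
      rcases hj with hj | hj
      · exact Or.inl (lt_of_le_of_ne hj (hne j).2.1)
      · exact Or.inr (lt_of_le_of_ne hj (hne j).1.symm)
    · obtain ⟨h1, j, h2⟩ := hy
      simp only [mem_inter_iff, mem_iInter, mem_iUnion, mem_union, Set.mem_ofPred_eq]
      exact ⟨fun j => ⟨(h1 j).1.le, (h1 j).2.le⟩, j, h2.imp le_of_lt le_of_lt⟩

/-- If `G` oscillates by at most `c` on each of a family of slices of a cube, at least one
for each coordinate direction, then it oscillates by at most `4 c` on their union. -/
theorem abs_sub_le_of_slices {n : ℕ} (hn : 2 ≤ n) {M c : ℝ} {G : Euc n → ℝ}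
    {S : Fin n → Set ℝ} (hS : ∀ i, (S i).Nonempty) (hSM : ∀ i, ∀ t ∈ S i, |t| ≤ M)
    (h : ∀ i, ∀ t ∈ S i, ∀ x y : Euc n, x i = t → y i = t → (∀ j, |x j| ≤ M) → (∀ j, |y j| ≤ M) →
      |G x - G y| ≤ c) {x y : Euc n} {i k : Fin n} (hi : x i ∈ S i) (hk : y k ∈ S k)
    (hx : ∀ j, |x j| ≤ M) (hy : ∀ j, |y j| ≤ M) : |G x - G y| ≤ 4 * c := by
  have hM : 0 ≤ M := (abs_nonneg _).trans (hx i)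
  have hc : 0 ≤ c := (abs_nonneg _).trans (h i _ hi x x rfl rfl hx hx)
  have key : ∀ {x y : Euc n} {i k : Fin n}, i ≠ k → x i ∈ S i → y k ∈ S k → (∀ j, |x j| ≤ M) →
      (∀ j, |y j| ≤ M) → |G x - G y| ≤ 2 * c := by
    intro x y i k hik hi hk hx hy
    set p : Euc n := WithLp.toLp 2 fun j => if j = i then x i else if j = k then y k else 0 with hp
    have hpi : p i = x i := by simp [hp]
    have hpk : p k = y k := by simp [hp, hik.symm]
    have hpM : ∀ j, |p j| ≤ M := by
      intro j
      simp only [hp]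
      split_ifs
      · exact hx i
      · exact hy k
      · simpa using hM
    have h1 := h i _ hi x p rfl hpi hx hpM
    have h2 := h k _ hk p y hpk rfl hpM hy
    linarith [abs_sub_le (G x) (G p) (G y)]
  by_cases hik : i = k
  · subst hik
    have : Nontrivial (Fin n) := Fin.nontrivial_iff_two_le.2 hn
    obtain ⟨l, hl⟩ := exists_ne i
    obtain ⟨s, hs⟩ := hS l
    set p : Euc n := WithLp.toLp 2 fun j => if j = l then s else 0 with hp
    have hpl : p l = s := by simp [hp]
    have hpM : ∀ j, |p j| ≤ M := by
      intro j
      simp only [hp]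
      split_ifs
      · exact hSM l s hs
      · simpa using hM
    have h1 := key hl.symm hi (hpl ▸ hs : p l ∈ S l) hx hpM
    have h2 := key hl (hpl ▸ hs : p l ∈ S l) hk hpM hy
    linarith [abs_sub_le (G x) (G p) (G y)]
  · linarith [key hik hi hk hx hy]


theorem exists_slice_osc_le {n : ℕ} (hn : 2 ≤ n) {K M : ℝ} (hK : 0 ≤ K) (hM : 1 ≤ M) :
    ∃ c : ℝ, ∀ w : Euc n → ℝ, ContDiff ℝ 1 w → (∀ x ∈ region n (n * M), 0 ≤ w x) →
      (∀ φ : Euc n → ℝ, ContDiff ℝ 1 φ → HasCompactSupport φ → tsupport φ ⊆ region n (n * M) →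
        (∀ x, 0 ≤ φ x) → -(K * ∫ x, φ x) ≤ ∫ x, ⟪nflux n (gradient w x), gradient φ x⟫_ℝ) →
      ∀ (i : Fin n) (α : ℝ), (∀ t ∈ Icc α (α + 1), 1 ≤ |t| ∧ |t| ≤ M) →
        ∃ t ∈ Icc α (α + 1), ∀ x y : Euc n, x i = t → y i = t → (∀ j, |x j| ≤ M) →
          (∀ j, |y j| ≤ M) → |Real.arsinh (w x) - Real.arsinh (w y)| ≤ c := by
  obtain ⟨d, rfl⟩ : ∃ d, n = d + 1 := ⟨n - 1, by omega⟩
  have hM0 : 0 < M := by linarith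
  obtain ⟨E, hE0, hE⟩ := log_energy hn (K := K) (R := (d + 1 : ℕ) * M) (by positivity)
  obtain ⟨C, hC0, hC⟩ := exists_good_slice (d := d) (by omega) hM0
  obtain ⟨c, hc0, hc⟩ := exists_pow_eq (n := d + 1) (by omega) (mul_nonneg hC0 hE0)
  refine ⟨c, fun w hw hw0 hweak i α hα => ?_⟩
  obtain ⟨t, ht, h⟩ := hC _ hw.arsinh i α
  refine ⟨t, ht, fun x y hx hy hxM hyM => ?_⟩
  have h1 := h x y hx hy (fun j => hxM _) (fun j => hyM _)
  have hsub : slab d i α M ⊆ ann (d + 1) 1 ((d + 1 : ℕ) * M) := by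
    intro z hz
    have h1 := hα _ hz.1
    refine ⟨h1.1.trans (abs_coord_le_norm z i), norm_le_mul_of_forall_abs_le fun j => ?_⟩
    exact Fin.succAboveCases i h1.2 hz.2 j
  have h2 : ∫ z in slab d i α M, ‖gradient (fun x => Real.arsinh (w x)) z‖ ^ (d + 1) ≤ E := by
    refine (setIntegral_mono_set ?_ (ae_of_all _ fun x => by positivity)
      (LE.le.eventuallyLE hsub)).trans (hE w hw hw0 hweak hK)
    exact integrableOn_of_continuous (isCompact_ann _ _ _)
      ((continuous_gradient hw.arsinh).norm.pow _)
  have h3 : |Real.arsinh (w x) - Real.arsinh (w y)| ^ (d + 1) ≤ c ^ (d + 1) := by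
    rw [hc]; exact h1.trans (by gcongr)
  exact (pow_le_pow_iff_left₀ (abs_nonneg _) hc0 (by omega)).1 h3

/-- Harnack's inequality on the spherical shell `2 n + 1 ≤ |x| ≤ 2 n + 2`. -/
theorem harnack {n : ℕ} (hn : 2 ≤ n) {K : ℝ} (hK : 0 ≤ K) :
    ∃ C : ℝ, 1 ≤ C ∧ ∀ w : Euc n → ℝ, ContDiff ℝ 1 w →
      (∀ x ∈ region n (n * (2 * n + 4)), 0 ≤ w x) →
      (∀ φ : Euc n → ℝ, ContDiff ℝ 1 φ → HasCompactSupport φ →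
        tsupport φ ⊆ region n (n * (2 * n + 4)) → (∀ x, 0 ≤ φ x) →
        |∫ x, ⟪nflux n (gradient w x), gradient φ x⟫_ℝ| ≤ K * ∫ x, φ x) →
      ∀ x y : Euc n, 2 * n + 1 ≤ ‖x‖ → ‖x‖ ≤ 2 * n + 2 → 2 * n + 1 ≤ ‖y‖ → ‖y‖ ≤ 2 * n + 2 →
        w x + 1 ≤ C * (w y + 1) := by
  set M : ℝ := 2 * n + 4 with hM
  have hn2 : (2 : ℝ) ≤ n := by exact_mod_cast hn
  obtain ⟨c, hc⟩ := exists_slice_osc_le hn hK (M := M) (by linarith)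
  set Λ := 2 * Real.exp (4 * |c|) with hΛ
  have hΛ1 : 1 ≤ Λ := by
    have : 1 ≤ Real.exp (4 * |c|) := Real.one_le_exp (by positivity)
    linarith
  set A := Real.exp (n * M) * (K + 1) * Real.exp (n * M) with hA
  have hA0 : 0 ≤ A := by positivity
  refine ⟨Λ ^ 2 * (1 + A) + A + 1, by nlinarith [sq_nonneg Λ], fun w hw hw0 hweak x y hx1 hx2 hy1 hy2 => ?_⟩
  have hg := hc w hw hw0 fun φ a b d e => by
    have h1 := hweak φ a b d e
    have := neg_abs_le (∫ x, ⟪nflux n (gradient w x), gradient φ x⟫_ℝ)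
    linarith
  choose f1 hf1 hg1 using fun i => hg i 1 fun t ht => by
    rw [abs_of_nonneg (by linarith [ht.1])]; exact ⟨ht.1, by linarith [ht.2]⟩
  choose f2 hf2 hg2 using fun i => hg i (-2) fun t ht => by
    rw [abs_of_nonpos (by linarith [ht.2])]; constructor <;> linarith [ht.1, ht.2]
  choose f3 hf3 hg3 using fun i => hg i (M - 1) fun t ht => by
    rw [abs_of_nonneg (by linarith [ht.1])]; constructor <;> linarith [ht.1, ht.2]
  choose f4 hf4 hg4 using fun i => hg i (-M) fun t ht => by
    rw [abs_of_nonpos (by linarith [ht.2])]; constructor <;> linarith [ht.1, ht.2]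
  set S : Fin n → Set ℝ := fun i => {f1 i, f2 i, f3 i, f4 i} with hS
  have hSM : ∀ i, ∀ t ∈ S i, |t| ≤ M := by
    rintro i t (rfl | rfl | rfl | rfl)
    · exact abs_le.2 ⟨by linarith [(hf1 i).1], by linarith [(hf1 i).2]⟩
    · exact abs_le.2 ⟨by linarith [(hf2 i).1], by linarith [(hf2 i).2]⟩
    · exact abs_le.2 ⟨by linarith [(hf3 i).1], by linarith [(hf3 i).2]⟩
    · exact abs_le.2 ⟨by linarith [(hf4 i).1], by linarith [(hf4 i).2]⟩
  have hosc : ∀ {x y : Euc n} {i k : Fin n}, x i ∈ S i → y k ∈ S k → (∀ j, |x j| ≤ M) →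
      (∀ j, |y j| ≤ M) → |Real.arsinh (w x) - Real.arsinh (w y)| ≤ 4 * |c| := by
    intro x y i k hi hk hx hy
    refine abs_sub_le_of_slices hn (G := fun x => Real.arsinh (w x)) (fun i => ⟨f1 i, by simp [hS]⟩)
      hSM ?_ hi hk hx hy
    rintro i t (rfl | rfl | rfl | rfl) x y hx hy hxM hyM
    · exact (hg1 i x y hx hy hxM hyM).trans (le_abs_self _)
    · exact (hg2 i x y hx hy hxM hyM).trans (le_abs_self _)
    · exact (hg3 i x y hx hy hxM hyM).trans (le_abs_self _)
    · exact (hg4 i x y hx hy hxM hyM).trans (le_abs_self _)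
  obtain ⟨hDo, hDc⟩ := frontier_shell (n := n) (f1 := f1) (f2 := f2) (f3 := f3) (f4 := f4)
  set D := {x : Euc n | (∀ j, f4 j < x j ∧ x j < f3 j) ∧ ∃ j, x j < f2 j ∨ f1 j < x j} with hD
  have hcM : ∀ x ∈ closure D, ∀ j, |x j| ≤ M := fun x hx j =>
    abs_le.2 ⟨by linarith [((hDc x hx).1 j).1, (hf4 j).1], by linarith [((hDc x hx).1 j).2, (hf3 j).2]⟩
  have hcr : ∀ x ∈ closure D, x ∈ ann n 1 (n * M) := by
    intro x hx
    refine ⟨?_, norm_le_mul_of_forall_abs_le (hcM x hx)⟩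
    obtain ⟨j, hj⟩ := (hDc x hx).2.1
    refine le_trans ?_ (abs_coord_le_norm x j)
    rcases hj with hj | hj
    · rw [abs_of_nonpos (by linarith [(hf2 j).2])]; linarith [(hf2 j).2]
    · rw [abs_of_nonneg (by linarith [(hf1 j).1])]; linarith [(hf1 j).1]
  have hreg : ∀ x ∈ closure D, x ∈ region n (n * M) := fun x hx =>
    ⟨by linarith [(hcr x hx).1], by linarith [(hcr x hx).2]⟩
  have hshell : ∀ x : Euc n, 2 * n + 1 ≤ ‖x‖ → ‖x‖ ≤ 2 * n + 2 → x ∈ D := by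
    intro x h1 h2
    refine ⟨fun j => ?_, ?_⟩
    · have := (abs_coord_le_norm x j).trans h2
      rw [abs_le] at this
      exact ⟨by linarith [(hf4 j).2], by linarith [(hf3 j).1]⟩
    · by_contra! hne
      have : ‖x‖ ≤ n * 2 := norm_le_mul_of_forall_abs_le fun j =>
        abs_le.2 ⟨by linarith [(hne j).1, (hf2 j).1], by linarith [(hne j).2, (hf1 j).2]⟩
      linarith
  set i0 : Fin n := ⟨0, by omega⟩
  set z : Euc n := WithLp.toLp 2 fun j => if j = i0 then f1 i0 else 0 with hz
  have hzi : z i0 ∈ S i0 := by simp [hz, hS]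
  have hzM : ∀ j, |z j| ≤ M := by
    intro j
    simp only [hz]
    split_ifs
    · exact hSM i0 _ (by simp [hS])
    · rw [abs_zero]; linarith
  have hz0 : 0 ≤ w z := by
    refine hw0 z ⟨?_, ?_⟩
    · have h1 : z i0 = f1 i0 := by simp [hz]
      have h2 := abs_coord_le_norm z i0
      rw [h1] at h2
      linarith [le_abs_self (f1 i0), (hf1 i0).1]
    · have := norm_le_mul_of_forall_abs_le hzM
      linarith
  refine harnack_of_frontier hn hK hΛ1 hDo
    (fun x hx => by simpa using (hcr x (subset_closure hx)).2) hw
    (fun x hx => hw0 x (hreg x (subset_closure hx))) (z := z) ?_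
    (fun φ a b d e => hweak φ a b (fun x hx => hreg x (subset_closure (d hx))) e)
    (hshell x hx1 hx2) (hshell y hy1 hy2)
  intro p hp
  have hpc := frontier_subset_closure hp
  have hpD : p ∉ D := by
    rw [hDo.frontier_eq] at hp; exact hp.2
  obtain ⟨j, hj⟩ := (hDc p hpc).2.2 hpD
  have hpj : p j ∈ S j := by simpa [hS] using hj
  have hp0 := hw0 p (hreg p hpc)
  exact ⟨add_one_le_of_abs_arsinh_sub_le hz0 (hosc hpj hzi (hcM p hpc) hzM),
    add_one_le_of_abs_arsinh_sub_le hp0 (hosc hzi hpj hzM (hcM p hpc))⟩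


/-! ### Scaling and the pointwise upper bound -/

/-- The rescaled function `y ↦ u (x₀ + r y) + n log r`. -/
noncomputable def rescale {n : ℕ} (u : Euc n → ℝ) (x₀ : Euc n) (r : ℝ) (y : Euc n) : ℝ :=
  u (x₀ + r • y) + n * Real.log r

theorem integral_comp_affine {n : ℕ} (f : Euc n → ℝ) (x₀ : Euc n) {r : ℝ} (hr : 0 < r) :
    ∫ y, f (x₀ + r • y) = (r ^ n)⁻¹ * ∫ x, f x := by
  have := Measure.integral_comp_smul (volume : Measure (Euc n)) (fun z => f (x₀ + z)) r
  rw [this, integral_add_left_eq_self, finrank_euclideanSpace_fin, smul_eq_mul,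
    abs_of_pos (by positivity)]

theorem exp_rescale {n : ℕ} (u : Euc n → ℝ) (x₀ : Euc n) {r : ℝ} (hr : 0 < r) (y : Euc n) :
    Real.exp (rescale u x₀ r y) = r ^ n * Real.exp (u (x₀ + r • y)) := by
  rw [rescale, Real.exp_add, mul_comm, Real.exp_nat_mul, Real.exp_log hr]

theorem hasGradientAt_comp_affine {n : ℕ} {u : Euc n → ℝ} (hu : ContDiff ℝ 1 u) (x₀ : Euc n)
    (r : ℝ) (y : Euc n) :
    HasGradientAt (fun y => u (x₀ + r • y)) (r • gradient u (x₀ + r • y)) y := by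
  have h1 : HasFDerivAt (fun y : Euc n => x₀ + r • y) (r • ContinuousLinearMap.id ℝ (Euc n)) y :=
    ((hasFDerivAt_id y).const_smul r).const_add x₀
  have h2 := (hu.differentiable one_ne_zero (x₀ + r • y)).hasFDerivAt
  rw [hasGradientAt_iff_hasFDerivAt]
  refine (h2.comp y h1).congr_fderiv ?_
  ext z
  simp

theorem Sol.rescale {n : ℕ} (hn : 2 ≤ n) {u : Euc n → ℝ} (h : Sol n u) (x₀ : Euc n) {r : ℝ}
    (hr : 0 < r) : Sol n (rescale u x₀ r) := by
  have hu := h.contDiff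
  refine ⟨?_, ?_, ?_⟩
  · unfold NLaplace.rescale; fun_prop
  · simp only [exp_rescale u x₀ hr]
    refine Integrable.const_mul ?_ _
    have h1 : Integrable fun z => Real.exp (u (x₀ + z)) := h.integrable.comp_add_left x₀
    exact h1.comp_smul hr.ne'
  · intro φ hφ hφs
    set ψ : Euc n → ℝ := fun x => φ (-(r⁻¹ • x₀) + r⁻¹ • x) with hψ
    have hψφ : ∀ y, ψ (x₀ + r • y) = φ y := fun y => by
      simp [hψ, smul_add, smul_smul, hr.ne']
    have hψc : ContDiff ℝ 1 ψ := by fun_prop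
    have hψs : HasCompactSupport ψ := by
      refine hφs.comp_homeomorph ((Homeomorph.smulOfNeZero r⁻¹ (inv_ne_zero hr.ne')).trans
        (Homeomorph.addLeft (-(r⁻¹ • x₀))))
    have hψg : ∀ y, r • gradient ψ (x₀ + r • y) = gradient φ y := fun y => by
      have := hasGradientAt_comp_affine hψc x₀ r y
      simp only [hψφ] at this
      exact this.gradient.symm
    have hg : ∀ y, gradient (NLaplace.rescale u x₀ r) y = r • gradient u (x₀ + r • y) := fun y => by
      have := hasGradientAt_comp_affine hu x₀ r y
      refine HasGradientAt.gradient ?_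
      rw [hasGradientAt_iff_hasFDerivAt] at *
      exact this.add_const _
    have e1 : ∀ y, ⟪nflux n (gradient (NLaplace.rescale u x₀ r) y), gradient φ y⟫_ℝ =
        r ^ n * ⟪nflux n (gradient u (x₀ + r • y)), gradient ψ (x₀ + r • y)⟫_ℝ := fun y => by
      rw [hg, nflux_smul hn hr.le, ← hψg, real_inner_smul_left, real_inner_smul_right, ← mul_assoc,
        ← pow_succ, show n - 1 + 1 = n by omega]
    have e2 : ∀ y, Real.exp (NLaplace.rescale u x₀ r y) * φ y =
        r ^ n * (Real.exp (u (x₀ + r • y)) * ψ (x₀ + r • y)) := fun y => by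
      rw [exp_rescale u x₀ hr, hψφ, mul_assoc]
    simp only [e1, e2, integral_const_mul]
    rw [integral_comp_affine (fun x => ⟪nflux n (gradient u x), gradient ψ x⟫_ℝ) x₀ hr,
      integral_comp_affine (fun x => Real.exp (u x) * ψ x) x₀ hr, h.weak ψ hψc hψs]

theorem setIntegral_exp_rescale {n : ℕ} (u : Euc n → ℝ) (x₀ y₀ : Euc n) {r : ℝ} (hr : 0 < r)
    (s : ℝ) : ∫ y in ball y₀ s, Real.exp (rescale u x₀ r y) =
      ∫ x in ball (x₀ + r • y₀) (r * s), Real.exp (u x) := by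
  rw [← integral_indicator measurableSet_ball, ← integral_indicator measurableSet_ball]
  have : ∀ y, (ball y₀ s).indicator (fun y => Real.exp (rescale u x₀ r y)) y = r ^ n *
      (ball (x₀ + r • y₀) (r * s)).indicator (fun x => Real.exp (u x)) (x₀ + r • y) := fun y => by
    have hiff : x₀ + r • y ∈ ball (x₀ + r • y₀) (r * s) ↔ y ∈ ball y₀ s := by
      rw [mem_ball, mem_ball, dist_add_left, dist_smul₀, Real.norm_of_nonneg hr.le,
        mul_lt_mul_iff_right₀ hr]
    by_cases hy : y ∈ ball y₀ s
    · rw [indicator_of_mem hy, indicator_of_mem (hiff.2 hy), exp_rescale u x₀ hr]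
    · rw [indicator_of_notMem hy, indicator_of_notMem (fun h => hy (hiff.1 h)), mul_zero]
  simp only [this, integral_const_mul]
  rw [integral_comp_affine _ x₀ hr]
  field_simp

theorem hasGradientAt_const_sub {n : ℕ} {u : Euc n → ℝ} (hu : ContDiff ℝ 1 u) (k : ℝ) (x : Euc n) :
    HasGradientAt (fun x => k - u x) (-gradient u x) x := by
  have := hasGradientAt_of_contDiff hu x
  rw [hasGradientAt_iff_hasFDerivAt] at *
  rw [map_neg]
  exact this.const_sub k

theorem harnack_sol {n : ℕ} (hn : 2 ≤ n) (k : ℝ) :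
    ∃ C : ℝ, 1 ≤ C ∧ ∀ u : Euc n → ℝ, Sol n u →
      (∀ x ∈ region n (n * (2 * n + 4)), u x ≤ k) →
      ∀ x y : Euc n, 2 * n + 1 ≤ ‖x‖ → ‖x‖ ≤ 2 * n + 2 → 2 * n + 1 ≤ ‖y‖ → ‖y‖ ≤ 2 * n + 2 →
        k - u x + 1 ≤ C * (k - u y + 1) := by
  obtain ⟨C, hC1, hC⟩ := harnack hn (Real.exp_pos k).le
  refine ⟨C, hC1, fun u hu huk x y hx1 hx2 hy1 hy2 => ?_⟩
  refine hC (fun x => k - u x) (contDiff_const.sub hu.contDiff) (fun x hx => sub_nonneg.2 (huk x hx))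
    (fun φ hφ hφs hφt hφ0 => ?_) x y hx1 hx2 hy1 hy2
  simp only [(hasGradientAt_const_sub hu.contDiff k _).gradient, nflux_neg, inner_neg_left,
    integral_neg, abs_neg]
  rw [hu.weak φ hφ hφs, abs_of_nonneg (integral_nonneg fun x => mul_nonneg (Real.exp_pos _).le (hφ0 x)),
    ← integral_const_mul]
  have huc := hu.contDiff.continuous
  have hφc := hφ.continuous
  refine integral_mono (Continuous.integrable_of_hasCompactSupport (by fun_prop) hφs.mul_left)
    ((hφc.integrable_of_hasCompactSupport hφs).const_mul _) fun x => ?_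
  by_cases hx : x ∈ tsupport φ
  · exact mul_le_mul_of_nonneg_right (Real.exp_le_exp.2 (huk x (hφt hx))) (hφ0 x)
  · simp [image_eq_zero_of_notMem_tsupport hx]

/-- A solution which is large at the origin has a definite amount of mass in the unit ball. -/
theorem exists_le_ball_mass {n : ℕ} (hn : 2 ≤ n) : ∃ c C : ℝ, 0 < c ∧ ∀ u : Euc n → ℝ, Sol n u →
    C ≤ u 0 → c ≤ ∫ x in ball 0 1, Real.exp (u x) := by
  have hn2 : (2 : ℝ) ≤ n := by exact_mod_cast hn
  obtain ⟨H, hH1, hH⟩ := harnack_sol hn (n * Real.log 2)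
  set ρ : ℝ := n * (2 * n + 4) + 1 + (2 * n + 2) with hρ
  have hρ0 : 0 < ρ := by positivity
  set B : ℝ := H * (n * Real.log 2 + 1) with hB
  refine ⟨Real.exp (-B) * volume.real (ball (0 : Euc n) (1 / 2)), n * Real.log (2 * ρ), ?_,
    fun u hu hu0 => ?_⟩
  · have : 0 < volume.real (ball (0 : Euc n) (1 / 2)) :=
      ENNReal.toReal_pos (measure_ball_pos _ _ (by norm_num)).ne' measure_ball_lt_top.ne
    positivity
  have huc := hu.contDiff.continuous
  obtain ⟨p, hp, hmax⟩ := (isCompact_closedBall (0 : Euc n) 1).exists_isMaxOn ⟨0, by simp⟩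
    (f := fun x => (1 - ‖x‖) ^ n * Real.exp (u x)) (by fun_prop)
  have hp1 : ‖p‖ ≤ 1 := by simpa using hp
  have h0 : (2 * ρ) ^ n ≤ (1 - ‖p‖) ^ n * Real.exp (u p) := by
    have h1 : (1 - ‖(0 : Euc n)‖) ^ n * Real.exp (u 0) ≤ (1 - ‖p‖) ^ n * Real.exp (u p) :=
      hmax (by simp)
    rw [norm_zero, sub_zero, one_pow, one_mul] at h1
    refine le_trans ?_ h1
    rw [← Real.exp_log (show 0 < 2 * ρ by positivity), ← Real.exp_nat_mul]
    exact Real.exp_le_exp.2 hu0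
  set r := Real.exp (-(u p) / n) with hr
  have hr0 : 0 < r := Real.exp_pos _
  have hnr : n * Real.log r = -u p := by
    rw [hr, Real.log_exp]; field_simp
  have hrn : Real.exp (u p) * r ^ n = 1 := by
    rw [hr, ← Real.exp_nat_mul, ← Real.exp_add]
    have : u p + n * (-(u p) / n) = 0 := by field_simp; ring
    rw [this, Real.exp_zero]
  have hσ : 2 * ρ * r ≤ 1 - ‖p‖ := by
    refine (pow_le_pow_iff_left₀ (by positivity) (by linarith) (by omega : n ≠ 0)).1 ?_
    calc (2 * ρ * r) ^ n = (2 * ρ) ^ n * r ^ n := mul_pow _ _ _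
      _ ≤ (1 - ‖p‖) ^ n * Real.exp (u p) * r ^ n := by gcongr
      _ = (1 - ‖p‖) ^ n := by rw [mul_assoc, hrn, mul_one]
  have hpos : 0 < 1 - ‖p‖ := lt_of_lt_of_le (by positivity) hσ
  have hup : ∀ x, ‖x - p‖ ≤ (1 - ‖p‖) / 2 → u x ≤ u p + n * Real.log 2 := by
    intro x hx
    have hxn : ‖x‖ ≤ ‖x - p‖ + ‖p‖ := by simpa using norm_add_le (x - p) p
    have h1 : (1 - ‖x‖) ^ n * Real.exp (u x) ≤ (1 - ‖p‖) ^ n * Real.exp (u p) :=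
      hmax (by simp; linarith)
    have h2 : ((1 - ‖p‖) / 2) ^ n ≤ (1 - ‖x‖) ^ n := pow_le_pow_left₀ (by linarith) (by linarith) n
    have h3 : ((1 - ‖p‖) / 2) ^ n * Real.exp (u x) ≤ (1 - ‖p‖) ^ n * Real.exp (u p) :=
      (mul_le_mul_of_nonneg_right h2 (Real.exp_pos _).le).trans h1
    have h4 : Real.exp (u x) ≤ 2 ^ n * Real.exp (u p) := by
      rw [div_pow, div_mul_eq_mul_div, div_le_iff₀ (by positivity), mul_assoc] at h3
      have := le_of_mul_le_mul_left h3 (pow_pos hpos n)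
      linarith
    rw [← Real.exp_le_exp, Real.exp_add, Real.exp_nat_mul, Real.exp_log two_pos]
    linarith
  have : Nontrivial (Euc n) := nontrivial_euc hn
  obtain ⟨e, he⟩ := exists_norm_eq (Euc n) (show (0 : ℝ) ≤ 2 * n + 3 / 2 by positivity)
  set v := rescale u (p + r • e) r with hv
  have hvs : Sol n v := hu.rescale hn _ hr0
  have hve : ∀ y, v y = u (p + r • (y + e)) - u p := fun y => by
    rw [hv, rescale, hnr, smul_add, add_assoc, add_comm (r • e)]; ring
  have hvk : ∀ x ∈ region n (n * (2 * n + 4)), v x ≤ n * Real.log 2 := by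
    intro x hx
    rw [hve]
    have h1 : ‖p + r • (x + e) - p‖ ≤ (1 - ‖p‖) / 2 := by
      rw [add_sub_cancel_left, norm_smul, Real.norm_of_nonneg hr0.le]
      have h2 := norm_add_le x e
      have h3 : ‖x + e‖ ≤ ρ := by rw [hρ]; linarith [hx.2]
      nlinarith
    linarith [hup _ h1]
  have hlow : ∀ y ∈ ball (-e) (1 / 2), -B ≤ v y := by
    intro y hy
    rw [mem_ball, dist_eq_norm, sub_neg_eq_add] at hy
    have h1 : ‖e‖ ≤ ‖y + e‖ + ‖y‖ := by simpa using norm_sub_le (y + e) y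
    have h2 : ‖y‖ ≤ ‖y + e‖ + ‖e‖ := by simpa using norm_sub_le (y + e) e
    have h3 := hH v hvs hvk y (-e) (by linarith) (by linarith) (by rw [norm_neg]; linarith)
      (by rw [norm_neg]; linarith)
    have h4 : v (-e) = 0 := by rw [hve]; simp
    rw [h4, sub_zero] at h3
    have : 0 ≤ n * Real.log 2 := by positivity
    linarith
  have hmass : Real.exp (-B) * volume.real (ball (0 : Euc n) (1 / 2)) ≤
      ∫ y in ball (-e) (1 / 2), Real.exp (v y) := by
    have hvol : volume.real (ball (0 : Euc n) (1 / 2)) = volume.real (ball (-e) (1 / 2)) := by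
      rw [measureReal_def, measureReal_def, Measure.addHaar_ball_center volume (-e)]
    calc _ = ∫ y in ball (-e) (1 / 2), Real.exp (-B) := by
          rw [setIntegral_const, smul_eq_mul, hvol, mul_comm]
      _ ≤ _ := setIntegral_mono_on (integrableOn_const measure_ball_lt_top.ne)
          hvs.integrable.integrableOn measurableSet_ball
          fun y hy => Real.exp_le_exp.2 (hlow y hy)
  refine hmass.trans ?_
  rw [hv, setIntegral_exp_rescale u _ _ hr0]
  refine setIntegral_mono_set hu.integrable.integrableOn (ae_of_all _ fun x => (Real.exp_pos _).le)
    (LE.le.eventuallyLE fun x hx => ?_)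
  rw [mem_ball, smul_neg, add_neg_cancel_right, dist_eq_norm] at hx
  rw [mem_ball_zero_iff]
  have hxn : ‖x‖ ≤ ‖x - p‖ + ‖p‖ := by simpa using norm_add_le (x - p) p
  have : ρ * r ≥ 1 * r := by gcongr; rw [hρ]; nlinarith
  linarith

theorem le_sub_log {n : ℕ} (hn : 2 ≤ n) {u : Euc n → ℝ} (hu : Sol n u) :
    ∃ C : ℝ, ∀ x, 1 ≤ ‖x‖ → u x ≤ C - n * Real.log ‖x‖ := by
  obtain ⟨c, C, hc, hC⟩ := exists_le_ball_mass hn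
  have ht : Tendsto (fun r : ℝ => ∫ x in ball 0 r, Real.exp (u x)) atTop (𝓝 (mass u)) :=
    (aecover_ball tendsto_id).integral_tendsto_of_countably_generated hu.integrable
  obtain ⟨r, hr, hr1⟩ := ((ht.eventually (lt_mem_nhds (sub_lt_self _ hc))).and
    (eventually_ge_atTop 1)).exists
  have huc := hu.contDiff.continuous
  obtain ⟨q, -, hq⟩ := (isCompact_closedBall (0 : Euc n) (2 * r)).exists_isMaxOn
    ⟨0, by simp; linarith⟩ huc.continuousOn
  refine ⟨max (C + n * Real.log 2) (u q + n * Real.log (2 * r)), fun x hx => ?_⟩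
  rcases le_total ‖x‖ (2 * r) with hxr | hxr
  · have h1 : u x ≤ u q := hq (by simpa using hxr)
    have h2 : Real.log ‖x‖ ≤ Real.log (2 * r) := Real.log_le_log (by linarith) hxr
    have h3 : n * Real.log ‖x‖ ≤ n * Real.log (2 * r) := by gcongr
    linarith [le_max_right (C + n * Real.log 2) (u q + n * Real.log (2 * r))]
  · have hR : 0 < ‖x‖ / 2 := by linarith
    by_contra! hcon
    have h1 := hC _ (hu.rescale hn x hR) (by
      rw [rescale, smul_zero, add_zero, Real.log_div (by linarith) two_ne_zero]
      linarith [le_max_left (C + n * Real.log 2) (u q + n * Real.log (2 * r))])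
    rw [setIntegral_exp_rescale u x 0 hR, smul_zero, add_zero, mul_one] at h1
    have hd : Disjoint (ball (0 : Euc n) r) (ball x (‖x‖ / 2)) := by
      refine ball_disjoint_ball ?_
      rw [dist_zero_left]; linarith
    have h2 := setIntegral_union hd measurableSet_ball hu.integrable.integrableOn
      hu.integrable.integrableOn
    have h3 : ∫ x in ball 0 r ∪ ball x (‖x‖ / 2), Real.exp (u x) ≤ mass u :=
      setIntegral_le_integral hu.integrable (ae_of_all _ fun x => (Real.exp_pos _).le)
    linarith


/-! ### Comparison with radial functions -/

section Radial

variable {n : ℕ} {G κ κ' : ℝ → ℝ}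

theorem nflux_gradient_radial (hn : 2 ≤ n) {x : Euc n} (hx : x ≠ 0) {g : ℝ}
    (hG : HasDerivAt G (-g) (Real.log ‖x‖)) (hg : 0 ≤ g) :
    nflux n (gradient (fun x : Euc n => G (Real.log ‖x‖)) x) = -((g ^ (n - 1) / ‖x‖ ^ n) • x) := by
  have hx' : 0 < ‖x‖ := norm_pos_iff.2 hx
  rw [(hasGradientAt_radial hx hG).gradient, neg_div, neg_smul, nflux_neg,
    nflux_smul hn (by positivity), nflux, smul_smul]
  obtain ⟨k, rfl⟩ := Nat.exists_eq_add_of_le' hn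
  rw [show k + 2 - 1 = k + 1 by omega, show k + 2 - 2 = k by omega]
  congr 2
  rw [div_pow, div_mul_eq_mul_div, div_eq_div_iff (by positivity) (by positivity)]
  ring

theorem integral_nflux_radial (hn : 2 ≤ n) (hG : ∀ t, HasDerivAt G (-κ t) t)
    (hκ : ∀ t, HasDerivAt κ (κ' t) t) (hκ' : Continuous κ') {φ : Euc n → ℝ} (hφ : ContDiff ℝ 1 φ)
    (hφs : HasCompactSupport φ) (h0 : (0 : Euc n) ∉ tsupport φ)
    (hpos : ∀ x ∈ tsupport φ, 0 ≤ κ (Real.log ‖x‖)) :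
    ∫ x, ⟪nflux n (gradient (fun x : Euc n => G (Real.log ‖x‖)) x), gradient φ x⟫_ℝ =
      ∫ x, (n - 1 : ℕ) * κ (Real.log ‖x‖) ^ (n - 2) * κ' (Real.log ‖x‖) / ‖x‖ ^ n * φ x := by
  have hκc : Continuous κ := continuous_iff_continuousAt.2 fun t => (hκ t).continuousAt
  have e1 : ∀ x : Euc n, ⟪nflux n (gradient (fun x : Euc n => G (Real.log ‖x‖)) x), gradient φ x⟫_ℝ =
      -(κ (Real.log ‖x‖) ^ (n - 1) / ‖x‖ ^ n * ⟪x, gradient φ x⟫_ℝ) := by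
    intro x
    by_cases hx : x ∈ tsupport φ
    · have hx0 : x ≠ 0 := fun h => h0 (h ▸ hx)
      rw [nflux_gradient_radial hn hx0 (hG _) (hpos x hx), inner_neg_left, real_inner_smul_left]
    · rw [gradient_eq_zero_of_notMem_tsupport hx, inner_zero_right, inner_zero_right, mul_zero, neg_zero]
  have hH : ∀ r > 0, HasDerivAt (fun r => κ (Real.log r) ^ (n - 1))
      ((n - 1 : ℕ) * κ (Real.log r) ^ (n - 2) * (κ' (Real.log r) * r⁻¹)) r := by
    intro r hr
    have := ((hκ (Real.log r)).comp r (Real.hasDerivAt_log (ne_of_gt hr))).pow (n - 1)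
    rwa [show n - 1 - 1 = n - 2 by omega] at this
  have hH' : ContinuousOn (fun r => (n - 1 : ℕ) * κ (Real.log r) ^ (n - 2) * (κ' (Real.log r) * r⁻¹))
      (Ioi 0) := by
    have hl : ContinuousOn Real.log (Ioi 0) := Real.continuousOn_log.mono fun r hr => ne_of_gt hr
    have hi : ContinuousOn (fun r : ℝ => r⁻¹) (Ioi 0) := continuousOn_inv₀.mono fun r hr => ne_of_gt hr
    exact ((continuousOn_const.mul ((hκc.comp_continuousOn hl).pow _))).mul
      ((hκ'.comp_continuousOn hl).mul hi)
  simp only [e1, integral_neg]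
  rw [integral_radial_mul hn hφ hφs h0 hH hH', neg_neg]
  refine integral_congr_ae (ae_of_all _ fun x => ?_)
  by_cases hx : x ∈ tsupport φ
  · have hx0 : 0 < ‖x‖ := norm_pos_iff.2 fun h => h0 (h ▸ hx)
    simp only
    congr 1
    rw [← div_eq_mul_inv, ← mul_div_assoc, div_div, ← pow_succ', show n - 1 + 1 = n by omega]
  · simp [image_eq_zero_of_notMem_tsupport hx]

/-- The open annulus with logarithmic radii `s` and `t`. -/
def shell (n : ℕ) (s t : ℝ) : Set (Euc n) := {x | Real.exp s < ‖x‖ ∧ ‖x‖ < Real.exp t}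

theorem isOpen_shell (s t : ℝ) : IsOpen (shell n s t) :=
  (isOpen_lt continuous_const continuous_norm).inter (isOpen_lt continuous_norm continuous_const)

theorem closure_shell_subset (s t : ℝ) : closure (shell n s t) ⊆ ann n (Real.exp s) (Real.exp t) :=
  closure_minimal (fun _ hx => ⟨hx.1.le, hx.2.le⟩) (isClosed_ann n _ _)

theorem norm_of_mem_frontier_shell {s t : ℝ} {x : Euc n} (hx : x ∈ frontier (shell n s t)) :
    ‖x‖ = Real.exp s ∨ ‖x‖ = Real.exp t := by
  rw [(isOpen_shell s t).frontier_eq] at hx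
  obtain ⟨h1, h2⟩ := closure_shell_subset s t hx.1
  by_contra! hne
  exact hx.2 ⟨lt_of_le_of_ne h1 hne.1.symm, lt_of_le_of_ne h2 hne.2⟩

theorem contDiffOn_radial (hG : ContDiff ℝ 1 G) :
    ContDiffOn ℝ 1 (fun x : Euc n => G (Real.log ‖x‖)) {0}ᶜ := fun _ hx =>
  (hG.contDiffAt.comp _ (contDiffAt_log_norm hx)).contDiffWithinAt

theorem shell_data {s t : ℝ} : Bornology.IsBounded (shell n s t) ∧
    closure (shell n s t) ⊆ ({0}ᶜ : Set (Euc n)) := by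
  refine ⟨isBounded_closedBall.subset fun x hx => mem_closedBall_zero_iff.2 hx.2.le, ?_⟩
  rintro x hx rfl
  have := (closure_shell_subset s t hx).1
  rw [norm_zero] at this
  linarith [Real.exp_pos s]

theorem contDiff_one_of_hasDerivAt {G g : ℝ → ℝ} (hG : ∀ t, HasDerivAt G (g t) t)
    (hg : Continuous g) : ContDiff ℝ 1 G := by
  rw [contDiff_one_iff_deriv]
  refine ⟨fun t => (hG t).differentiableAt, ?_⟩
  rwa [show deriv G = g from funext fun t => (hG t).deriv]

/-- The weak form of the radial operator is continuous with compact support on test functions. -/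
theorem integrable_radial (hκ : Continuous κ) {φ : Euc n → ℝ} (hφ : Continuous φ)
    (hφs : HasCompactSupport φ) (h0 : (0 : Euc n) ∉ tsupport φ) :
    Integrable fun x => κ (Real.log ‖x‖) / ‖x‖ ^ n * φ x := by
  refine Continuous.integrable_of_hasCompactSupport ?_ hφs.mul_left
  refine continuous_of_tsupport (η := φ) (fun x hx => ?_) fun x hx => ?_
  · have hx0 : x ≠ 0 := fun h => h0 (h ▸ hx)
    have h1 : ‖x‖ ^ n ≠ 0 := pow_ne_zero _ (norm_ne_zero_iff.2 hx0)
    have h2 : ContinuousAt (fun x : Euc n => Real.log ‖x‖) x :=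
      continuous_norm.continuousAt.log (norm_ne_zero_iff.2 hx0)
    exact ((hκ.continuousAt.comp h2).div (continuous_norm.continuousAt.pow n) h1).mul hφ.continuousAt
  · simp [image_eq_zero_of_notMem_tsupport hx]

theorem integrable_nflux_radial (hG : ∀ t, HasDerivAt G (-κ t) t) (hκ : Continuous κ)
    {φ : Euc n → ℝ} (hφ : ContDiff ℝ 1 φ) (hφs : HasCompactSupport φ)
    (h0 : (0 : Euc n) ∉ tsupport φ) :
    Integrable fun x => ⟪nflux n (gradient (fun x : Euc n => G (Real.log ‖x‖)) x), gradient φ x⟫_ℝ := by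
  have hGc : ContDiff ℝ 1 G := contDiff_one_of_hasDerivAt hG hκ.neg
  refine Continuous.integrable_of_hasCompactSupport ?_ ?_
  · refine continuous_of_tsupport (η := φ) (fun x hx => ?_) fun x hx => ?_
    · have hx0 : x ≠ 0 := fun h => h0 (h ▸ hx)
      have h1 : ContDiffAt ℝ 1 (fun x : Euc n => G (Real.log ‖x‖)) x :=
        hGc.contDiffAt.comp _ (contDiffAt_log_norm hx0)
      exact ((continuous_nflux n).continuousAt.comp (continuousAt_gradient h1)).inner
        (continuous_gradient hφ).continuousAt
    · simp only [gradient_eq_zero_of_notMem_tsupport hx, inner_zero_right]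
  · exact (hasCompactSupport_gradient hφs).mono fun x hx hx2 =>
      hx (by simp only [show gradient φ x = 0 from hx2, inner_zero_right])

theorem radial_le {u : Euc n → ℝ} (hn : 2 ≤ n) (hu : Sol n u) {A B s t : ℝ} (hB : 0 ≤ B)
    (hs : ∀ x, ‖x‖ = Real.exp s → A - B * s ≤ u x) (ht : ∀ x, ‖x‖ = Real.exp t → A - B * t ≤ u x)
    {x : Euc n} (hx : x ∈ shell n s t) : A - B * Real.log ‖x‖ ≤ u x := by
  have hG : ∀ t, HasDerivAt (fun t => A - B * t) (-B) t := fun t => by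
    simpa using ((hasDerivAt_id t).const_mul B).const_sub A
  obtain ⟨hb, hc⟩ := shell_data (n := n) (s := s) (t := t)
  refine comparison_principle hn (isOpen_shell s t) hb isOpen_compl_singleton hc
    (v := fun x => A - B * Real.log ‖x‖) (z := u)
    (contDiffOn_radial (G := fun t => A - B * t) (by fun_prop)) hu.contDiff.contDiffOn ?_ ?_ x hx
  · intro y hy
    rcases norm_of_mem_frontier_shell hy with h | h
    · simp only [h, Real.log_exp]; exact hs y h
    · simp only [h, Real.log_exp]; exact ht y h
  · intro φ hφ hφs hφt hφ0
    have h0 : (0 : Euc n) ∉ tsupport φ := fun h => hc (subset_closure (hφt h)) rfl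
    simp only [inner_sub_left]
    rw [integral_sub (integrable_nflux_radial (κ := fun _ => B) hG continuous_const hφ hφs h0)
      (integrable_inner_gradient (X := fun x => nflux n (gradient u x))
        ((continuous_nflux n).comp (continuous_gradient hu.contDiff)) hφ hφs),
      integral_nflux_radial hn (κ := fun _ => B) (κ' := fun _ => 0) hG
        (fun t => hasDerivAt_const t B) continuous_const hφ hφs h0 (fun _ _ => hB)]
    have : 0 ≤ ∫ x, ⟪nflux n (gradient u x), gradient φ x⟫_ℝ := by
      rw [hu.weak φ hφ hφs]
      exact integral_nonneg fun x => mul_nonneg (Real.exp_pos _).le (hφ0 x)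
    simpa using this

theorem le_radial {u : Euc n → ℝ} (hn : 2 ≤ n) (hu : Sol n u) {s t : ℝ}
    (hG : ∀ t, HasDerivAt G (-κ t) t) (hκ : ∀ t, HasDerivAt κ (κ' t) t) (hκ' : Continuous κ')
    (hpos : ∀ r, s ≤ r → 0 ≤ κ r)
    (hrhs : ∀ x : Euc n, Real.exp s < ‖x‖ → Real.exp (u x) ≤
      (n - 1 : ℕ) * κ (Real.log ‖x‖) ^ (n - 2) * κ' (Real.log ‖x‖) / ‖x‖ ^ n)
    (hs : ∀ x, ‖x‖ = Real.exp s → u x ≤ G s) (ht : ∀ x, ‖x‖ = Real.exp t → u x ≤ G t)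
    {x : Euc n} (hx : x ∈ shell n s t) : u x ≤ G (Real.log ‖x‖) := by
  have hκc : Continuous κ := continuous_iff_continuousAt.2 fun t => (hκ t).continuousAt
  obtain ⟨hb, hc⟩ := shell_data (n := n) (s := s) (t := t)
  refine comparison_principle hn (isOpen_shell s t) hb isOpen_compl_singleton hc
    (v := u) (z := fun x => G (Real.log ‖x‖)) hu.contDiff.contDiffOn
    (contDiffOn_radial (contDiff_one_of_hasDerivAt hG hκc.neg)) ?_ ?_ x hx
  · intro y hy
    rcases norm_of_mem_frontier_shell hy with h | h
    · simp only [h, Real.log_exp]; exact hs y h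
    · simp only [h, Real.log_exp]; exact ht y h
  · intro φ hφ hφs hφt hφ0
    have h0 : (0 : Euc n) ∉ tsupport φ := fun h => hc (subset_closure (hφt h)) rfl
    simp only [inner_sub_left]
    rw [integral_sub
      (integrable_inner_gradient (X := fun x => nflux n (gradient u x))
        ((continuous_nflux n).comp (continuous_gradient hu.contDiff)) hφ hφs)
      (integrable_nflux_radial hG hκc hφ hφs h0),
      integral_nflux_radial hn hG hκ hκ' hφ hφs h0 fun x hx => hpos _ ?_, hu.weak φ hφ hφs, sub_nonpos]
    · have huc := hu.contDiff.continuous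
      have hφc := hφ.continuous
      refine integral_mono (Continuous.integrable_of_hasCompactSupport (by fun_prop) hφs.mul_left)
        (integrable_radial (κ := fun r => (n - 1 : ℕ) * κ r ^ (n - 2) * κ' r) (by fun_prop) hφc hφs h0)
        fun x => ?_
      by_cases hx : x ∈ tsupport φ
      · exact mul_le_mul_of_nonneg_right (hrhs x (hφt hx).1) (hφ0 x)
      · simp [image_eq_zero_of_notMem_tsupport hx]
    · rw [Real.le_log_iff_exp_le ((Real.exp_pos s).trans (hφt hx).1)]
      exact (hφt hx).1.le

theorem le_of_le_on_sphere {u : Euc n → ℝ} (hn : 2 ≤ n) (hu : Sol n u) {a r : ℝ} (hr : 0 < r)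
    (ha : ∀ x, ‖x‖ = r → a ≤ u x) {x : Euc n} (hx : ‖x‖ ≤ r) : a ≤ u x := by
  rcases hx.eq_or_lt with hx | hx
  · exact ha x hx
  refine comparison_principle hn (isOpen_ball (x := (0 : Euc n)) (ε := r)) isBounded_ball isOpen_univ
    (subset_univ _) (v := fun _ => a) (z := u) contDiffOn_const hu.contDiff.contDiffOn ?_ ?_ x
    (mem_ball_zero_iff.2 hx)
  · intro y hy
    rw [frontier_ball _ hr.ne', mem_sphere_zero_iff_norm] at hy
    exact ha y hy
  · intro φ hφ hφs _ hφ0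
    have : ∀ x, gradient (fun _ : Euc n => a) x = 0 := fun x => by simp
    have h0 : nflux n (0 : Euc n) = 0 := by simp [nflux]
    simp only [this, h0, zero_sub, inner_neg_left, integral_neg, Left.neg_nonpos_iff]
    rw [hu.weak φ hφ hφs]
    exact integral_nonneg fun x => mul_nonneg (Real.exp_pos _).le (hφ0 x)

end Radial

/-- The minimum of `u` over the sphere of radius `e^t`. -/
noncomputable def sphMin {n : ℕ} (u : Euc n → ℝ) (t : ℝ) : ℝ := sInf (u '' sphere 0 (Real.exp t))

section SphMin

variable {n : ℕ} {u : Euc n → ℝ}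

theorem exists_sphMin (hn : 2 ≤ n) (hu : Sol n u) (t : ℝ) :
    ∃ x, ‖x‖ = Real.exp t ∧ u x = sphMin u t ∧ ∀ y, ‖y‖ = Real.exp t → sphMin u t ≤ u y := by
  have := nontrivial_euc hn
  have hne : (sphere (0 : Euc n) (Real.exp t)).Nonempty :=
    NormedSpace.sphere_nonempty.2 (Real.exp_pos t).le
  obtain ⟨x, hx, h, hle⟩ := (isCompact_sphere (0 : Euc n) (Real.exp t)).exists_sInf_image_eq_and_le
    hne hu.contDiff.continuous.continuousOn
  refine ⟨x, by simpa using hx, h.symm, fun y hy => ?_⟩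
  rw [sphMin, h]
  exact hle y (by simpa using hy)

theorem sphMin_le (hn : 2 ≤ n) (hu : Sol n u) {t : ℝ} {x : Euc n} (hx : ‖x‖ ≤ Real.exp t) :
    sphMin u t ≤ u x := by
  obtain ⟨-, -, -, h⟩ := exists_sphMin hn hu t
  exact le_of_le_on_sphere hn hu (Real.exp_pos t) h hx

theorem antitone_sphMin (hn : 2 ≤ n) (hu : Sol n u) : Antitone (sphMin u) := by
  intro s t hst
  obtain ⟨x, hx, h, -⟩ := exists_sphMin hn hu s
  rw [← h]
  exact sphMin_le hn hu (hx.le.trans (Real.exp_le_exp.2 hst))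

theorem sphMin_concave (hn : 2 ≤ n) (hu : Sol n u) {s t r : ℝ} (hst : s < t) (htr : t < r) :
    (sphMin u s - sphMin u t) * (r - s) ≤ (sphMin u s - sphMin u r) * (t - s) := by
  set B := (sphMin u s - sphMin u r) / (r - s) with hB
  have hB0 : 0 ≤ B := div_nonneg (sub_nonneg.2 (antitone_sphMin hn hu (by linarith))) (by linarith)
  have hBr : B * (r - s) = sphMin u s - sphMin u r := div_mul_cancel₀ _ (by linarith)
  obtain ⟨x, hx, h, -⟩ := exists_sphMin hn hu t
  obtain ⟨-, -, -, h1⟩ := exists_sphMin hn hu s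
  obtain ⟨-, -, -, h2⟩ := exists_sphMin hn hu r
  have := radial_le hn hu (A := sphMin u s + B * s) hB0 (s := s) (t := r)
    (fun y hy => by linarith [h1 y hy]) (fun y hy => by linarith [h2 y hy]) (x := x)
    ⟨by rw [hx]; exact Real.exp_lt_exp.2 hst, by rw [hx]; exact Real.exp_lt_exp.2 htr⟩
  rw [hx, Real.log_exp, h] at this
  have h3 : sphMin u s - sphMin u t ≤ B * (t - s) := by linarith
  rw [← hBr]
  nlinarith

end SphMin


section Asymptotics

variable {n : ℕ} {u : Euc n → ℝ}

theorem sub_le_mul_log (hn : 2 ≤ n) (hu : Sol n u) {β : ℝ} (hβ : 0 ≤ β)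
    (hβm : n * omegaN n * β ^ (n - 1) = mass u) {r1 r2 a b : ℝ} (h1 : 0 < r1) (h12 : r1 ≤ r2)
    (hb : ∀ x, ‖x‖ < r1 → b ≤ u x) (ha : ∀ x, r2 < ‖x‖ → u x ≤ a) :
    b - a - 2 ≤ β * Real.log (r2 / r1) := by
  have hlog : 0 ≤ Real.log (r2 / r1) := Real.log_nonneg ((one_le_div h1).2 h12)
  have h := cap_pow_le hn hu h1 h12 hb ha
  rw [← hβm, mul_assoc _ (β ^ (n - 1)), ← mul_pow] at h
  have h2 := le_of_mul_le_mul_left h (mul_omegaN_pos hn)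
  exact (sub_two_le_ramp a b).trans (le_of_pow_le_pow_left₀ (by omega) (by positivity) h2)

theorem exists_rescale_le (hn : 2 ≤ n) (hu : Sol n u) :
    ∃ k, ∀ R, 2 ≤ R → ∀ x : Euc n, 1 / 2 < ‖x‖ → rescale u 0 R x ≤ k := by
  obtain ⟨C, hC⟩ := le_sub_log hn hu
  refine ⟨C + n * Real.log 2, fun R hR x hx => ?_⟩
  have hx0 : 0 < ‖x‖ := by linarith
  have hnorm : ‖(0 : Euc n) + R • x‖ = R * ‖x‖ := by
    rw [zero_add, norm_smul, Real.norm_of_nonneg (by linarith)]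
  have h := hC (0 + R • x) (by rw [hnorm]; nlinarith)
  rw [hnorm, Real.log_mul (by linarith) hx0.ne'] at h
  have h2 : -Real.log 2 ≤ Real.log ‖x‖ := by
    rw [← Real.log_inv]
    exact Real.log_le_log (by norm_num) (by linarith)
  have h3 : (n : ℝ) * (-Real.log 2) ≤ n * Real.log ‖x‖ := by gcongr
  simp only [rescale]
  linarith

theorem exists_le_sphMin (hn : 2 ≤ n) (hu : Sol n u) :
    ∃ C K t₀ : ℝ, 1 ≤ C ∧ ∀ t, t₀ ≤ t → ∀ y : Euc n, ‖y‖ = Real.exp t →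
      u y ≤ sphMin u t / C + K := by
  obtain ⟨k, hk⟩ := exists_rescale_le hn hu
  obtain ⟨C, hC1, hC⟩ := harnack_sol hn k
  have hC0 : 0 < C := by linarith
  refine ⟨C, |k| + 1, Real.log (2 * (2 * n + 1)), hC1, fun t ht y hy => ?_⟩
  have hn1 : (0 : ℝ) < 2 * n + 1 := by positivity
  set R := Real.exp t / (2 * n + 1) with hR
  have hR2 : 2 ≤ R := by
    rw [hR, le_div_iff₀ hn1, ← Real.log_le_iff_le_exp (by positivity)]
    exact ht
  have hR0 : 0 < R := by linarith
  obtain ⟨x, hx, hxm, -⟩ := exists_sphMin hn hu t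
  have hres : ∀ z : Euc n, rescale u 0 R (R⁻¹ • z) = u z + n * Real.log R := fun z => by
    rw [rescale, zero_add, smul_inv_smul₀ hR0.ne']
  have hno : ∀ z : Euc n, ‖z‖ = Real.exp t → ‖R⁻¹ • z‖ = 2 * n + 1 := fun z hz => by
    rw [norm_smul, Real.norm_of_nonneg (by positivity), hz, hR]
    field_simp
  have h := hC _ (hu.rescale hn 0 hR0) (fun z hz => hk R hR2 z hz.1) (R⁻¹ • x) (R⁻¹ • y)
    (hno x hx).ge (by linarith [hno x hx]) (hno y hy).ge (by linarith [hno y hy])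
  rw [hres, hres, hxm] at h
  have hlog : 0 ≤ n * Real.log R := mul_nonneg (by positivity) (Real.log_nonneg (by linarith))
  rw [← sub_le_iff_le_add, le_div_iff₀ hC0]
  nlinarith [le_abs_self k, mul_nonneg (sub_nonneg.2 hC1) (sub_nonneg.2 (le_abs_self k)), abs_nonneg k,
    mul_nonneg (sub_nonneg.2 hC1) hlog]

theorem nonpos_of_forall_mul_le {a c r₀ : ℝ} (h : ∀ r, r₀ ≤ r → a * r ≤ c) : a ≤ 0 := by
  by_contra! ha
  have h1 := h (max r₀ ((c + 1) / a)) (le_max_left _ _)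
  have h2 := mul_le_mul_of_nonneg_left (le_max_right r₀ ((c + 1) / a)) ha.le
  rw [mul_div_cancel₀ _ ha.ne'] at h2
  linarith

theorem exists_sphMin_ge (hn : 2 ≤ n) (hu : Sol n u) :
    ∃ B t₁ : ℝ, 0 < t₁ ∧ ∀ t, t₁ ≤ t → sphMin u 0 - sphMin u t ≤ B * t := by
  obtain ⟨C, K, t₀, hC1, hC⟩ := exists_le_sphMin hn hu
  obtain ⟨C₁, hC₁⟩ := le_sub_log hn hu
  have hC0 : 0 < C := by linarith
  have hn2 : (2 : ℝ) ≤ n := by exact_mod_cast hn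
  obtain ⟨β, hβ, hβm⟩ := exists_pow_eq (n := n - 1) (by omega)
    (div_nonneg (mass_pos hu).le (mul_omegaN_pos hn).le)
  replace hβm : n * omegaN n * β ^ (n - 1) = mass u := by
    rw [hβm, mul_div_cancel₀ _ (mul_omegaN_pos hn).ne']
  set p₀ := sphMin u 0 with hp₀
  refine ⟨β * (2 * C) + 2, max 1 (max t₀ (C₁ + |2 * p₀ - p₀ / C - K|)), by positivity, fun t ht => ?_⟩
  obtain ⟨ht1, ht0, ht2⟩ : 1 ≤ t ∧ t₀ ≤ t ∧ C₁ + |2 * p₀ - p₀ / C - K| ≤ t := by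
    simpa [max_le_iff] using ht
  set T := 2 * C * t with hT
  have hTt : t < T := by nlinarith
  have hpt : sphMin u t ≤ C₁ - n * t := by
    obtain ⟨x, hx, hxm, -⟩ := exists_sphMin hn hu t
    have := hC₁ x (by rw [hx]; exact Real.one_le_exp (by linarith))
    rwa [hx, Real.log_exp, hxm] at this
  have hptK : sphMin u t ≤ 2 * p₀ - p₀ / C - K := by
    nlinarith [neg_abs_le (2 * p₀ - p₀ / C - K)]
  have hconc := sphMin_concave hn hu (s := 0) (t := t) (r := T) (by linarith) hTt
  have hconc2 : 2 * C * (p₀ - sphMin u t) ≤ p₀ - sphMin u T := by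
    refine le_of_mul_le_mul_right ?_ (show 0 < t by linarith)
    calc 2 * C * (p₀ - sphMin u t) * t = (p₀ - sphMin u t) * (T - 0) := by rw [hT]; ring
      _ ≤ (p₀ - sphMin u T) * (t - 0) := hconc
      _ = _ := by ring
  have hdiv : sphMin u T / C ≤ p₀ / C - 2 * (p₀ - sphMin u t) := by
    rw [div_le_iff₀ hC0, sub_mul, div_mul_cancel₀ _ hC0.ne']
    linarith
  have key := sub_le_mul_log hn hu hβ hβm (r1 := 1) (r2 := Real.exp T) (a := sphMin u t) (b := p₀)
    one_pos (Real.one_le_exp (by linarith))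
    (fun x hx => sphMin_le hn hu (by rw [Real.exp_zero]; exact hx.le)) fun x hx => ?_
  · rw [div_one, Real.log_exp] at key
    nlinarith
  · have hx0 : 0 < ‖x‖ := (Real.exp_pos T).trans hx
    have hTx : T ≤ Real.log ‖x‖ := (Real.le_log_iff_exp_le hx0).2 hx.le
    have h1 := hC (Real.log ‖x‖) (by linarith) x (Real.exp_log hx0).symm
    have h2 : sphMin u (Real.log ‖x‖) / C ≤ sphMin u T / C :=
      div_le_div_of_nonneg_right (antitone_sphMin hn hu hTx) hC0.le
    linarith

/-- The spherical minimum has an asymptotic logarithmic slope `-b`. -/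
theorem exists_slope (hn : 2 ≤ n) (hu : Sol n u) :
    ∃ b : ℝ, 0 ≤ b ∧ (∀ t, 0 ≤ t → sphMin u 0 - b * t ≤ sphMin u t) ∧
      (∀ a < b, ∃ t₁ > 0, ∀ t, t₁ ≤ t → sphMin u t ≤ sphMin u 0 - a * t) ∧
      ∀ s t, 0 ≤ s → s < t → sphMin u s - sphMin u t ≤ b * (t - s) := by
  obtain ⟨B, T₁, hT₁, hB⟩ := exists_sphMin_ge hn hu
  set q : ℝ → ℝ := fun t => (sphMin u 0 - sphMin u t) / t with hq
  have hmono : ∀ s t, 0 < s → s ≤ t → q s ≤ q t := by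
    intro s t hs hst
    rcases hst.eq_or_lt with rfl | hst
    · exact le_rfl
    rw [hq]
    simp only
    rw [div_le_div_iff₀ hs (hs.trans hst)]
    simpa using sphMin_concave hn hu hs hst
  have hqB : ∀ t, 0 < t → q t ≤ B := by
    intro t ht
    refine (hmono t (max t T₁) ht (le_max_left _ _)).trans ?_
    exact (div_le_iff₀ (ht.trans_le (le_max_left _ _))).2 (hB _ (le_max_right _ _))
  obtain ⟨b, hb⟩ : ∃ b, IsLUB (q '' Ioi 0) b :=
    Real.exists_isLUB ⟨q 1, 1, mem_Ioi.2 one_pos, rfl⟩ ⟨B, by rintro _ ⟨t, ht, rfl⟩; exact hqB t ht⟩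
  have hqb : ∀ t, 0 < t → q t ≤ b := fun t ht => hb.1 ⟨t, ht, rfl⟩
  have hlow : ∀ t, 0 ≤ t → sphMin u 0 - b * t ≤ sphMin u t := by
    intro t ht
    rcases ht.eq_or_lt with rfl | ht
    · simp
    · linarith [(div_le_iff₀ ht).1 (hqb t ht)]
  refine ⟨b, ?_, hlow, ?_, ?_⟩
  · exact le_trans (div_nonneg (sub_nonneg.2 (antitone_sphMin hn hu zero_le_one)) zero_le_one)
      (hqb 1 one_pos)
  · intro a hab
    obtain ⟨_, ⟨t₁, ht₁, rfl⟩, h1, -⟩ := hb.exists_between hab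
    refine ⟨t₁, ht₁, fun t ht => ?_⟩
    have h2 : a < q t := h1.trans_le (hmono _ _ ht₁ ht)
    linarith [(lt_div_iff₀ (lt_of_lt_of_le ht₁ ht)).1 h2]
  · intro s t hs hst
    have := nonpos_of_forall_mul_le (a := sphMin u s - sphMin u t - b * (t - s)) (r₀ := t + 1)
      (c := (sphMin u s - sphMin u 0) * (t - s) + s * (sphMin u s - sphMin u t)) fun r hr => by
        have h1 := sphMin_concave hn hu hst (show t < r by linarith)
        have h2 := mul_le_mul_of_nonneg_right (hlow r (by linarith)) (sub_nonneg.2 hst.le)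
        nlinarith
    linarith

end Asymptotics


section Asymptotics

variable {n : ℕ} {u : Euc n → ℝ} {b : ℝ}

theorem sphMin_log_le (hn : 2 ≤ n) (hu : Sol n u) {x : Euc n} (hx : 0 < ‖x‖) :
    sphMin u (Real.log ‖x‖) ≤ u x :=
  sphMin_le hn hu (Real.exp_log hx).ge

theorem lt_slope (hn : 2 ≤ n) (hu : Sol n u)
    (hlow : ∀ t, 0 ≤ t → sphMin u 0 - b * t ≤ sphMin u t) : (n : ℝ) < b := by
  by_contra! hbn
  have hω := mul_omegaN_pos hn
  have h : Real.exp (sphMin u 0) * (n * omegaN n) ≤ 0 := by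
    refine nonpos_of_forall_mul_le (r₀ := 0) (c := mass u) fun t ht => ?_
    have h1 : (1 : ℝ) ≤ Real.exp t := Real.one_le_exp ht
    have hi := integral_annulus hn one_pos h1
    rw [div_one, Real.log_exp] at hi
    rw [mul_assoc, ← hi, ← integral_const_mul]
    refine (setIntegral_mono_on (g := fun x => Real.exp (u x)) ((integrable_annulus one_pos).const_mul _)
      hu.integrable.integrableOn (isClosed_ann n _ _).measurableSet fun x hx => ?_).trans
      (setIntegral_le_integral hu.integrable (ae_of_all _ fun x => (Real.exp_pos _).le))
    have hx0 : 0 < ‖x‖ := one_pos.trans_le hx.1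
    have hL : 0 ≤ Real.log ‖x‖ := Real.log_nonneg hx.1
    rw [← Real.exp_log (show 0 < (‖x‖ ^ n)⁻¹ by positivity), ← Real.exp_add, Real.exp_le_exp,
      Real.log_inv, Real.log_pow]
    have := mul_le_mul_of_nonneg_right hbn hL
    linarith [hlow _ hL, sphMin_log_le hn hu hx0]
  linarith [mul_pos (Real.exp_pos (sphMin u 0)) hω]

theorem gradient_sub_const' (v : Euc n → ℝ) (m : ℝ) (x : Euc n) :
    gradient (fun x => v x - m) x = gradient v x := by
  rw [gradient, gradient, fderiv_sub_const]

theorem exists_le_sphMin_add (hn : 2 ≤ n) (hu : Sol n u)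
    (hslope : ∀ s t, 0 ≤ s → s < t → sphMin u s - sphMin u t ≤ b * (t - s)) :
    ∃ C t₀ : ℝ, ∀ t, t₀ ≤ t → ∀ y : Euc n, ‖y‖ = Real.exp t → u y ≤ sphMin u t + C := by
  obtain ⟨k, hk⟩ := exists_rescale_le hn hu
  obtain ⟨C, hC1, hC⟩ := harnack hn (Real.exp_pos k).le
  have hn2 : (2 : ℝ) ≤ n := by exact_mod_cast hn
  have hn1 : (0 : ℝ) < 2 * n + 1 := by positivity
  set ρ : ℝ := n * (2 * n + 4) + 1 with hρ
  have hρ1 : 2 * n + 1 < ρ := by nlinarith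
  have hρ0 : 0 < ρ := by linarith
  refine ⟨C * (b * Real.log (ρ / (2 * n + 1)) + 1), max 0 (Real.log (2 * (2 * n + 1))),
    fun t ht y hy => ?_⟩
  obtain ⟨ht0, ht⟩ := max_le_iff.1 ht
  set R := Real.exp t / (2 * n + 1) with hR
  have hR2 : 2 ≤ R := by
    rw [hR, le_div_iff₀ hn1, ← Real.log_le_iff_le_exp (by positivity)]
    exact ht
  have hR0 : 0 < R := by linarith
  obtain ⟨x, hx, hxm, -⟩ := exists_sphMin hn hu t
  set τ := Real.log (ρ * R) with hτ
  have hτt : τ - t = Real.log (ρ / (2 * n + 1)) := by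
    rw [hτ, hR, ← mul_div_assoc, mul_div_right_comm, Real.log_mul (by positivity) (Real.exp_pos t).ne',
      Real.log_exp, add_sub_cancel_right]
  have hτ1 : t < τ := by
    have : 0 < Real.log (ρ / (2 * n + 1)) := Real.log_pos ((one_lt_div hn1).2 hρ1)
    linarith
  set m := sphMin u τ + n * Real.log R with hm
  have hres := hu.rescale hn 0 hR0
  have hval : ∀ z : Euc n, rescale u 0 R (R⁻¹ • z) - m = u z - sphMin u τ := fun z => by
    rw [rescale, zero_add, smul_inv_smul₀ hR0.ne', hm]
    ring
  have hno : ∀ z : Euc n, ‖z‖ = Real.exp t → ‖R⁻¹ • z‖ = 2 * n + 1 := fun z hz => by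
    rw [norm_smul, Real.norm_of_nonneg (by positivity), hz, hR]
    field_simp
  have h := hC (fun z => rescale u 0 R z - m) (hres.contDiff.sub contDiff_const) ?_ ?_
    (R⁻¹ • y) (R⁻¹ • x) (hno y hy).ge (by linarith [hno y hy]) (hno x hx).ge (by linarith [hno x hx])
  · simp only [hval, hxm] at h
    have h1 := hslope t τ ht0 hτ1
    rw [hτt] at h1
    have h2 : C * (sphMin u t - sphMin u τ + 1) ≤ C * (b * Real.log (ρ / (2 * n + 1)) + 1) := by gcongr
    linarith [antitone_sphMin hn hu hτ1.le]
  · intro z hz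
    have : sphMin u τ ≤ u (0 + R • z) := by
      refine sphMin_le hn hu ?_
      rw [zero_add, norm_smul, Real.norm_of_nonneg hR0.le, hτ, Real.exp_log (by positivity), mul_comm]
      exact mul_le_mul_of_nonneg_right hz.2.le hR0.le
    simp only [rescale, hm]
    linarith
  · intro φ hφ hφs hφt hφ0
    simp only [gradient_sub_const']
    rw [hres.weak φ hφ hφs,
      abs_of_nonneg (integral_nonneg fun x => mul_nonneg (Real.exp_pos _).le (hφ0 x)),
      ← integral_const_mul]
    have huc := hres.contDiff.continuous
    have hφc := hφ.continuous
    refine integral_mono (Continuous.integrable_of_hasCompactSupport (by fun_prop) hφs.mul_left)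
      ((hφc.integrable_of_hasCompactSupport hφs).const_mul _) fun x => ?_
    by_cases hx : x ∈ tsupport φ
    · exact mul_le_mul_of_nonneg_right (Real.exp_le_exp.2 (hk R hR2 x (hφt hx).1)) (hφ0 x)
    · simp [image_eq_zero_of_notMem_tsupport hx]

theorem exists_le_sub_log (hn : 2 ≤ n) (hu : Sol n u)
    (hlow : ∀ t, 0 ≤ t → sphMin u 0 - b * t ≤ sphMin u t)
    (hlim : ∀ a < b, ∃ t₁ > 0, ∀ t, t₁ ≤ t → sphMin u t ≤ sphMin u 0 - a * t)
    (hslope : ∀ s t, 0 ≤ s → s < t → sphMin u s - sphMin u t ≤ b * (t - s)) :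
    ∃ A, ∀ x, 1 ≤ ‖x‖ → u x ≤ A - b * Real.log ‖x‖ := by
  have hbn := lt_slope hn hu hlow
  have hn2 : (2 : ℝ) ≤ n := by exact_mod_cast hn
  have hb : 0 < b := by linarith
  obtain ⟨C, t₀, hC⟩ := exists_le_sphMin_add hn hu hslope
  obtain ⟨C₁, hC₁⟩ := le_sub_log hn hu
  set p₀ := sphMin u 0 with hp₀
  set δ := (b - n) / 2 with hδ
  have hδ0 : 0 < δ := by rw [hδ]; linarith
  obtain ⟨t₁, ht₁, hq⟩ := hlim (n + δ) (by linarith)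
  set c := Real.exp (p₀ + C) / ((b / 4) ^ (n - 2) * δ ^ 2) with hc
  have hc0 : 0 < c := by positivity
  obtain ⟨t₂, ht₂⟩ : ∃ t₂, ∀ t, t₂ ≤ t → c * δ * Real.exp (-δ * t) ≤ b / 4 := by
    have : Tendsto (fun t => c * δ * Real.exp (-δ * t)) atTop (𝓝 (c * δ * 0)) := by
      refine (Real.tendsto_exp_atBot.comp ?_).const_mul _
      exact tendsto_id.const_mul_atTop_of_neg (by linarith)
    rw [mul_zero] at this
    exact eventually_atTop.1 (this.eventually (ge_mem_nhds (show 0 < b / 4 by linarith)))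
  set s := max (max 0 t₀) (max t₁ t₂) with hs
  obtain ⟨⟨hs0, hst₀⟩, hst₁, hst₂⟩ : (0 ≤ s ∧ t₀ ≤ s) ∧ t₁ ≤ s ∧ t₂ ≤ s := by
    simp [hs]
  set A := p₀ + C + b * s + c with hA
  have hu1 : ∀ t, s ≤ t → ∀ x : Euc n, ‖x‖ = Real.exp t → u x ≤ sphMin u t + C := fun t ht =>
    hC t (hst₀.trans ht)
  have key : ∀ a, b / 2 < a → a < b → ∀ x : Euc n, Real.exp s < ‖x‖ →
      u x ≤ A - a * Real.log ‖x‖ := by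
    intro a ha1 ha2 x hx
    have hx0 : 0 < ‖x‖ := (Real.exp_pos s).trans hx
    obtain ⟨t₃, ht₃, hq₃⟩ := hlim a ha2
    set T := max t₃ (Real.log ‖x‖ + 1) with hT
    have hxT : Real.log ‖x‖ < T := lt_of_lt_of_le (by linarith) (le_max_right _ _)
    have hsx : s < Real.log ‖x‖ := (Real.lt_log_iff_exp_lt hx0).2 hx
    have hexp : ∀ t, HasDerivAt (fun t => Real.exp (-δ * t)) (Real.exp (-δ * t) * -δ) t := fun t => by
      simpa using ((hasDerivAt_id t).const_mul (-δ)).exp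
    have hle := le_radial hn hu (G := fun t => A - a * t - c * Real.exp (-δ * t))
      (κ := fun t => a - c * δ * Real.exp (-δ * t)) (κ' := fun t => c * δ ^ 2 * Real.exp (-δ * t))
      (s := s) (t := T) (x := x) ?_ ?_ (by fun_prop) ?_ ?_ ?_ ?_ ⟨hx, (Real.log_lt_iff_lt_exp hx0).1 hxT⟩
    · have : 0 ≤ c * Real.exp (-δ * Real.log ‖x‖) := by positivity
      linarith
    · intro t
      exact ((((hasDerivAt_id t).const_mul a).const_sub A).sub ((hexp t).const_mul c)).congr_deriv
        (by ring)
    · intro t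
      exact (((hexp t).const_mul (c * δ)).const_sub a).congr_deriv (by ring)
    · intro r hr
      linarith [ht₂ r (hst₂.trans hr)]
    · intro y hy
      have hy0 : 0 < ‖y‖ := (Real.exp_pos s).trans hy
      set L := Real.log ‖y‖ with hL
      have hsL : s ≤ L := (Real.le_log_iff_exp_le hy0).2 hy.le
      have h1 : u y ≤ p₀ + C - (n + δ) * L := by
        linarith [hu1 L hsL y (Real.exp_log hy0).symm, hq L (hst₁.trans hsL)]
      have h2 : ‖y‖ ^ n = Real.exp (n * L) := by rw [Real.exp_nat_mul, hL, Real.exp_log hy0]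
      have h3 : b / 4 ≤ a - c * δ * Real.exp (-δ * L) := by linarith [ht₂ L (hst₂.trans hsL)]
      have h4 : (1 : ℝ) ≤ (n - 1 : ℕ) := by exact_mod_cast (by omega : 1 ≤ n - 1)
      rw [h2, le_div_iff₀ (Real.exp_pos _)]
      calc Real.exp (u y) * Real.exp (n * L)
          ≤ Real.exp (p₀ + C - (n + δ) * L) * Real.exp (n * L) := by gcongr
        _ = Real.exp (p₀ + C) * Real.exp (-δ * L) := by
            rw [← Real.exp_add, ← Real.exp_add]; congr 1; ring
        _ = 1 * (b / 4) ^ (n - 2) * (c * δ ^ 2 * Real.exp (-δ * L)) := by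
            have : c * ((b / 4) ^ (n - 2) * δ ^ 2) = Real.exp (p₀ + C) :=
              div_mul_cancel₀ _ (by positivity)
            rw [← this]; ring
        _ ≤ _ := by gcongr
    · intro y hy
      have h1 := hu1 s le_rfl y hy
      have h2 : sphMin u s ≤ p₀ := antitone_sphMin hn hu hs0
      have h3 : a * s ≤ b * s := by gcongr
      have h4 : c * Real.exp (-δ * s) ≤ c * 1 := by
        gcongr
        exact Real.exp_le_one_iff.2 (by nlinarith)
      linarith
    · intro y hy
      have hsT : s ≤ T := (hsx.trans hxT).le
      have h1 := hu1 T hsT y hy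
      have h2 := hq₃ T (le_max_left _ _)
      have h4 : c * Real.exp (-δ * T) ≤ c * 1 := by
        gcongr
        exact Real.exp_le_one_iff.2 (by nlinarith)
      have h5 : 0 ≤ b * s := by positivity
      linarith
  refine ⟨max A (C₁ + b * s), fun x hx => ?_⟩
  have hx0 : 0 < ‖x‖ := one_pos.trans_le hx
  have hL : 0 ≤ Real.log ‖x‖ := Real.log_nonneg hx
  rcases le_or_gt ‖x‖ (Real.exp s) with h | h
  · have h1 : Real.log ‖x‖ ≤ s := (Real.log_le_iff_le_exp hx0).2 h
    have h2 : b * Real.log ‖x‖ ≤ b * s := by gcongr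
    have h3 : 0 ≤ n * Real.log ‖x‖ := by positivity
    linarith [hC₁ x hx, le_max_right A (C₁ + b * s)]
  · have h1 : Tendsto (fun a => A - a * Real.log ‖x‖) (𝓝[<] b) (𝓝 (A - b * Real.log ‖x‖)) :=
      Continuous.continuousWithinAt (by fun_prop)
    have h2 : u x ≤ A - b * Real.log ‖x‖ := by
      refine ge_of_tendsto h1 ?_
      filter_upwards [Ioo_mem_nhdsLT (show b / 2 < b by linarith)] with a ha
      exact key a ha.1 ha.2 x h
    linarith [le_max_left A (C₁ + b * s)]

theorem exists_abs_add_log_le (hn : 2 ≤ n) (hu : Sol n u) :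
    ∃ b A : ℝ, 0 < b ∧ 0 ≤ A ∧ ∀ x, 1 ≤ ‖x‖ → |u x + b * Real.log ‖x‖| ≤ A := by
  obtain ⟨b, -, hlow, hlim, hslope⟩ := exists_slope hn hu
  obtain ⟨A, hA⟩ := exists_le_sub_log hn hu hlow hlim hslope
  have hbn := lt_slope hn hu hlow
  have hb : 0 < b := lt_of_le_of_lt (Nat.cast_nonneg n) hbn
  refine ⟨b, max |A| |sphMin u 0|, hb, le_max_of_le_left (abs_nonneg _), fun x hx => ?_⟩
  have hx0 : 0 < ‖x‖ := one_pos.trans_le hx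
  rw [abs_le]
  constructor
  · linarith [hlow _ (Real.log_nonneg hx), sphMin_log_le hn hu hx0, neg_abs_le (sphMin u 0),
      le_max_right |A| |sphMin u 0|]
  · linarith [hA x hx, le_abs_self A, le_max_left |A| |sphMin u 0|]

theorem slope_eq (hn : 2 ≤ n) (hu : Sol n u) {β A : ℝ} (hβ : 0 ≤ β)
    (hβm : n * omegaN n * β ^ (n - 1) = mass u) (hb : 0 < b) (hA0 : 0 ≤ A)
    (hA : ∀ x, 1 ≤ ‖x‖ → |u x + b * Real.log ‖x‖| ≤ A) : b = β := by
  have hω := mul_omegaN_pos hn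
  have hm := mass_pos hu
  have hup : ∀ t, 0 ≤ t → ∀ x : Euc n, Real.exp t ≤ ‖x‖ → u x ≤ A - b * t := by
    intro t ht x hx
    have hx1 : 1 ≤ ‖x‖ := (Real.one_le_exp ht).trans hx
    have h1 : t ≤ Real.log ‖x‖ := (Real.le_log_iff_exp_le (one_pos.trans_le hx1)).2 hx
    have h2 : b * t ≤ b * Real.log ‖x‖ := by gcongr
    linarith [(abs_le.1 (hA x hx1)).2]
  refine le_antisymm ?_ ?_
  · refine sub_nonpos.1 (nonpos_of_forall_mul_le (r₀ := 0) (c := A + 2 - sphMin u 0) fun T hT => ?_)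
    have := sub_le_mul_log hn hu hβ hβm (r1 := 1) (r2 := Real.exp T) (a := A - b * T) (b := sphMin u 0)
      one_pos (Real.one_le_exp hT)
      (fun x hx => sphMin_le hn hu (by rw [Real.exp_zero]; exact hx.le)) fun x hx => hup T hT x hx.le
    rw [div_one, Real.log_exp] at this
    linarith
  · have h1 : ∀ s, 0 ≤ s → (∫ x in ball (0 : Euc n) (Real.exp s), Real.exp (u x)) ^ n ≤
        (b * mass u) ^ (n - 1) * (n * omegaN n) := by
      intro s hs
      set m := ∫ x in ball (0 : Euc n) (Real.exp s), Real.exp (u x) with hmdef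
      have hS : ∀ S, 2 < S → ((1 - 2 * S⁻¹) * m) ^ n ≤
          ((b + (2 * A + 2) * S⁻¹) * mass u) ^ (n - 1) * (n * omegaN n) := by
        intro S hS
        have hS0 : 0 < S := by linarith
        have hlog : Real.log (Real.exp (s + S) / Real.exp s) = S := by
          rw [← Real.exp_sub, Real.log_exp, add_sub_cancel_left]
        set a := -A - b * (s + S) with ha
        set τ := max 0 ((A - a + 1) / b) with hτ
        have hbτ : A - a + 1 ≤ b * τ := by
          rw [mul_comm, ← div_le_iff₀ hb]; exact le_max_right _ _
        have h := ball_mass_pow_le hn hu (r1 := Real.exp s) (r2 := Real.exp (s + S)) (a := a)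
          (b := A - b * s) (R := Real.exp τ) (Real.exp_pos s) (by rw [hlog]; exact hS) (Real.exp_pos _)
          (by rw [ha]; nlinarith) (fun x hx => ⟨?_, hup s hs x hx.1⟩)
          (fun x hx => by linarith [hup τ (le_max_left _ _) x hx.le])
        · rw [hlog, ← hmdef] at h
          have e1 : (1 - 2 * S⁻¹) * m = (S - 2) * m * S⁻¹ := by field_simp
          have e2 : (b + (2 * A + 2) * S⁻¹) * mass u = (A - b * s - a + 2) * mass u * S⁻¹ := by
            rw [ha]; field_simp; ring
          rw [e1, e2, mul_pow _ S⁻¹, mul_pow _ S⁻¹]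
          calc ((S - 2) * m) ^ n * S⁻¹ ^ n
              ≤ ((A - b * s - a + 2) * mass u) ^ (n - 1) * (n * omegaN n * S) * S⁻¹ ^ n := by gcongr
            _ = ((A - b * s - a + 2) * mass u) ^ (n - 1) * (n * omegaN n * S) *
                (S⁻¹ ^ (n - 1) * S⁻¹) := by rw [← pow_succ, show n - 1 + 1 = n by omega]
            _ = _ := by field_simp
        · have hx1 : 1 ≤ ‖x‖ := (Real.one_le_exp hs).trans hx.1
          have h1 : Real.log ‖x‖ ≤ s + S := (Real.log_le_iff_le_exp (one_pos.trans_le hx1)).2 hx.2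
          have h2 : b * Real.log ‖x‖ ≤ b * (s + S) := by gcongr
          linarith [(abs_le.1 (hA x hx1)).1]
      have hinv := tendsto_inv_atTop_zero (𝕜 := ℝ)
      have ht1 : Tendsto (fun S : ℝ => ((1 - 2 * S⁻¹) * m) ^ n) atTop (𝓝 (((1 - 2 * 0) * m) ^ n)) :=
        (((hinv.const_mul 2).const_sub 1).mul_const m).pow n
      have ht2 : Tendsto (fun S : ℝ => ((b + (2 * A + 2) * S⁻¹) * mass u) ^ (n - 1) * (n * omegaN n))
          atTop (𝓝 (((b + (2 * A + 2) * 0) * mass u) ^ (n - 1) * (n * omegaN n))) :=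
        ((((hinv.const_mul _).const_add b).mul_const _).pow _).mul_const _
      simpa using le_of_tendsto_of_tendsto ht1 ht2 ((eventually_gt_atTop 2).mono hS)
    have h2 : mass u ^ n ≤ (b * mass u) ^ (n - 1) * (n * omegaN n) := by
      have ht : Tendsto (fun r : ℝ => ∫ x in ball 0 r, Real.exp (u x)) atTop (𝓝 (mass u)) :=
        (aecover_ball tendsto_id).integral_tendsto_of_countably_generated hu.integrable
      exact le_of_tendsto ((ht.comp Real.tendsto_exp_atTop).pow n)
        ((eventually_ge_atTop 0).mono fun s hs => h1 s hs)
    rw [show mass u ^ n = mass u ^ (n - 1) * (n * omegaN n * β ^ (n - 1)) by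
      rw [hβm, ← pow_succ, show n - 1 + 1 = n by omega], mul_pow] at h2
    refine le_of_pow_le_pow_left₀ (n := n - 1) (by omega) hb.le ?_
    refine le_of_mul_le_mul_left ?_ (mul_pos (pow_pos hm (n - 1)) hω)
    linarith

end Asymptotics

theorem Sol.of_isWeakNSol {n : ℕ} {u : Euc n → ℝ} (hu : ContDiff ℝ 1 u)
    (hsol : IsWeakNSol n Set.univ u (fun x => Real.exp (u x)))
    (hint : Integrable (fun x => Real.exp (u x))) : Sol n u := by
  refine ⟨hu, hint, fun φ hφ hφs => ?_⟩
  have := hsol φ hφ hφs (subset_univ _)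
  simpa only [Measure.restrict_univ, nflux, real_inner_smul_left] using this

end NLaplace

theorem entire_solution_log_asymptotics
    (n : ℕ) (hn : 2 ≤ n)
    (u : EuclideanSpace ℝ (Fin n) → ℝ)
    (hu : ContDiff ℝ 1 u)
    (hsol : IsWeakNSol n Set.univ u (fun x => Real.exp (u x)))
    (hint : Integrable (fun x : EuclideanSpace ℝ (Fin n) => Real.exp (u x))) :
    ∃ C : ℝ, 0 < C ∧
      ∀ x : EuclideanSpace ℝ (Fin n), 1 ≤ ‖x‖ →
        |u x + ((1 / ((n : ℝ) * omegaN n)) *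
              ∫ y : EuclideanSpace ℝ (Fin n), Real.exp (u y)) ^ ((1 : ℝ) / ((n : ℝ) - 1)) *
            Real.log ‖x‖| ≤ C := by
  have hs := NLaplace.Sol.of_isWeakNSol hu hsol hint
  have hω := NLaplace.mul_omegaN_pos hn
  obtain ⟨b, A, hb, hA0, hA⟩ := NLaplace.exists_abs_add_log_le hn hs
  set β : ℝ := ((1 / ((n : ℝ) * omegaN n)) * NLaplace.mass u) ^ ((1 : ℝ) / ((n : ℝ) - 1)) with hβ
  have hm : 0 ≤ 1 / ((n : ℝ) * omegaN n) * NLaplace.mass u := by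
    have := NLaplace.mass_pos hs
    positivity
  have hβm : n * omegaN n * β ^ (n - 1) = NLaplace.mass u := by
    have hc : (n : ℝ) - 1 = (n - 1 : ℕ) := by
      rw [Nat.cast_sub (by omega), Nat.cast_one]
    rw [hβ, hc, one_div ((n - 1 : ℕ) : ℝ), Real.rpow_inv_natCast_pow hm (by omega),
      one_div, mul_inv_cancel_left₀ hω.ne']
  have hbβ := NLaplace.slope_eq hn hs (Real.rpow_nonneg hm _) hβm hb hA0 hA
  refine ⟨A + 1, by linarith, fun x hx => ?_⟩
  have := hA x hx
  rw [hbβ] at this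
  exact this.trans (by linarith)
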